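/- arXiv:math/9805121 — 12 statements merged into one kernel-verified Lean document; each statement's English description precedes it below -/
import Mathlib

section
/- Let a, b, c be complex numbers. The quartic curve Q(a,b,c) is nonsingular if and only if a² + b² + c² − abc − 4 ≠ 0 and a² ≠ 4 and b² ≠ 4 and c² ≠ 4. -/
open MvPolynomial

/-- `F a b c` is the homogeneous quartic
`X⁴ + Y⁴ + Z⁴ + a·X²Y² + b·X²Z² + c·Y²Z²` in `ℂ[X,Y,Z]`,
whose zero locus is the plane quartic curve `Q(a,b,c)`. -/
noncomputable def F (a b c : ℂ) : MvPolynomial (Fin 3) ℂ :=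
  X 0 ^ 4 + X 1 ^ 4 + X 2 ^ 4
    + C a * (X 0 ^ 2 * X 1 ^ 2)
    + C b * (X 0 ^ 2 * X 2 ^ 2)
    + C c * (X 1 ^ 2 * X 2 ^ 2)

/-- A point is singular on `Q(a,b,c)` exactly when each coordinate annihilates the corresponding
linear form in the squares of the coordinates. -/
theorem eval_pderiv_F_eq_zero_iff (a b c : ℂ) (p : Fin 3 → ℂ) :
    (∀ i : Fin 3, eval p (pderiv i (F a b c)) = 0) ↔
      p 0 * (2 * p 0 ^ 2 + a * p 1 ^ 2 + b * p 2 ^ 2) = 0 ∧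
      p 1 * (a * p 0 ^ 2 + 2 * p 1 ^ 2 + c * p 2 ^ 2) = 0 ∧
      p 2 * (b * p 0 ^ 2 + c * p 1 ^ 2 + 2 * p 2 ^ 2) = 0 := by
  have h0 : eval p (pderiv 0 (F a b c)) =
      2 * (p 0 * (2 * p 0 ^ 2 + a * p 1 ^ 2 + b * p 2 ^ 2)) := by
    simp [F, pderiv_X, Derivation.leibniz, Derivation.leibniz_pow]
    ring
  have h1 : eval p (pderiv 1 (F a b c)) =
      2 * (p 1 * (a * p 0 ^ 2 + 2 * p 1 ^ 2 + c * p 2 ^ 2)) := by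
    simp [F, pderiv_X, Derivation.leibniz, Derivation.leibniz_pow]
    ring
  have h2 : eval p (pderiv 2 (F a b c)) =
      2 * (p 2 * (b * p 0 ^ 2 + c * p 1 ^ 2 + 2 * p 2 ^ 2)) := by
    simp [F, pderiv_X, Derivation.leibniz, Derivation.leibniz_pow]
    ring
  rw [Fin.forall_fin_succ, Fin.forall_fin_two]
  change eval p (pderiv 0 (F a b c)) = 0 ∧ eval p (pderiv 1 (F a b c)) = 0 ∧
    eval p (pderiv 2 (F a b c)) = 0 ↔ _
  rw [h0, h1, h2]
  simp only [mul_eq_zero_iff_left (two_ne_zero' ℂ)]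

/-- A nonzero vector `(u, v, w)` such that each coordinate annihilates the corresponding linear
form yields a singular point, by extracting square roots. -/
theorem exists_singular_of_squares {a b c u v w : ℂ} (hne : ¬ (u = 0 ∧ v = 0 ∧ w = 0))
    (hu : u * (2 * u + a * v + b * w) = 0) (hv : v * (a * u + 2 * v + c * w) = 0)
    (hw : w * (b * u + c * v + 2 * w) = 0) :
    ∃ p : Fin 3 → ℂ, p ≠ 0 ∧ ∀ i : Fin 3, eval p (pderiv i (F a b c)) = 0 := by
  obtain ⟨x, rfl⟩ := IsAlgClosed.exists_pow_nat_eq u two_pos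
  obtain ⟨y, rfl⟩ := IsAlgClosed.exists_pow_nat_eq v two_pos
  obtain ⟨z, rfl⟩ := IsAlgClosed.exists_pow_nat_eq w two_pos
  refine ⟨![x, y, z], fun h => hne ?_, (eval_pderiv_F_eq_zero_iff a b c _).2 ?_⟩
  · have hx : x = 0 := congrFun h 0
    have hy : y = 0 := congrFun h 1
    have hz : z = 0 := congrFun h 2
    simp [hx, hy, hz]
  · simpa using And.intro hu (And.intro hv hw)

/-- The quartic curve `Q(a,b,c)` is nonsingular (there is no nonzero point of `ℂ³` at
which all three partial derivatives of `F a b c` vanish) if and only if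
`a² + b² + c² − abc − 4 ≠ 0`, `a² ≠ 4`, `b² ≠ 4`, and `c² ≠ 4`. -/
theorem quartic_nonsingular_iff (a b c : ℂ) :
    (¬ ∃ p : Fin 3 → ℂ, p ≠ 0 ∧ ∀ i : Fin 3, eval p (pderiv i (F a b c)) = 0) ↔
      (a ^ 2 + b ^ 2 + c ^ 2 - a * b * c - 4 ≠ 0 ∧ a ^ 2 ≠ 4 ∧ b ^ 2 ≠ 4 ∧ c ^ 2 ≠ 4) := by
  constructor
  · intro h
    refine ⟨fun hd => h ?_, fun ha => h ?_, fun hb => h ?_, fun hc => h ?_⟩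
    · have hdet : (!![2, a, b; a, 2, c; b, c, 2] : Matrix (Fin 3) (Fin 3) ℂ).det = 0 := by
        rw [Matrix.det_fin_three]
        simp
        linear_combination -2 * hd
      obtain ⟨q, hq, hq0⟩ := Matrix.exists_mulVec_eq_zero_iff.2 hdet
      have e0 : 2 * q 0 + a * q 1 + b * q 2 = 0 := by
        simpa [Matrix.mulVec, dotProduct, Fin.sum_univ_three] using congrFun hq0 0
      have e1 : a * q 0 + 2 * q 1 + c * q 2 = 0 := by
        simpa [Matrix.mulVec, dotProduct, Fin.sum_univ_three] using congrFun hq0 1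
      have e2 : b * q 0 + c * q 1 + 2 * q 2 = 0 := by
        simpa [Matrix.mulVec, dotProduct, Fin.sum_univ_three] using congrFun hq0 2
      refine exists_singular_of_squares (u := q 0) (v := q 1) (w := q 2) ?_
        (by rw [e0, mul_zero]) (by rw [e1, mul_zero]) (by rw [e2, mul_zero])
      rintro ⟨h0, h1, h2⟩
      refine hq (funext fun i => ?_)
      fin_cases i <;> assumption
    · exact exists_singular_of_squares (u := -a) (v := 2) (w := 0) (by simp)
        (by ring) (by linear_combination -2 * ha) (by ring)
    · exact exists_singular_of_squares (u := -b) (v := 0) (w := 2) (by simp)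
        (by ring) (by ring) (by linear_combination -2 * hb)
    · exact exists_singular_of_squares (u := 0) (v := -c) (w := 2) (by simp)
        (by ring) (by ring) (by linear_combination -2 * hc)
  · rintro ⟨hd, ha, hb, hc⟩ ⟨p, hp, h⟩
    obtain ⟨hx, hy, hz⟩ := (eval_pderiv_F_eq_zero_iff a b c p).1 h
    have hne : ¬ (p 0 = 0 ∧ p 1 = 0 ∧ p 2 = 0) := by
      rintro ⟨h0, h1, h2⟩
      refine hp (funext fun i => ?_)
      fin_cases i <;> assumption
    generalize p 0 = x at *
    generalize p 1 = y at *
    generalize p 2 = z at *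
    by_cases x0 : x = 0 <;> by_cases y0 : y = 0 <;> by_cases z0 : z = 0 <;>
      simp only [x0, y0, z0, mul_eq_zero, false_or] at hx hy hz
    · exact hne ⟨x0, y0, z0⟩
    · simp [z0] at hz
    · simp [y0] at hy
    · refine mul_ne_zero (sub_ne_zero.2 hc) (pow_ne_zero 2 y0) ?_
      linear_combination c * hz - 2 * hy
    · simp [x0] at hx
    · refine mul_ne_zero (sub_ne_zero.2 hb) (pow_ne_zero 2 x0) ?_
      linear_combination b * hz - 2 * hx
    · refine mul_ne_zero (sub_ne_zero.2 ha) (pow_ne_zero 2 x0) ?_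
      linear_combination a * hy - 2 * hx
    · refine mul_ne_zero (mul_ne_zero two_ne_zero hd) (pow_ne_zero 2 x0) ?_
      linear_combination (c ^ 2 - 4) * hx + (2 * a - b * c) * hy + (2 * b - a * c) * hz
end

section
/- Let (a,b,c) and (a',b',c') be triples of complex numbers. There exist a permutation σ of the three variables, nonzero complex scalars t₁, t₂, t₃, and a nonzero complex number λ such that substituting the variables of F(a,b,c) by the scaled permuted variables (t₁·X_{σ(1)}, t₂·X_{σ(2)}, t₃·X_{σ(3)}) yields λ·F(a',b',c'), if and only if there exist a permutation τ of {1,2,3} and signs δ₁, δ₂, δ₃ ∈ {1,−1} with δ₁δ₂δ₃ = 1 such that (a',b',c') = (δ₁·s_{τ(1)}, δ₂·s_{τ(2)}, δ₃·s_{τ(3)}), where (s₁,s₂,s₃) = (a,b,c). In other words, F(a',b',c') is obtained from F(a,b,c) by a substitution given by the product of a permutation matrix and an invertible diagonal matrix (up to a nonzero scalar) exactly when (a',b',c') is obtained from (a,b,c) by permuting the entries and changing the signs of an even number of them. -/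
open MvPolynomial

/-- The quartic with its mixed coefficients indexed by the variable missing from the monomial. -/
theorem F_eq_sum (u : Fin 3 → ℂ) :
    F (u 2) (u 1) (u 0) = ∑ i, (X i ^ 4 + C (u i) * ∏ j ∈ {i}ᶜ, X j ^ 2) := by
  have h0 : ({0}ᶜ : Finset (Fin 3)) = {1, 2} := by decide
  have h1 : ({1}ᶜ : Finset (Fin 3)) = {0, 2} := by decide
  have h2 : ({2}ᶜ : Finset (Fin 3)) = {0, 1} := by decide
  simp [F, Fin.sum_univ_three, h0, h1, h2]
  ring

theorem rename_F (σ : Equiv.Perm (Fin 3)) (u : Fin 3 → ℂ) :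
    rename σ (F (u (σ 2)) (u (σ 1)) (u (σ 0))) = F (u 2) (u 1) (u 0) := by
  rw [F_eq_sum u, F_eq_sum (fun i => u (σ i)), map_sum,
    ← Equiv.sum_comp σ (fun i => X i ^ 4 + C (u i) * ∏ j ∈ {i}ᶜ, X j ^ 2)]
  refine Finset.sum_congr rfl fun i _ => ?_
  have h : ({σ i}ᶜ : Finset (Fin 3)) = ({i}ᶜ : Finset (Fin 3)).map σ.toEmbedding := by
    ext j
    simp [Finset.mem_map_equiv, Equiv.symm_apply_eq]
  simp [h, Finset.prod_map]

theorem aeval_perm_F_eq_iff (σ : Equiv.Perm (Fin 3)) (t : Fin 3 → ℂ) (lam a b c : ℂ)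
    (u : Fin 3 → ℂ) :
    aeval (fun i => C (t i) * X (σ i)) (F a b c) = C lam * F (u 2) (u 1) (u 0) ↔
      aeval (fun i => C (t i) * X i) (F a b c) =
        C lam * F (u (σ 2)) (u (σ 1)) (u (σ 0)) := by
  have h : aeval (fun i => C (t i) * X (σ i)) (F a b c) =
      rename σ (aeval (fun i => C (t i) * X i) (F a b c)) := by
    rw [← AlgHom.comp_apply, comp_aeval]
    simp
  rw [h, ← rename_F σ u]
  nth_rw 1 [← rename_C σ lam]
  rw [← map_mul, (rename_injective σ σ.injective).eq_iff]

theorem aeval_diag_F_eq_iff (t : Fin 3 → ℂ) (lam a b c a' b' c' : ℂ) :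
    aeval (fun i => C (t i) * X i) (F a b c) = C lam * F a' b' c' ↔
      (∀ i, t i ^ 4 = lam) ∧ a * (t 0 ^ 2 * t 1 ^ 2) = lam * a' ∧
        b * (t 0 ^ 2 * t 2 ^ 2) = lam * b' ∧ c * (t 1 ^ 2 * t 2 ^ 2) = lam * c' := by
  constructor
  · intro h
    have ev (x y z : ℂ) := congrArg (eval ![x, y, z]) h
    simp [F] at ev
    have h0 : t 0 ^ 4 = lam := by simpa using ev 1 0 0
    have h1 : t 1 ^ 4 = lam := by simpa using ev 0 1 0
    have h2 : t 2 ^ 4 = lam := by simpa using ev 0 0 1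
    refine ⟨fun i => by fin_cases i <;> assumption, ?_, ?_, ?_⟩
    · linear_combination ev 1 1 0 - h0 - h1
    · linear_combination ev 1 0 1 - h0 - h2
    · linear_combination ev 0 1 1 - h1 - h2
  · rintro ⟨h, ha, hb, hc⟩
    refine MvPolynomial.funext fun x => ?_
    simp [F]
    linear_combination x 0 ^ 4 * h 0 + x 1 ^ 4 * h 1 + x 2 ^ 4 * h 2 + x 0 ^ 2 * x 1 ^ 2 * ha +
      x 0 ^ 2 * x 2 ^ 2 * hb + x 1 ^ 2 * x 2 ^ 2 * hc

theorem exists_diag_F_iff (a b c a' b' c' : ℂ) :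
    (∃ (t : Fin 3 → ℂ) (lam : ℂ), (∀ i, t i ≠ 0) ∧ lam ≠ 0 ∧
        aeval (fun i => C (t i) * X i) (F a b c) = C lam * F a' b' c') ↔
      ∃ ε : Fin 3 → ℂ, (∀ i, ε i = 1 ∨ ε i = -1) ∧ ε 0 * ε 1 * ε 2 = 1 ∧
        a' = ε 2 * a ∧ b' = ε 1 * b ∧ c' = ε 0 * c := by
  simp only [aeval_diag_F_eq_iff]
  constructor
  · rintro ⟨t, lam, -, hlam, h, ha, hb, hc⟩
    have sign (i j : Fin 3) : t i ^ 2 * t j ^ 2 / lam = 1 ∨ t i ^ 2 * t j ^ 2 / lam = -1 := by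
      rw [← sq_eq_one_iff, div_pow, div_eq_one_iff_eq (pow_ne_zero 2 hlam)]
      linear_combination t j ^ 4 * h i + lam * h j
    refine ⟨![t 1 ^ 2 * t 2 ^ 2 / lam, t 0 ^ 2 * t 2 ^ 2 / lam, t 0 ^ 2 * t 1 ^ 2 / lam],
      fun i => by fin_cases i <;> exact sign _ _, ?_, ?_, ?_, ?_⟩
    · simp only [Matrix.cons_val]
      field_simp
      linear_combination t 1 ^ 4 * t 2 ^ 4 * h 0 + lam * t 2 ^ 4 * h 1 + lam ^ 2 * h 2
    all_goals
      simp only [Matrix.cons_val]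
      field_simp
    · linear_combination -ha
    · linear_combination -hb
    · linear_combination -hc
  · rintro ⟨ε, hε, hprod, rfl, rfl, rfl⟩
    choose t ht using fun i => IsAlgClosed.exists_pow_nat_eq (ε i) two_pos
    have hsq (i : Fin 3) : ε i ^ 2 = 1 := sq_eq_one_iff.2 (hε i)
    refine ⟨t, 1, fun i hi => ?_, one_ne_zero, fun i => ?_, ?_, ?_, ?_⟩
    · have := hsq i
      simp [← ht, hi] at this
    · rw [← hsq i, ← ht i]
      ring
    · rw [ht, ht]
      linear_combination a * ε 2 * hprod - a * ε 0 * ε 1 * hsq 2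
    · rw [ht, ht]
      linear_combination b * ε 1 * hprod - b * ε 0 * ε 2 * hsq 1
    · rw [ht, ht]
      linear_combination c * ε 0 * hprod - c * ε 1 * ε 2 * hsq 0

/-- `F a' b' c'` is obtained from `F a b c` (up to a nonzero scalar `λ`) by a substitution
of variables given by the product of a permutation matrix and an invertible diagonal
matrix, i.e. the substitution `Xᵢ ↦ tᵢ · X_{σ(i)}` with all `tᵢ ≠ 0`, if and only if
`(a',b',c')` is obtained from `(a,b,c)` by permuting the entries and changing the signs
of an even number of them. -/
theorem strict_isomorphism_iff (a b c a' b' c' : ℂ) :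
    (∃ (σ : Equiv.Perm (Fin 3)) (t : Fin 3 → ℂ) (lam : ℂ),
        (∀ i, t i ≠ 0) ∧ lam ≠ 0 ∧
        aeval (fun i : Fin 3 => C (t i) * X (σ i)) (F a b c) = C lam * F a' b' c') ↔
    (∃ (τ : Equiv.Perm (Fin 3)) (δ : Fin 3 → ℂ),
        (∀ i, δ i = 1 ∨ δ i = -1) ∧ δ 0 * δ 1 * δ 2 = 1 ∧
        a' = δ 0 * ![a, b, c] (τ 0) ∧
        b' = δ 1 * ![a, b, c] (τ 1) ∧
        c' = δ 2 * ![a, b, c] (τ 2)) := by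
  have key (σ : Equiv.Perm (Fin 3)) (t : Fin 3 → ℂ) (lam : ℂ) :=
    aeval_perm_F_eq_iff σ t lam a b c ![c', b', a']
  simp only [Matrix.cons_val] at key
  simp only [key, exists_diag_F_iff]
  have hsign (ε : Fin 3 → ℂ) (σ : Equiv.Perm (Fin 3)) (h : ε 0 * ε 1 * ε 2 = 1) :
      ε (σ 0) * ε (σ 1) * ε (σ 2) = 1 := by
    rw [← h, ← Fin.prod_univ_three, ← Fin.prod_univ_three (fun i => ε (σ i)), Equiv.prod_comp]
  have hl (σ : Equiv.Perm (Fin 3)) (ε : Fin 3 → ℂ) :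
      (![c', b', a'] (σ 2) = ε 2 * a ∧ ![c', b', a'] (σ 1) = ε 1 * b ∧
        ![c', b', a'] (σ 0) = ε 0 * c) ↔
        ∀ i, ![c', b', a'] (σ i) = ε i * ![a, b, c] i.rev := by
    simp [Fin.forall_fin_succ, Fin.rev]
    tauto
  have hr (τ : Equiv.Perm (Fin 3)) (δ : Fin 3 → ℂ) :
      (a' = δ 0 * ![a, b, c] (τ 0) ∧ b' = δ 1 * ![a, b, c] (τ 1) ∧
        c' = δ 2 * ![a, b, c] (τ 2)) ↔
        ∀ i, ![c', b', a'] i.rev = δ i * ![a, b, c] (τ i) := by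
    simp [Fin.forall_fin_succ, Fin.rev]
  simp only [hl, hr]
  constructor
  · rintro ⟨σ, ε, hε, hprod, h⟩
    refine ⟨Fin.revPerm.trans (σ.symm.trans Fin.revPerm), fun i => ε (σ.symm i.rev),
      fun i => hε _, hsign ε (Fin.revPerm.trans σ.symm) hprod, fun i => ?_⟩
    simpa using h (σ.symm i.rev)
  · rintro ⟨τ, δ, hδ, hprod, h⟩
    refine ⟨Fin.revPerm.trans (τ.symm.trans Fin.revPerm), fun i => δ (τ.symm i.rev),
      fun i => hδ _, hsign δ (Fin.revPerm.trans τ.symm) hprod, fun i => ?_⟩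
    simpa using h (τ.symm i.rev)
end

section
/- Let a, b, d, e be complex numbers with d² = a + 2, d ≠ 0, and e² = d. Then substituting X ↦ (e/2)(X + Y), Y ↦ (e/2)(X − Y), Z ↦ Z into the polynomial F(−2 + 16/(a+2), 2b/d, 2b/d) yields exactly the polynomial F(a,b,b); that is, F(−2+16/(a+2), 2b/d, 2b/d)((e/2)(X+Y), (e/2)(X−Y), Z) = F(a,b,b)(X,Y,Z) as an identity of polynomials in ℂ[X,Y,Z]. -/
open MvPolynomial

/-- If `d² = a + 2`, `d ≠ 0`, and `e² = d`, then substituting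
`X ↦ (e/2)(X+Y)`, `Y ↦ (e/2)(X−Y)`, `Z ↦ Z` into
`F(−2 + 16/(a+2), 2b/d, 2b/d)` yields exactly `F(a, b, b)`. -/
theorem substitution_identity (a b d e : ℂ) (hd : d ^ 2 = a + 2) (hd0 : d ≠ 0)
    (he : e ^ 2 = d) :
    aeval
      (![C (e / 2) * (X 0 + X 1), C (e / 2) * (X 0 - X 1), X 2] :
        Fin 3 → MvPolynomial (Fin 3) ℂ)
      (F (-2 + 16 / (a + 2)) (2 * b / d) (2 * b / d)) = F a b b := by
  apply MvPolynomial.funext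
  intro v
  have ha : a = e ^ 4 - 2 := by linear_combination (e ^ 2 + d) * -he - hd
  have he0 : e ≠ 0 := by
    rintro rfl
    exact hd0 (by simpa using he.symm)
  subst ha
  subst he
  simp only [F, map_add, map_sub, map_mul, map_pow, aeval_X, aeval_C, algebraMap_eq, eval_C, eval_X,
    Matrix.cons_val]
  rw [sub_add_cancel]
  field_simp
  ring
end

section
/- Let m be a positive integer, let d be a positive odd divisor of m, and let u, v be integers with u·d + v·(m/d) = 1 and with v divisible by 4. Let Λ₁ = {p + q·i√m : p, q ∈ ℤ} ⊆ ℂ and Λ_d = {p + q·i√m/d : p, q ∈ ℤ} ⊆ ℂ. Then the ℂ-linear map T : ℂ² → ℂ² given by T(z₁, z₂) = ( u·z₁ + (2i√m/d)·z₂ , (v·i√m/(2d))·z₁ + z₂ ) is invertible and maps the subgroup Λ₁ × Λ₁ of ℂ² bijectively onto the subgroup Λ_d × Λ_d. -/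
open Complex

/-- The lattice `ℤ + (i·t)·ℤ` in `ℂ` (for `t : ℝ`). -/
def latt (t : ℝ) : Set ℂ :=
  {z : ℂ | ∃ p q : ℤ, z = (p : ℂ) + (q : ℂ) * (Complex.I * (t : ℂ))}

/-- The `ℂ`-linear map `T(z₁, z₂) = (u·z₁ + (2i√m/d)·z₂, (v·i√m/(2d))·z₁ + z₂)`. -/
noncomputable def Tmap (m d : ℕ) (u v : ℤ) : ℂ × ℂ → ℂ × ℂ := fun z =>
  ((u : ℂ) * z.1 + (2 * Complex.I * (Real.sqrt m : ℂ) / (d : ℂ)) * z.2,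
   ((v : ℂ) * Complex.I * (Real.sqrt m : ℂ) / (2 * (d : ℂ))) * z.1 + z.2)

/-- The inverse of `Tmap m d u v` when `v = 2 * w`. -/
noncomputable def TmapInv (m d : ℕ) (u w : ℤ) : ℂ × ℂ → ℂ × ℂ := fun z =>
  ((d : ℂ) * z.1 - 2 * (Complex.I * (Real.sqrt m : ℂ)) * z.2,
   -((w : ℂ) * (Complex.I * (Real.sqrt m : ℂ))) * z.1 + (d : ℂ) * (u : ℂ) * z.2)

lemma I_mul_sqrt_sq (m : ℕ) : (Complex.I * (Real.sqrt m : ℂ)) ^ 2 = -(m : ℂ) := by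
  rw [mul_pow, Complex.I_sq, ← Complex.ofReal_pow, Real.sq_sqrt (Nat.cast_nonneg m)]
  simp

lemma Tmap_two_mul (m d : ℕ) (u w : ℤ) (z : ℂ × ℂ) :
    Tmap m d u (2 * w) z =
      ((u : ℂ) * z.1 + 2 * (Complex.I * (Real.sqrt m : ℂ)) / d * z.2,
       (w : ℂ) * (Complex.I * (Real.sqrt m : ℂ)) / d * z.1 + z.2) := by
  simp only [Tmap]
  push_cast
  congr 2
  · ring
  · rw [mul_assoc (2 * (w : ℂ)), mul_assoc 2, mul_div_mul_left _ _ two_ne_zero]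

section Inverse

variable {d k : ℕ} {u w : ℤ}

lemma leftInverse_TmapInv (hd : d ≠ 0) (huw : u * d + 2 * w * k = 1) :
    Function.LeftInverse (TmapInv (d * k) d u w) (Tmap (d * k) d u (2 * w)) := by
  rintro ⟨x, y⟩
  have hs := I_mul_sqrt_sq (d * k)
  have hd' : (d : ℂ) ≠ 0 := by exact_mod_cast hd
  have huw' : (u : ℂ) * d + 2 * w * k = 1 := by exact_mod_cast huw
  rw [Tmap_two_mul]
  simp only [TmapInv]
  generalize Complex.I * (Real.sqrt (d * k : ℕ) : ℂ) = s at *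
  push_cast at hs
  ext <;> simp only <;> field_simp
  · linear_combination d * x * huw' - 2 * w * x * hs
  · linear_combination d * y * huw' - 2 * w * y * hs

lemma rightInverse_TmapInv (hd : d ≠ 0) (huw : u * d + 2 * w * k = 1) :
    Function.RightInverse (TmapInv (d * k) d u w) (Tmap (d * k) d u (2 * w)) := by
  rintro ⟨x, y⟩
  have hs := I_mul_sqrt_sq (d * k)
  have hd' : (d : ℂ) ≠ 0 := by exact_mod_cast hd
  have huw' : (u : ℂ) * d + 2 * w * k = 1 := by exact_mod_cast huw
  rw [Tmap_two_mul]
  simp only [TmapInv]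
  generalize Complex.I * (Real.sqrt (d * k : ℕ) : ℂ) = s at *
  push_cast at hs
  ext <;> simp only <;> field_simp
  · linear_combination d * x * huw' - 2 * w * x * hs
  · linear_combination d * y * huw' - 2 * w * y * hs

lemma mapsTo_Tmap (hd : d ≠ 0) :
    Set.MapsTo (Tmap (d * k) d u (2 * w))
      (latt (Real.sqrt (d * k : ℕ)) ×ˢ latt (Real.sqrt (d * k : ℕ)))
      (latt (Real.sqrt (d * k : ℕ) / d) ×ˢ latt (Real.sqrt (d * k : ℕ) / d)) := by
  rintro ⟨_, _⟩ ⟨⟨a, b, rfl⟩, ⟨c, e, rfl⟩⟩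
  have hs := I_mul_sqrt_sq (d * k)
  have hd' : (d : ℂ) ≠ 0 := by exact_mod_cast hd
  rw [Tmap_two_mul]
  refine ⟨⟨u * a - 2 * e * k, u * b * d + 2 * c, ?_⟩, ⟨c - w * b * k, e * d + w * a, ?_⟩⟩ <;>
    rw [Complex.ofReal_div, ← mul_div_assoc Complex.I, Complex.ofReal_natCast] <;>
    generalize Complex.I * (Real.sqrt (d * k : ℕ) : ℂ) = s at * <;>
    push_cast at hs ⊢ <;> field_simp
  · linear_combination 2 * e * hs
  · linear_combination w * b * hs

lemma mapsTo_TmapInv (hd : d ≠ 0) :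
    Set.MapsTo (TmapInv (d * k) d u w)
      (latt (Real.sqrt (d * k : ℕ) / d) ×ˢ latt (Real.sqrt (d * k : ℕ) / d))
      (latt (Real.sqrt (d * k : ℕ)) ×ˢ latt (Real.sqrt (d * k : ℕ))) := by
  rintro ⟨_, _⟩ ⟨⟨a, b, rfl⟩, ⟨c, e, rfl⟩⟩
  have hs := I_mul_sqrt_sq (d * k)
  have hd' : (d : ℂ) ≠ 0 := by exact_mod_cast hd
  simp only [TmapInv]
  refine ⟨⟨d * a + 2 * e * k, b - 2 * c, ?_⟩, ⟨w * b * k + d * u * c, u * e - w * a, ?_⟩⟩ <;>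
    rw [Complex.ofReal_div, ← mul_div_assoc Complex.I, Complex.ofReal_natCast] <;>
    generalize Complex.I * (Real.sqrt (d * k : ℕ) : ℂ) = s at * <;>
    push_cast at hs ⊢ <;> field_simp
  · linear_combination -2 * e * hs
  · linear_combination -w * b * hs

end Inverse

/-- Let `d` be a positive odd divisor of the positive integer `m`, and let `u, v` be
integers with `u·d + v·(m/d) = 1` and `4 ∣ v`.  Then the `ℂ`-linear map
`T(z₁,z₂) = (u·z₁ + (2i√m/d)·z₂, (v·i√m/(2d))·z₁ + z₂)` is invertible, and it maps the
subgroup `Λ₁ × Λ₁` of `ℂ²` bijectively onto `Λ_d × Λ_d`, where `Λ₁ = ℤ + i√m·ℤ` and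
`Λ_d = ℤ + (i√m/d)·ℤ`. -/
theorem lattice_map_bijective (m d : ℕ) (hm : 0 < m) (hd : 0 < d) (hodd : Odd d)
    (hdvd : d ∣ m) (u v : ℤ) (huv : u * (d : ℤ) + v * ((m / d : ℕ) : ℤ) = 1)
    (hv : (4 : ℤ) ∣ v) :
    Function.Bijective (Tmap m d u v) ∧
      Set.BijOn (Tmap m d u v)
        (latt (Real.sqrt m) ×ˢ latt (Real.sqrt m))
        (latt (Real.sqrt m / d) ×ˢ latt (Real.sqrt m / d)) := by
  obtain ⟨k, rfl⟩ := hdvd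
  obtain ⟨w, rfl⟩ : (2 : ℤ) ∣ v := dvd_trans (by norm_num) hv
  rw [Nat.mul_div_cancel_left k hd] at huv
  have hl := leftInverse_TmapInv hd.ne' huv
  have hr := rightInverse_TmapInv hd.ne' huv
  exact ⟨⟨hl.injective, hr.surjective⟩, Set.InvOn.bijOn
    ⟨hl.leftInvOn _, hr.rightInvOn _⟩ (mapsTo_Tmap hd.ne') (mapsTo_TmapInv hd.ne')⟩
end

section
/- Let m be a positive even squarefree integer, let K be a number field of degree 2 over ℚ, and let θ be an element of the ring of integers 𝓞_K of K with θ² = −m. For every positive odd divisor d of m, let 𝔄_d be the ideal of 𝓞_K generated by d and θ, and let [𝔄_d] denote its class in the ideal class group of 𝓞_K. Then: (i) [𝔄_d]² is the identity for every positive odd divisor d of m; (ii) if d and d' are distinct positive odd divisors of m then [𝔄_d] ≠ [𝔄_{d'}]; and (iii) every element of the class group whose square is the identity equals [𝔄_d] for some positive odd divisor d of m. -/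
open NumberField

/-- The class in the ideal class group of a (nonzero) ideal of the ring of integers
of a number field `K`.  (For the zero ideal we return the identity class; all ideals
appearing below are nonzero.) -/
noncomputable def idealClass (K : Type) [Field K] [NumberField K]
    (I : Ideal (𝓞 K)) : ClassGroup (𝓞 K) :=
  open scoped Classical in
  if h : I ∈ nonZeroDivisors (Ideal (𝓞 K)) then ClassGroup.mk0 ⟨I, h⟩ else 1

section QuadraticIntegers

variable {K : Type} [Field K] [NumberField K] {m : ℕ} {θ : 𝓞 K}

lemma exists_basis_one_sqrt (hm : 0 < m) (hdeg : Module.finrank ℚ K = 2)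
    (hθ : θ ^ 2 = -(m : 𝓞 K)) :
    ∃ b : Module.Basis (Fin 2) ℚ K, b 0 = 1 ∧ b 1 = (θ : K) := by
  have hθK : (θ : K) ^ 2 = -(m : K) := by
    have := congrArg (algebraMap (𝓞 K) K) hθ
    simpa using this
  have hli : LinearIndependent ℚ ![(1 : K), (θ : K)] := by
    rw [LinearIndependent.pair_iff' one_ne_zero]
    intro a ha
    have h1 : (algebraMap ℚ K) (a ^ 2) = algebraMap ℚ K (-(m : ℚ)) := by
      rw [Algebra.smul_def, mul_one] at ha
      rw [map_pow, ha, hθK]; simp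
    have h2 := (algebraMap ℚ K).injective h1
    have : (0 : ℚ) < m := by exact_mod_cast hm
    nlinarith [sq_nonneg a]
  refine ⟨basisOfLinearIndependentOfCardEqFinrank hli (by simp [hdeg]), ?_, ?_⟩ <;> simp

lemma leftMulMatrix_add_mul_sqrt (hθ : θ ^ 2 = -(m : 𝓞 K)) (b : Module.Basis (Fin 2) ℚ K)
    (hb0 : b 0 = 1) (hb1 : b 1 = (θ : K)) (p q : ℚ) :
    Algebra.leftMulMatrix b ((p : K) + q * θ) = !![p, -(m * q); q, p] := by
  have hθK : (θ : K) ^ 2 = -(m : K) := by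
    have := congrArg (algebraMap (𝓞 K) K) hθ
    simpa using this
  have key : ∀ p q : ℚ, b.repr ((p : K) + q * θ) = p • b.repr (b 0) + q • b.repr (b 1) := by
    intro p q
    rw [← map_smul b.repr, ← map_smul b.repr, ← map_add, hb0, hb1]
    simp [Algebra.smul_def]
  have h0 : ((p : K) + q * θ) * b 0 = (p : K) + q * θ := by rw [hb0, mul_one]
  have h1 : ((p : K) + q * θ) * b 1 = ((-(m * q) : ℚ) : K) + p * θ := by
    rw [hb1]; push_cast; linear_combination (q : K) * hθK
  ext i j
  rw [Algebra.leftMulMatrix_eq_repr_mul]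
  fin_cases j
  · simp only [Fin.zero_eta, h0, key]
    fin_cases i <;> simp
  · simp only [Fin.mk_one, h1, key]
    fin_cases i <;> simp

lemma norm_add_mul_sqrt (hm : 0 < m) (hdeg : Module.finrank ℚ K = 2)
    (hθ : θ ^ 2 = -(m : 𝓞 K)) (p q : ℚ) :
    Algebra.norm ℚ ((p : K) + q * θ) = p ^ 2 + m * q ^ 2 := by
  obtain ⟨b, hb0, hb1⟩ := exists_basis_one_sqrt hm hdeg hθ
  rw [Algebra.norm_eq_matrix_det b, leftMulMatrix_add_mul_sqrt hθ b hb0 hb1,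
    Matrix.det_fin_two_of]
  ring

lemma trace_add_mul_sqrt (hm : 0 < m) (hdeg : Module.finrank ℚ K = 2)
    (hθ : θ ^ 2 = -(m : 𝓞 K)) (p q : ℚ) :
    Algebra.trace ℚ K ((p : K) + q * θ) = 2 * p := by
  obtain ⟨b, hb0, hb1⟩ := exists_basis_one_sqrt hm hdeg hθ
  rw [Algebra.trace_eq_matrix_trace b, leftMulMatrix_add_mul_sqrt hθ b hb0 hb1,
    Matrix.trace_fin_two_of]
  ring

lemma norm_int_add_mul_sqrt (hm : 0 < m) (hdeg : Module.finrank ℚ K = 2)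
    (hθ : θ ^ 2 = -(m : 𝓞 K)) (a b : ℤ) :
    Algebra.norm ℤ ((a : 𝓞 K) + b * θ) = a ^ 2 + m * b ^ 2 := by
  have h := norm_add_mul_sqrt hm hdeg hθ (a : ℚ) (b : ℚ)
  have h2 := Algebra.coe_norm_int (K := K) ((a : 𝓞 K) + (b : 𝓞 K) * θ)
  have h3 : (((a : 𝓞 K) + b * θ : 𝓞 K) : K) = ((a : ℚ) : K) + ((b : ℚ) : K) * θ := by simp
  rw [h3, h] at h2
  exact_mod_cast h2

lemma add_mul_sqrt_inj (hm : 0 < m) (hdeg : Module.finrank ℚ K = 2)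
    (hθ : θ ^ 2 = -(m : 𝓞 K)) {a b c d : ℤ} (h : (a : 𝓞 K) + b * θ = c + d * θ) :
    a = c ∧ b = d := by
  have h0 : ((a - c : ℤ) : 𝓞 K) + (b - d : ℤ) * θ = 0 := by
    push_cast; linear_combination h
  have hN := norm_int_add_mul_sqrt hm hdeg hθ (a - c) (b - d)
  rw [h0, Algebra.norm_zero] at hN
  have hm' : (0 : ℤ) < m := by exact_mod_cast hm
  have h1 : (a - c) ^ 2 = 0 := by nlinarith [sq_nonneg (a - c), mul_nonneg hm'.le (sq_nonneg (b - d))]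
  have h2 : (m : ℤ) * (b - d) ^ 2 = 0 := by rw [h1] at hN; linarith
  have h3 : (b - d) ^ 2 = 0 := by
    rcases mul_eq_zero.mp h2 with h | h
    · exact absurd h hm'.ne'
    · exact h
  exact ⟨sub_eq_zero.mp (pow_eq_zero_iff two_ne_zero |>.mp h1),
    sub_eq_zero.mp (pow_eq_zero_iff two_ne_zero |>.mp h3)⟩

lemma Rat.exists_int_of_squarefree_mul_sq {m : ℕ} (hsf : Squarefree m) {q : ℚ} {n : ℤ}
    (h : m * q ^ 2 = n) : ∃ k : ℤ, q = k := by
  have hd : (q.den : ℚ) ≠ 0 := by exact_mod_cast q.den_nz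
  have h1 : (m : ℤ) * q.num ^ 2 = n * (q.den : ℤ) ^ 2 := by
    have : (m : ℚ) * (q.num : ℚ) ^ 2 = n * (q.den : ℚ) ^ 2 := by
      rw [← h]
      nth_rewrite 2 [← Rat.num_div_den q]
      field_simp
    exact_mod_cast this
  have hcop : IsCoprime ((q.den : ℤ) ^ 2) (q.num ^ 2) :=
    (Int.isCoprime_iff_gcd_eq_one.mpr (by
      simpa [Int.gcd, Nat.Coprime] using q.reduced.symm)).pow
  have h2 : ((q.den : ℤ)) ^ 2 ∣ m := hcop.dvd_of_dvd_mul_right ⟨n, by rw [h1]; ring⟩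
  have h3 : q.den * q.den ∣ m := by rw [← sq]; exact_mod_cast h2
  have h4 : q.den = 1 := Nat.isUnit_iff.mp (hsf _ h3)
  exact ⟨q.num, (Rat.den_eq_one_iff q |>.mp h4).symm⟩

lemma not_four_dvd_of_squarefree {m : ℕ} (hsf : Squarefree m) : ¬ 4 ∣ m := fun h => by
  have := Nat.isUnit_iff.mp (hsf 2 (by simpa using h))
  omega

lemma exists_eq_add_mul_sqrt (hm : 0 < m) (heven : Even m) (hsf : Squarefree m)
    (hdeg : Module.finrank ℚ K = 2) (hθ : θ ^ 2 = -(m : 𝓞 K)) (x : 𝓞 K) :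
    ∃ a b : ℤ, x = a + b * θ := by
  obtain ⟨b, hb0, hb1⟩ := exists_basis_one_sqrt hm hdeg hθ
  obtain ⟨p, q, hx⟩ : ∃ p q : ℚ, (x : K) = p + q * θ := by
    refine ⟨b.repr x 0, b.repr x 1, ?_⟩
    conv_lhs => rw [← b.sum_repr (x : K)]
    rw [Fin.sum_univ_two, hb0, hb1]
    simp [Algebra.smul_def]
  obtain ⟨A, hA⟩ : ∃ A : ℤ, (A : ℚ) = 2 * p := by
    rw [← trace_add_mul_sqrt hm hdeg hθ p q, ← hx]
    exact ⟨_, Algebra.coe_trace_int x⟩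
  obtain ⟨N, hN⟩ : ∃ N : ℤ, (N : ℚ) = p ^ 2 + m * q ^ 2 := by
    rw [← norm_add_mul_sqrt hm hdeg hθ p q, ← hx]
    exact ⟨_, Algebra.coe_norm_int x⟩
  obtain ⟨B, hB⟩ : ∃ B : ℤ, 2 * q = B :=
    Rat.exists_int_of_squarefree_mul_sq hsf (n := 4 * N - A ^ 2) (by push_cast; rw [hN, hA]; ring)
  have hAB : A ^ 2 + m * B ^ 2 = 4 * N := by
    have : (A : ℚ) ^ 2 + m * B ^ 2 = 4 * N := by rw [hN, hA, ← hB]; ring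
    exact_mod_cast this
  obtain ⟨k, hk⟩ : ∃ k : ℤ, (m : ℤ) = 4 * k + 2 := by
    have := not_four_dvd_of_squarefree hsf
    have := heven.two_dvd
    exact ⟨(m : ℤ) / 4, by omega⟩
  have hA2 : Even A := by
    have : Even (A ^ 2) := ⟨2 * N - (2 * k + 1) * B ^ 2, by rw [hk] at hAB; linarith⟩
    exact (Int.even_pow.mp this).1
  obtain ⟨a, rfl⟩ := hA2.two_dvd
  have hB2 : Even B := by
    have : Even (B ^ 2) := ⟨N - a ^ 2 - k * B ^ 2, by rw [hk] at hAB; linarith⟩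
    exact (Int.even_pow.mp this).1
  obtain ⟨c, rfl⟩ := hB2.two_dvd
  refine ⟨a, c, RingOfIntegers.ext ?_⟩
  have hp : p = a := by push_cast at hA; linarith
  have hq : q = c := by push_cast at hB; linarith
  simp [hx, hp, hq]

lemma isUnit_eq_one_or_neg_one (hm : 0 < m) (heven : Even m) (hsf : Squarefree m)
    (hdeg : Module.finrank ℚ K = 2) (hθ : θ ^ 2 = -(m : 𝓞 K)) {u : 𝓞 K} (hu : IsUnit u) :
    u = 1 ∨ u = -1 := by
  obtain ⟨a, b, rfl⟩ := exists_eq_add_mul_sqrt hm heven hsf hdeg hθ u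
  have hN := hu.map (Algebra.norm ℤ)
  rw [norm_int_add_mul_sqrt hm hdeg hθ, Int.isUnit_iff] at hN
  have hm2 : (2 : ℤ) ≤ m := by
    obtain ⟨k, hk⟩ := heven.two_dvd
    omega
  have hb : b = 0 := by
    by_contra hb
    have : 0 < b ^ 2 := by positivity
    rcases hN with h | h <;> nlinarith [sq_nonneg a]
  subst hb
  have ha : a ^ 2 = 1 := by
    rcases hN with h | h <;> nlinarith [sq_nonneg a]
  rcases sq_eq_one_iff.mp ha with rfl | rfl <;> simp

end QuadraticIntegers

section IdealClass

variable {K : Type} [Field K] [NumberField K]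

lemma idealClass_mul {I J : Ideal (𝓞 K)} (hI : I ≠ 0) (hJ : J ≠ 0) :
    idealClass K (I * J) = idealClass K I * idealClass K J := by
  have hI' := mem_nonZeroDivisors_of_ne_zero hI
  have hJ' := mem_nonZeroDivisors_of_ne_zero hJ
  rw [idealClass, idealClass, idealClass, dif_pos hI', dif_pos hJ', dif_pos (mul_mem hI' hJ'),
    ← map_mul]
  rfl

lemma idealClass_eq_one_iff {I : Ideal (𝓞 K)} (hI : I ≠ 0) :
    idealClass K I = 1 ↔ ∃ x, I = Ideal.span {x} := by
  rw [idealClass, dif_pos (mem_nonZeroDivisors_of_ne_zero hI), ClassGroup.mk0_eq_one_iff,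
    Submodule.isPrincipal_iff]

lemma exists_eq_idealClass (c : ClassGroup (𝓞 K)) :
    ∃ I : Ideal (𝓞 K), I ≠ 0 ∧ c = idealClass K I := by
  obtain ⟨⟨I, hI⟩, rfl⟩ := ClassGroup.mk0_surjective c
  exact ⟨I, nonZeroDivisors.ne_zero hI, by rw [idealClass, dif_pos hI]⟩

lemma idealClass_eq_of_mul_eq_span {I J : Ideal (𝓞 K)} (hI : I ≠ 0) (hJ : J ≠ 0)
    (h : idealClass K J ^ 2 = 1) {x : 𝓞 K} (hx : I * J = Ideal.span {x}) :
    idealClass K I = idealClass K J := by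
  have h1 := (idealClass_eq_one_iff (mul_ne_zero hI hJ)).mpr ⟨x, hx⟩
  rw [idealClass_mul hI hJ] at h1
  rw [sq] at h
  exact mul_right_cancel (h1.trans h.symm)

lemma Ideal.dvd_of_sq_dvd_sq {R : Type*} [CommRing R] [IsDedekindDomain R] {I J : Ideal R}
    (h : I ^ 2 ∣ J ^ 2) : I ∣ J :=
  (UniqueFactorizationMonoid.pow_dvd_pow_iff_dvd two_ne_zero).mp h

lemma Ideal.eq_of_sq_eq_sq {R : Type*} [CommRing R] [IsDedekindDomain R] {I J : Ideal R}
    (h : I ^ 2 = J ^ 2) : I = J :=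
  dvd_antisymm (Ideal.dvd_of_sq_dvd_sq h.dvd) (Ideal.dvd_of_sq_dvd_sq h.symm.dvd)

end IdealClass

lemma Nat.dvd_of_squarefree_of_forall_prime {s m : ℕ} (hm : 0 < m) (hs : Squarefree s)
    (h : ∀ p, p.Prime → p ∣ s → p ∣ m) : s ∣ m := by
  rw [← Nat.prod_primeFactors_of_squarefree hs]
  refine (Finset.prod_dvd_prod_of_subset _ m.primeFactors _ fun p hp => ?_).trans
    (Nat.prod_primeFactors_dvd m)
  have := Nat.prime_of_mem_primeFactors hp
  exact Nat.mem_primeFactors.mpr ⟨this, h p this (Nat.dvd_of_mem_primeFactors hp), hm.ne'⟩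

lemma Nat.eq_of_squarefree_of_mul_eq_sq {d e a : ℕ} (hd : Squarefree d) (he : Squarefree e)
    (h : d * e = a ^ 2) : d = e := by
  have key : ∀ {d e : ℕ}, Squarefree d → d * e = a ^ 2 → d ∣ e := by
    intro d e hd h
    obtain ⟨k, rfl⟩ : d ∣ a := hd.isRadical 2 a ⟨e, h.symm⟩
    refine ⟨k ^ 2, Nat.eq_of_mul_eq_mul_left (Nat.pos_of_ne_zero hd.ne_zero) ?_⟩
    rw [h]; ring
  exact Nat.dvd_antisymm (key hd h) (key he (by rw [mul_comm, h]))

section AmbiguousIdeals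

variable {K : Type} [Field K] [NumberField K] {m : ℕ} {θ : 𝓞 K}

lemma span_pair_sqrt_sq (hsf : Squarefree m) (hθ : θ ^ 2 = -(m : 𝓞 K)) {d : ℕ} (hd : d ∣ m) :
    Ideal.span {(d : 𝓞 K), θ} ^ 2 = Ideal.span {(d : 𝓞 K)} := by
  obtain ⟨e, rfl⟩ := hd
  have hcop : IsCoprime (d : ℤ) e :=
    Nat.isCoprime_iff_coprime.mpr (Nat.squarefree_mul_iff.mp hsf).1
  obtain ⟨u, v, huv⟩ := hcop
  have huv' : (u : 𝓞 K) * d + v * e = 1 := by exact_mod_cast congrArg (Int.cast : ℤ → 𝓞 K) huv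
  push_cast at hθ
  rw [sq, Ideal.span_pair_mul_span_pair]
  apply le_antisymm
  · rw [Ideal.span_le]
    rintro x (rfl | rfl | rfl | rfl) <;> rw [SetLike.mem_coe, Ideal.mem_span_singleton]
    · exact dvd_mul_right _ _
    · exact dvd_mul_right _ _
    · exact dvd_mul_left _ _
    · exact ⟨-e, by linear_combination hθ⟩
  · rw [Ideal.span_singleton_le_iff_mem]
    have : u * ((d : 𝓞 K) * d) - v * (θ * θ) = d := by
      linear_combination (d : 𝓞 K) * huv' - (v : 𝓞 K) * hθ
    have hmem : u * ((d : 𝓞 K) * d) - v * (θ * θ) ∈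
        Ideal.span {(d : 𝓞 K) * d, d * θ, θ * d, θ * θ} :=
      sub_mem (Ideal.mul_mem_left _ _ (Ideal.subset_span (by simp)))
        (Ideal.mul_mem_left _ _ (Ideal.subset_span (by simp)))
    rwa [this] at hmem

lemma span_pair_natCast_ne_zero {d : ℕ} (hd : d ≠ 0) : Ideal.span {(d : 𝓞 K), θ} ≠ 0 := by
  intro h
  have : (d : 𝓞 K) ∈ Ideal.span {(d : 𝓞 K), θ} := Ideal.subset_span (by simp)
  rw [h] at this
  exact hd (by exact_mod_cast (Submodule.mem_bot _).mp this)

lemma idealClass_span_pair_sq (hm : 0 < m) (hsf : Squarefree m) (hθ : θ ^ 2 = -(m : 𝓞 K))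
    {d : ℕ} (hd : d ∣ m) : idealClass K (Ideal.span {(d : 𝓞 K), θ}) ^ 2 = 1 := by
  have h0 : Ideal.span {(d : 𝓞 K), θ} ≠ 0 :=
    span_pair_natCast_ne_zero (Nat.pos_of_dvd_of_pos hd hm).ne'
  rw [sq, ← idealClass_mul h0 h0, ← sq,
    idealClass_eq_one_iff (pow_ne_zero 2 h0)]
  exact ⟨_, span_pair_sqrt_sq hsf hθ hd⟩

lemma eq_of_span_natCast_mul_eq_span_sq (hm : 0 < m) (heven : Even m) (hsf : Squarefree m)
    (hdeg : Module.finrank ℚ K = 2) (hθ : θ ^ 2 = -(m : 𝓞 K)) {d e : ℕ}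
    (hd : Odd d) (he : Odd e) (hdsf : Squarefree d) (hesf : Squarefree e) {x : 𝓞 K}
    (hx : Ideal.span {(d : 𝓞 K) * e} = Ideal.span {x ^ 2}) : d = e := by
  rw [Ideal.span_singleton_eq_span_singleton] at hx
  obtain ⟨u, hu⟩ := hx
  obtain ⟨a, b, rfl⟩ := exists_eq_add_mul_sqrt hm heven hsf hdeg hθ x
  have hexp : ((a : 𝓞 K) + b * θ) ^ 2 = (a ^ 2 - m * b ^ 2 : ℤ) + (2 * a * b : ℤ) * θ := by
    push_cast; linear_combination (b : 𝓞 K) ^ 2 * hθ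
  obtain ⟨ε, hε, hde⟩ : ∃ ε : ℤ, (ε = 1 ∨ ε = -1) ∧
      ((ε * (d * e) : ℤ) : 𝓞 K) + (0 : ℤ) * θ = ((a : 𝓞 K) + b * θ) ^ 2 := by
    rcases isUnit_eq_one_or_neg_one hm heven hsf hdeg hθ u.isUnit with h | h
    · exact ⟨1, Or.inl rfl, by rw [← hu, h]; push_cast; ring⟩
    · exact ⟨-1, Or.inr rfl, by rw [← hu, h]; push_cast; ring⟩
  rw [hexp] at hde
  obtain ⟨h1, h2⟩ := add_mul_sqrt_inj hm hdeg hθ hde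
  have hm' : (0 : ℤ) < m := by exact_mod_cast hm
  have hde0 : (0 : ℤ) < d * e := by exact_mod_cast Nat.mul_pos hd.pos he.pos
  have hab : a = 0 ∨ b = 0 := by
    rcases mul_eq_zero.mp h2.symm with h | h
    · exact Or.inl (by omega)
    · exact Or.inr h
  rcases hab with rfl | rfl
  · exfalso
    have hodd : Odd ((d : ℤ) * e) := by exact_mod_cast hd.mul he
    have hev : Even ((m : ℤ) * b ^ 2) := (by exact_mod_cast heven : Even (m : ℤ)).mul_right _
    rw [← Int.not_even_iff_odd] at hodd
    apply hodd
    rcases hε with rfl | rfl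
    · nlinarith [sq_nonneg b]
    · have : (d : ℤ) * e = m * b ^ 2 := by linarith
      rwa [this]
  · rcases hε with rfl | rfl
    · refine Nat.eq_of_squarefree_of_mul_eq_sq (a := a.natAbs) hdsf hesf ?_
      zify
      rw [sq_abs]
      linarith
    · nlinarith [sq_nonneg a]

/-- An ideal with principal square is, up to a principal factor, the inverse of an ideal whose
square is generated by a positive integer. -/
lemma exists_mul_eq_span_of_sq_eq_span (hm : 0 < m) (heven : Even m) (hsf : Squarefree m)
    (hdeg : Module.finrank ℚ K = 2) (hθ : θ ^ 2 = -(m : 𝓞 K)) {I : Ideal (𝓞 K)} (hI : I ≠ 0)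
    {x : 𝓞 K} (hx : I ^ 2 = Ideal.span {x}) :
    ∃ (J : Ideal (𝓞 K)) (r : ℕ) (y : 𝓞 K), 0 < r ∧ J ^ 2 = Ideal.span {(r : 𝓞 K)} ∧
      I * J = Ideal.span {y} := by
  obtain ⟨a, b, rfl⟩ := exists_eq_add_mul_sqrt hm heven hsf hdeg hθ x
  have hn : 0 < Ideal.absNorm I :=
    Nat.pos_of_ne_zero fun h => hI (Ideal.absNorm_eq_zero_iff.mp h)
  have hN := congrArg Ideal.absNorm hx
  rw [map_pow, Ideal.absNorm_span_singleton, norm_int_add_mul_sqrt hm hdeg hθ] at hN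
  generalize Ideal.absNorm I = n at hn hN
  have hN' : (n : ℤ) ^ 2 = a ^ 2 + m * b ^ 2 := by
    have := congrArg (Nat.cast : ℕ → ℤ) hN
    rwa [Int.natCast_natAbs, abs_of_nonneg (by positivity), Nat.cast_pow] at this
  by_cases hy : (a : 𝓞 K) + b * θ + n = 0
  · have hIn : I ^ 2 = Ideal.span {(n : 𝓞 K)} := by
      rw [hx, eq_neg_of_add_eq_zero_left hy, Ideal.span_singleton_neg]
    exact ⟨I, n, n, hn, hIn, by rw [← sq, hIn]⟩
  have hsq : ((a : 𝓞 K) + b * θ + n) ^ 2 = (2 * (n + a) : ℤ) * (a + b * θ) := by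
    have : (n : 𝓞 K) ^ 2 = a ^ 2 + m * b ^ 2 := by
      exact_mod_cast congrArg (Int.cast : ℤ → 𝓞 K) hN'
    push_cast
    linear_combination (b : 𝓞 K) ^ 2 * hθ + this
  have hna : 0 < (n : ℤ) + a := by
    have h0 : 0 ≤ (n : ℤ) + a := by
      have := abs_le_of_sq_le_sq (a := a) (b := (n : ℤ))
        (by rw [hN']; nlinarith [mul_nonneg (Int.natCast_nonneg m) (sq_nonneg b)]) (by positivity)
      linarith [neg_abs_le a]
    refine lt_of_le_of_ne h0 fun h => hy ?_
    rw [← h] at hsq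
    simpa using hsq
  obtain ⟨r, hr⟩ := Int.eq_ofNat_of_zero_le (a := 2 * ((n : ℤ) + a)) (by linarith)
  have hrr : ((2 * (n + a) : ℤ) : 𝓞 K) = r := by rw [hr]; simp
  rw [hrr] at hsq
  have hspan : Ideal.span {(a : 𝓞 K) + b * θ + n} ^ 2 = Ideal.span {(r : 𝓞 K)} * I ^ 2 := by
    rw [Ideal.span_singleton_pow, hsq, hx, Ideal.span_singleton_mul_span_singleton]
  obtain ⟨J, hJ⟩ := Ideal.dvd_of_sq_dvd_sq (Dvd.intro_left _ hspan.symm)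
  refine ⟨J, r, _, by omega, ?_, hJ.symm⟩
  refine mul_left_cancel₀ (pow_ne_zero 2 hI) ?_
  rw [← mul_pow, ← hJ, hspan, mul_comm]

lemma dvd_of_sq_eq_span_squarefree (hm : 0 < m) (heven : Even m) (hsf : Squarefree m)
    (hdeg : Module.finrank ℚ K = 2) (hθ : θ ^ 2 = -(m : 𝓞 K)) {J : Ideal (𝓞 K)} {s : ℕ}
    (hs : Squarefree s) (hJ : J ^ 2 = Ideal.span {(s : 𝓞 K)}) : s ∣ m := by
  refine Nat.dvd_of_squarefree_of_forall_prime hm hs fun p hp hps => ?_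
  by_contra hpm
  have hpZ : Prime (p : ℤ) := Nat.prime_iff_prime_int.mp hp
  have hp2 : ¬ (p : ℤ) ∣ 2 := by
    intro h
    have : p ∣ 2 := by exact_mod_cast h
    exact hpm (((Nat.prime_dvd_prime_iff_eq hp Nat.prime_two).mp this) ▸ heven.two_dvd)
  have hpm' : ¬ (p : ℤ) ∣ m := by exact_mod_cast hpm
  have hle : J ≤ Ideal.span {(p : 𝓞 K)} := by
    intro x hx
    have hx2 : x ^ 2 ∈ Ideal.span {(s : 𝓞 K)} := hJ ▸ Ideal.pow_mem_pow hx 2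
    rw [Ideal.mem_span_singleton] at hx2 ⊢
    obtain ⟨y, hy⟩ := (Nat.cast_dvd_cast hps).trans hx2
    obtain ⟨a, b, rfl⟩ := exists_eq_add_mul_sqrt hm heven hsf hdeg hθ x
    obtain ⟨e, f, rfl⟩ := exists_eq_add_mul_sqrt hm heven hsf hdeg hθ y
    have heq : ((a ^ 2 - m * b ^ 2 : ℤ) : 𝓞 K) + (2 * a * b : ℤ) * θ =
        (p * e : ℤ) + (p * f : ℤ) * θ := by
      push_cast; linear_combination hy - (b : 𝓞 K) ^ 2 * hθ
    obtain ⟨h1, h2⟩ := add_mul_sqrt_inj hm hdeg hθ heq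
    have hab : (p : ℤ) ∣ a ∧ (p : ℤ) ∣ b := by
      rcases hpZ.dvd_or_dvd (Dvd.intro _ h2.symm) with h | h
      · have ha := (hpZ.dvd_or_dvd h).resolve_left hp2
        have hmb : (p : ℤ) ∣ m * b ^ 2 := by
          have : (m : ℤ) * b ^ 2 = a ^ 2 - p * e := by linarith
          rw [this]
          exact dvd_sub (dvd_pow ha two_ne_zero) (dvd_mul_right _ _)
        exact ⟨ha, hpZ.dvd_of_dvd_pow ((hpZ.dvd_or_dvd hmb).resolve_left hpm')⟩
      · have ha : (p : ℤ) ∣ a ^ 2 := by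
          have : a ^ 2 = p * e + m * b ^ 2 := by linarith
          rw [this]
          exact dvd_add (dvd_mul_right _ _) ((dvd_pow h two_ne_zero).mul_left _)
        exact ⟨hpZ.dvd_of_dvd_pow ha, h⟩
    obtain ⟨⟨a, rfl⟩, ⟨b, rfl⟩⟩ := hab
    exact ⟨a + b * θ, by push_cast; ring⟩
  have hs2 : (s : 𝓞 K) ∈ Ideal.span {(p : 𝓞 K) ^ 2} := by
    rw [← Ideal.span_singleton_pow]
    exact Ideal.pow_right_mono hle 2 (hJ ▸ Ideal.mem_span_singleton_self _)
  obtain ⟨y, hy⟩ := Ideal.mem_span_singleton.mp hs2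
  obtain ⟨e, f, rfl⟩ := exists_eq_add_mul_sqrt hm heven hsf hdeg hθ y
  have heq : ((s : ℤ) : 𝓞 K) + (0 : ℤ) * θ = (p ^ 2 * e : ℤ) + (p ^ 2 * f : ℤ) * θ := by
    push_cast; linear_combination hy
  have hdvd : (p : ℤ) ^ 2 ∣ s := ⟨e, (add_mul_sqrt_inj hm hdeg hθ heq).1⟩
  have hdvd' : p * p ∣ s := by rw [← sq]; exact_mod_cast hdvd
  exact hp.ne_one (Nat.isUnit_iff.mp (hs p hdvd'))

lemma exists_idealClass_eq_of_sq_eq_span_natCast (hm : 0 < m) (heven : Even m)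
    (hsf : Squarefree m) (hdeg : Module.finrank ℚ K = 2) (hθ : θ ^ 2 = -(m : 𝓞 K))
    {J : Ideal (𝓞 K)} {r : ℕ} (hr : 0 < r) (hJ : J ^ 2 = Ideal.span {(r : 𝓞 K)}) :
    ∃ s : ℕ, s ∣ m ∧ idealClass K J = idealClass K (Ideal.span {(s : 𝓞 K), θ}) := by
  obtain ⟨s, k, hs0, hk0, rfl, hs⟩ := Nat.sq_mul_squarefree_of_pos hr
  have hk : Ideal.span {(k : 𝓞 K)} ≠ 0 := by
    rw [Ne, Ideal.zero_eq_bot, Ideal.span_singleton_eq_bot]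
    exact_mod_cast hk0.ne'
  have hJ2 : J ^ 2 = Ideal.span {(k : 𝓞 K)} ^ 2 * Ideal.span {(s : 𝓞 K)} := by
    rw [hJ, Ideal.span_singleton_pow, Ideal.span_singleton_mul_span_singleton]
    push_cast; rfl
  obtain ⟨J', rfl⟩ := Ideal.dvd_of_sq_dvd_sq (Dvd.intro _ hJ2.symm)
  rw [mul_pow] at hJ2
  have hJ' := mul_left_cancel₀ (pow_ne_zero 2 hk) hJ2
  have hsm := dvd_of_sq_eq_span_squarefree hm heven hsf hdeg hθ hs hJ'
  rw [← span_pair_sqrt_sq hsf hθ hsm] at hJ'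
  obtain rfl := Ideal.eq_of_sq_eq_sq hJ'
  refine ⟨s, hsm, ?_⟩
  rw [idealClass_mul hk (span_pair_natCast_ne_zero hs0.ne'),
    (idealClass_eq_one_iff hk).mpr ⟨_, rfl⟩, one_mul]

lemma idealClass_span_pair_eq_of_mul_eq (hm : 0 < m) (hsf : Squarefree m)
    (hθ : θ ^ 2 = -(m : 𝓞 K)) {s t : ℕ} (hst : s * t = m) :
    idealClass K (Ideal.span {(s : 𝓞 K), θ}) = idealClass K (Ideal.span {(t : 𝓞 K), θ}) := by
  have hs : s ∣ m := Dvd.intro _ hst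
  have ht : t ∣ m := Dvd.intro_left _ hst
  refine idealClass_eq_of_mul_eq_span (x := θ)
    (span_pair_natCast_ne_zero (Nat.pos_of_dvd_of_pos hs hm).ne')
    (span_pair_natCast_ne_zero (Nat.pos_of_dvd_of_pos ht hm).ne')
    (idealClass_span_pair_sq hm hsf hθ ht) (Ideal.eq_of_sq_eq_sq ?_)
  rw [mul_pow, span_pair_sqrt_sq hsf hθ hs, span_pair_sqrt_sq hsf hθ ht,
    Ideal.span_singleton_mul_span_singleton, Ideal.span_singleton_pow, hθ,
    Ideal.span_singleton_neg, ← hst, Nat.cast_mul]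

end AmbiguousIdeals

/-- Let `m` be a positive even squarefree integer, `K` a number field of degree `2`
over `ℚ`, and `θ ∈ 𝓞 K` with `θ² = −m`.  For each positive odd divisor `d` of `m` let
`𝔄_d = (d, θ)`.  Then (i) the class of `𝔄_d` is `2`-torsion; (ii) distinct positive odd
divisors give distinct classes; and (iii) every `2`-torsion element of the class group
is the class of some `𝔄_d`. -/
theorem two_torsion_classes (m : ℕ) (hm : 0 < m) (heven : Even m) (hsf : Squarefree m)
    (K : Type) [Field K] [NumberField K] (hdeg : Module.finrank ℚ K = 2)
    (θ : 𝓞 K) (hθ : θ ^ 2 = -(m : 𝓞 K)) :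
    (∀ d : ℕ, 0 < d → Odd d → d ∣ m →
        (idealClass K (Ideal.span {(d : 𝓞 K), θ})) ^ 2 = 1) ∧
    (∀ d d' : ℕ, 0 < d → Odd d → d ∣ m → 0 < d' → Odd d' → d' ∣ m → d ≠ d' →
        idealClass K (Ideal.span {(d : 𝓞 K), θ}) ≠
          idealClass K (Ideal.span {(d' : 𝓞 K), θ})) ∧
    (∀ c : ClassGroup (𝓞 K), c ^ 2 = 1 →
        ∃ d : ℕ, 0 < d ∧ Odd d ∧ d ∣ m ∧
          c = idealClass K (Ideal.span {(d : 𝓞 K), θ})) := by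
  refine ⟨fun d _ _ hdm => idealClass_span_pair_sq hm hsf hθ hdm, ?_, ?_⟩
  · intro d d' hd hdo hdm hd' hdo' hdm' hne heq
    refine hne ?_
    have h0 : Ideal.span {(d : 𝓞 K), θ} ≠ 0 := span_pair_natCast_ne_zero hd.ne'
    have h0' : Ideal.span {(d' : 𝓞 K), θ} ≠ 0 := span_pair_natCast_ne_zero hd'.ne'
    have h1 : idealClass K (Ideal.span {(d : 𝓞 K), θ} * Ideal.span {(d' : 𝓞 K), θ}) = 1 := by
      rw [idealClass_mul h0 h0', heq, ← sq, idealClass_span_pair_sq hm hsf hθ hdm']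
    obtain ⟨x, hx⟩ := (idealClass_eq_one_iff (mul_ne_zero h0 h0')).mp h1
    refine eq_of_span_natCast_mul_eq_span_sq hm heven hsf hdeg hθ hdo hdo'
      (hsf.squarefree_of_dvd hdm) (hsf.squarefree_of_dvd hdm') (x := x) ?_
    rw [← Ideal.span_singleton_pow, ← hx, mul_pow, span_pair_sqrt_sq hsf hθ hdm,
      span_pair_sqrt_sq hsf hθ hdm', Ideal.span_singleton_mul_span_singleton]
  · intro c hc
    obtain ⟨I, hI, rfl⟩ := exists_eq_idealClass c
    have hI2 : idealClass K (I ^ 2) = 1 := by rw [sq, idealClass_mul hI hI, ← sq, hc]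
    obtain ⟨x, hx⟩ := (idealClass_eq_one_iff (pow_ne_zero 2 hI)).mp hI2
    obtain ⟨J, r, y, hr, hJ, hIJ⟩ :=
      exists_mul_eq_span_of_sq_eq_span hm heven hsf hdeg hθ hI hx
    have hJ0 : J ≠ 0 := by
      rintro rfl
      rw [zero_pow two_ne_zero, eq_comm, Ideal.zero_eq_bot, Ideal.span_singleton_eq_bot] at hJ
      exact hr.ne' (by exact_mod_cast hJ)
    obtain ⟨s, hsm, hs⟩ :=
      exists_idealClass_eq_of_sq_eq_span_natCast hm heven hsf hdeg hθ hr hJ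
    have hIs : idealClass K I = idealClass K (Ideal.span {(s : 𝓞 K), θ}) := by
      rw [← hs]
      exact (idealClass_eq_of_mul_eq_span hJ0 hI hc (by rw [mul_comm, hIJ])).symm
    have hs0 : 0 < s := Nat.pos_of_dvd_of_pos hsm hm
    rcases Nat.even_or_odd s with hse | hso
    · obtain ⟨t, ht⟩ := hsm
      have ht0 : 0 < t := Nat.pos_of_ne_zero (by rintro rfl; omega)
      refine ⟨t, ht0, ?_, Dvd.intro_left _ ht.symm,
        hIs.trans (idealClass_span_pair_eq_of_mul_eq hm hsf hθ ht.symm)⟩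
      rw [← Nat.not_even_iff_odd]
      intro hte
      exact not_four_dvd_of_squarefree hsf (ht ▸ mul_dvd_mul hse.two_dvd hte.two_dvd)
    · exact ⟨s, hs0, hso, hsm, hIs⟩
end

section
/- Let K be a number field of degree 2 over ℚ containing an element θ with θ² = −6. Then the class number of K (the cardinality of the ideal class group of its ring of integers) equals 2. -/
open NumberField nonZeroDivisors

/-- Integers can be rounded to a nearest multiple of a positive integer. -/
lemma exists_two_mul_abs_sub_mul_le (n : ℤ) (hn : 0 < n) (x : ℤ) :
    ∃ p : ℤ, |2 * (x - n * p)| ≤ n := by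
  refine ⟨(2 * x + n) / (2 * n), ?_⟩
  have h₁ := Int.mul_ediv_add_emod (2 * x + n) (2 * n)
  have h₂ := Int.emod_nonneg (2 * x + n) (show 2 * n ≠ 0 by omega)
  have h₃ := Int.emod_lt_of_pos (2 * x + n) (show 0 < 2 * n by omega)
  rw [abs_le]
  constructor <;> linarith

/-- A point of `ℚ(√-6)`, or its double, is at norm-distance less than `1` from `ℤ[√-6]`. -/
lemma exists_sq_add_six_mul_sq_lt (n : ℤ) (hn : 0 < n) (x y : ℤ) :
    ∃ m p q : ℤ, (m = 1 ∨ m = 2) ∧ (m * x - n * p) ^ 2 + 6 * (m * y - n * q) ^ 2 < n ^ 2 := by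
  have round_sq (z : ℤ) : ∃ p : ℤ, 4 * (z - n * p) ^ 2 ≤ n ^ 2 := by
    obtain ⟨p, hp⟩ := exists_two_mul_abs_sub_mul_le n hn z
    exact ⟨p, by nlinarith [sq_le_sq' (abs_le.mp hp).1 (abs_le.mp hp).2]⟩
  obtain ⟨q, hq⟩ := exists_two_mul_abs_sub_mul_le n hn y
  obtain ⟨hq₁, hq₂⟩ := abs_le.mp hq
  rcases lt_or_ge (8 * (y - n * q) ^ 2) (n ^ 2) with h | h
  · obtain ⟨p, hp⟩ := round_sq x
    exact ⟨1, p, q, .inl rfl, by linarith⟩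
  · obtain ⟨p, hp⟩ := round_sq (2 * x)
    have key (v : ℤ) (hv : 0 ≤ v) (hvn : n ^ 2 ≤ 2 * (n - v) ^ 2) (hle : v ≤ n) :
        8 * v ^ 2 < n ^ 2 := by
      by_contra! hc
      have h₁ : n < 3 * v := by nlinarith
      have h₂ : 2 * n < 3 * (n - v) := by nlinarith
      linarith
    rcases le_total 0 (y - n * q) with h0 | h0
    · have := key (n - 2 * (y - n * q)) (by linarith) (by nlinarith) (by linarith)
      exact ⟨2, p, 2 * q + 1, .inr rfl, by nlinarith⟩
    · have := key (n + 2 * (y - n * q)) (by linarith) (by nlinarith) (by linarith)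
      exact ⟨2, p, 2 * q - 1, .inr rfl, by nlinarith⟩

/-- Rationals `r`, `s` with `2r` and `r² + 6s²` integral are integers. -/
lemma exists_int_of_two_mul_of_sq_add_six_mul_sq {r s : ℚ} {m n : ℤ} (hm : (m : ℚ) = 2 * r)
    (hn : (n : ℚ) = r ^ 2 + 6 * s ^ 2) : ∃ a b : ℤ, (a : ℚ) = r ∧ (b : ℚ) = s := by
  obtain ⟨t, ht⟩ : ∃ t : ℤ, (t : ℚ) = 12 * s := by
    refine IsIntegrallyClosed.exists_algebraMap_eq_of_isIntegral_pow (R := ℤ) two_pos ?_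
    have : (12 * s) ^ 2 = algebraMap ℤ ℚ (6 * (4 * n - m ^ 2)) := by
      rw [eq_intCast]; push_cast; rw [hm, hn]; ring
    exact this ▸ isIntegral_algebraMap
  have h : t ^ 2 = 6 * (4 * n - m ^ 2) := by
    have : (t : ℚ) ^ 2 = 6 * (4 * n - m ^ 2) := by rw [ht, hm, hn]; ring
    exact_mod_cast this
  obtain ⟨u, rfl⟩ : 6 ∣ t := by
    have h6 : (6 : ℤ) ∣ t ^ 2 := ⟨_, h⟩
    have h2 : (2 : ℤ) ∣ t := Int.prime_two.dvd_of_dvd_pow (dvd_trans (by norm_num) h6)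
    have h3 : (3 : ℤ) ∣ t := Int.prime_three.dvd_of_dvd_pow (dvd_trans (by norm_num) h6)
    omega
  obtain ⟨k, rfl⟩ : 2 ∣ m :=
    Int.prime_two.dvd_of_dvd_pow (n := 2) ⟨2 * n - 3 * u ^ 2, by linarith⟩
  obtain ⟨v, rfl⟩ : 2 ∣ u :=
    Int.prime_two.dvd_of_dvd_pow (n := 2) ⟨n - k ^ 2 - u ^ 2, by linarith⟩
  refine ⟨k, v, ?_, ?_⟩ <;> push_cast at * <;> linarith

section Field

variable {K : Type*} [Field K] [CharZero K]

lemma eq_zero_of_add_mul_sqrt_neg_six {θ : K} (hθ : θ ^ 2 = -6) {r s : ℚ}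
    (h : (r : K) + s * θ = 0) : r = 0 ∧ s = 0 := by
  have h' : (r : K) ^ 2 + 6 * s ^ 2 = 0 := by
    linear_combination (r - s * θ) * h + s ^ 2 * hθ
  have h'' : r ^ 2 + 6 * s ^ 2 = 0 := by exact_mod_cast h'
  constructor <;> nlinarith [sq_nonneg r, sq_nonneg s, pow_eq_zero_iff (two_ne_zero) (a := r)]

end Field

lemma exists_ringOfIntegers_eq_add_mul_sqrt_neg_six {K : Type*} [Field K] [NumberField K]
    (hdeg : Module.finrank ℚ K = 2) {θ : K} (hθ : θ ^ 2 = -6) (x : K) (hx : IsIntegral ℤ x) :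
    ∃ a b : ℤ, x = a + b * θ := by
  have hli : LinearIndependent ℚ ![1, θ] := by
    rw [LinearIndependent.pair_iff]
    intro r s h
    refine eq_zero_of_add_mul_sqrt_neg_six hθ ?_
    simpa [Algebra.smul_def] using h
  let B := basisOfLinearIndependentOfCardEqFinrank hli (by simp [hdeg])
  have hB0 : B 0 = 1 := by simp [B]
  have hB1 : B 1 = θ := by simp [B]
  have htr : Algebra.trace ℚ K θ = 0 := by
    have hθθ : θ * B 1 = (-6 : ℚ) • B 0 := by
      rw [hB0, hB1, ← sq, hθ, Algebra.smul_def]; simp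
    have hθ1 : θ * B 0 = B 1 := by rw [hB0, hB1, mul_one]
    simp [Algebra.trace_eq_matrix_trace B, Matrix.trace, Algebra.leftMulMatrix_eq_repr_mul,
      Fin.sum_univ_two, hθθ, hθ1]
  obtain ⟨r, s, rfl⟩ : ∃ r s : ℚ, x = r + s * θ := by
    refine ⟨B.repr x 0, B.repr x 1, ?_⟩
    conv_lhs => rw [← B.sum_repr x]
    simp [Fin.sum_univ_two, hB0, hB1, Algebra.smul_def]
  have htrx : Algebra.trace ℚ K (r + s * θ) = 2 * r := by
    have : (r : K) + s * θ = algebraMap ℚ K r + s • θ := by simp [Algebra.smul_def]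
    rw [this, map_add, map_smul, htr, Algebra.trace_algebraMap, hdeg]
    simp
  obtain ⟨m, hm⟩ := IsIntegrallyClosed.isIntegral_iff.mp (Algebra.isIntegral_trace (L := ℚ) hx)
  rw [htrx] at hm
  have hm' : (m : K) = 2 * r := by
    have : (m : ℚ) = 2 * r := hm
    exact_mod_cast congrArg (Rat.cast : ℚ → K) this
  obtain ⟨n, hn⟩ : ∃ n : ℤ, (n : ℚ) = r ^ 2 + 6 * s ^ 2 := by
    refine IsIntegrallyClosed.isIntegral_iff.mp ?_
    rw [← isIntegral_algebraMap_iff (algebraMap ℚ K).injective]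
    have hmint : IsIntegral ℤ (m : K) := isIntegral_algebraMap (x := m)
    have heq : algebraMap ℚ K (r ^ 2 + 6 * s ^ 2) =
        m * (r + s * θ) - (r + s * θ) ^ 2 := by
      rw [hm', eq_ratCast]
      push_cast
      linear_combination (s : K) ^ 2 * hθ
    exact heq ▸ (hmint.mul hx).sub (hx.pow 2)
  obtain ⟨a, b, rfl, rfl⟩ := exists_int_of_two_mul_of_sq_add_six_mul_sq hm hn
  exact ⟨a, b, by simp⟩

section Ring

variable {R : Type*} [CommRing R] {t : R}

lemma span_two_sqrt_neg_six_sq (ht : t ^ 2 = -6) :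
    Ideal.span {2, t} * Ideal.span {2, t} = Ideal.span {(2 : R)} := by
  refine le_antisymm ?_ ?_
  · rw [Ideal.span_pair_mul_span_pair, Ideal.span_le]
    rintro x (rfl | rfl | rfl | rfl) <;>
      simp only [SetLike.mem_coe, Ideal.mem_span_singleton]
    exacts [⟨2, rfl⟩, ⟨t, rfl⟩, ⟨t, mul_comm _ _⟩, ⟨-3, by linear_combination ht⟩]
  · rw [Ideal.span_singleton_le_iff_mem]
    have h2 : (2 : R) ∈ Ideal.span {2, t} := Ideal.subset_span (by simp)
    have h3 : t ∈ Ideal.span {2, t} := Ideal.subset_span (by simp)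
    have := sub_mem (neg_mem (Ideal.mul_mem_mul h3 h3)) (Ideal.mul_mem_mul h2 h2)
    convert this using 1
    linear_combination ht

/-- The ideals of `ℤ[√-6]` containing `2` are `⊤`, `(2)` and `(2, √-6)`. -/
lemma eq_top_or_eq_span_of_two_mem (ht : t ^ 2 = -6) (hrep : ∀ x : R, ∃ a b : ℤ, x = a + b * t)
    (J : Ideal R) (h2 : 2 ∈ J) :
    J = ⊤ ∨ J = Ideal.span {2} ∨ J = Ideal.span {2, t} := by
  by_cases hodd : ∃ a b : ℤ, (a : R) + b * t ∈ J ∧ Odd a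
  · left
    obtain ⟨a, b, hab, k, rfl⟩ := hodd
    rw [Ideal.eq_top_iff_one]
    have := J.sub_mem (J.mul_mem_left ((2 * k + 1 : ℤ) - b * t) hab)
      (J.mul_mem_left (2 * k ^ 2 + 2 * k + 3 * b ^ 2) h2)
    convert this using 1
    push_cast
    linear_combination b ^ 2 * ht
  push Not at hodd
  have heven (a b : ℤ) (h : (a : R) + b * t ∈ J) : ∃ k, a = 2 * k :=
    (Int.not_odd_iff_even.mp (hodd a b h)).two_dvd
  right
  by_cases hb : ∃ a b : ℤ, (a : R) + b * t ∈ J ∧ Odd b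
  · right
    obtain ⟨a, b, hab, l, rfl⟩ := hb
    obtain ⟨k, rfl⟩ := heven a _ hab
    refine le_antisymm (fun x hx ↦ ?_) (Ideal.span_le.mpr ?_)
    · obtain ⟨c, d, rfl⟩ := hrep x
      obtain ⟨m, rfl⟩ := heven c d hx
      exact Ideal.mem_span_pair.mpr ⟨m, d, by push_cast; ring⟩
    · have htJ : t ∈ J := by
        convert J.sub_mem hab (J.mul_mem_left (k + l * t) h2) using 1
        push_cast
        ring
      rintro x (rfl | rfl) <;> assumption
  · left
    push Not at hb
    refine le_antisymm (fun x hx ↦ ?_) ((Ideal.span_singleton_le_iff_mem J).mpr h2)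
    obtain ⟨c, d, rfl⟩ := hrep x
    obtain ⟨m, rfl⟩ := heven c d hx
    obtain ⟨l, rfl⟩ := (Int.not_odd_iff_even.mp (hb _ d hx)).two_dvd
    exact Ideal.mem_span_singleton.mpr ⟨m + l * t, by push_cast; ring⟩

/-- In `ℤ[√-6]`, the double of a nonzero ideal is contained in a principal ideal generated by
one of its elements. -/
lemma exists_dvd_two_mul_of_mem (ht : t ^ 2 = -6) (hrep : ∀ x : R, ∃ a b : ℤ, x = a + b * t)
    (I : Ideal R) (hI : I ≠ ⊥) : ∃ α ∈ I, α ≠ 0 ∧ ∀ β ∈ I, α ∣ 2 * β := by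
  have hex : ∃ n : ℕ, ∃ a b : ℤ, (a : R) + b * t ∈ I ∧ (a : R) + b * t ≠ 0 ∧
      a ^ 2 + 6 * b ^ 2 = n := by
    obtain ⟨x, hx, hx0⟩ := Submodule.exists_mem_ne_zero_of_ne_bot hI
    obtain ⟨a, b, rfl⟩ := hrep x
    exact ⟨(a ^ 2 + 6 * b ^ 2).toNat, a, b, hx, hx0, (Int.toNat_of_nonneg (by positivity)).symm⟩
  classical
  obtain ⟨a, b, hα, hα0, hn⟩ := Nat.find_spec hex
  have hmin {c d : ℤ} (h : (c : R) + d * t ∈ I) (hlt : c ^ 2 + 6 * d ^ 2 < a ^ 2 + 6 * b ^ 2) :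
      (c : R) + d * t = 0 := by
    by_contra h0
    have hle := Nat.find_min' hex ⟨c, d, h, h0, (Int.toNat_of_nonneg (by positivity)).symm⟩
    have := Int.toNat_of_nonneg (show 0 ≤ c ^ 2 + 6 * d ^ 2 by positivity)
    omega
  have hpos : 0 < a ^ 2 + 6 * b ^ 2 := by
    by_contra! hle
    have ha : a ^ 2 = 0 := by nlinarith [sq_nonneg a, sq_nonneg b]
    have hb : b ^ 2 = 0 := by nlinarith [sq_nonneg a, sq_nonneg b]
    simp only [pow_eq_zero_iff two_ne_zero] at ha hb
    simp [ha, hb] at hα0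
  refine ⟨_, hα, hα0, fun β hβ ↦ ?_⟩
  obtain ⟨c, d, rfl⟩ := hrep β
  obtain ⟨m, p, q, hm, hlt⟩ :=
    exists_sq_add_six_mul_sq_lt _ hpos (a * c + 6 * b * d) (a * d - b * c)
  have hrem : ((m * c - (p * a - 6 * q * b) : ℤ) : R) + (m * d - (p * b + q * a) : ℤ) * t =
      m * (c + d * t) - (p + q * t) * (a + b * t) := by
    push_cast
    linear_combination (q * b : R) * ht
  have hzero := hmin (c := m * c - (p * a - 6 * q * b)) (d := m * d - (p * b + q * a))
    (hrem ▸ I.sub_mem (I.mul_mem_left _ hβ) (I.mul_mem_left _ hα))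
    (lt_of_mul_lt_mul_left (by linarith) hpos.le)
  rw [hrem, sub_eq_zero] at hzero
  rcases hm with rfl | rfl
  · exact Dvd.dvd.mul_left ⟨p + q * t, by simpa [mul_comm] using hzero⟩ 2
  · exact ⟨p + q * t, by simpa [mul_comm] using hzero⟩

/-- The ideal `(2, √-6)` of `ℤ[√-6]` is not principal. -/
lemma not_isPrincipal_span_two_sqrt_neg_six (ht : t ^ 2 = -6)
    (hrep : ∀ x : R, ∃ a b : ℤ, x = a + b * t)
    (hzero : ∀ a b : ℤ, (a : R) + b * t = 0 → a = 0 ∧ b = 0) :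
    ¬ (Ideal.span {2, t}).IsPrincipal := by
  rintro ⟨g, hg⟩
  rw [← Ideal.span] at hg
  have hdvd {x : R} (hx : x ∈ Ideal.span {2, t}) : g ∣ x := by
    rwa [hg, Ideal.mem_span_singleton] at hx
  obtain ⟨a, b, rfl⟩ := hrep g
  obtain ⟨x, hx⟩ := hdvd (Ideal.subset_span (by simp : (2 : R) ∈ _))
  obtain ⟨y, hy⟩ := hdvd (Ideal.subset_span (by simp : t ∈ _))
  obtain ⟨u, v, huv⟩ := Ideal.mem_span_pair.mp
    (hg ▸ Ideal.mem_span_singleton_self ((a : R) + b * t) : (a : R) + b * t ∈ Ideal.span {2, t})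
  obtain ⟨c, d, rfl⟩ := hrep x
  obtain ⟨e, f, rfl⟩ := hrep y
  obtain ⟨k, l, rfl⟩ := hrep u
  obtain ⟨m, n, rfl⟩ := hrep v
  obtain ⟨h₁, h₂⟩ := hzero (a * c - 6 * b * d - 2) (a * d + b * c) (by
    push_cast; linear_combination -hx - (b * d : R) * ht)
  obtain ⟨h₃, h₄⟩ := hzero (a * e - 6 * b * f) (a * f + b * e - 1) (by
    push_cast; linear_combination -hy - (b * f : R) * ht)
  obtain ⟨h₅, h₆⟩ := hzero (2 * k - 6 * n - a) (2 * l + m - b) (by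
    push_cast; linear_combination huv - (n : R) * ht)
  have hnorm : (a ^ 2 + 6 * b ^ 2) * (c ^ 2 + 6 * d ^ 2) = 4 := by
    linear_combination (a * c - 6 * b * d + 2) * h₁ + 6 * (a * d + b * c) * h₂
  have hb : b = 0 := by
    by_contra hb
    have hb1 : 0 < b ^ 2 := by positivity
    have hpos : 0 < c ^ 2 + 6 * d ^ 2 := by
      by_contra! h
      nlinarith [sq_nonneg a]
    nlinarith [sq_nonneg a]
  subst hb
  have h2f : 2 * ((k - 3 * n) * f) = 1 := by linear_combination h₄ + f * h₅
  omega

end Ring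

/-- A number field of degree `2` over `ℚ` containing a square root of `−6`
has class number `2`. -/
theorem classNumber_sqrt_neg_six (K : Type) [Field K] [NumberField K]
    (hdeg : Module.finrank ℚ K = 2) (θ : K) (hθ : θ ^ 2 = -6) :
    NumberField.classNumber K = 2 := by
  have hθint : IsIntegral ℤ θ := by
    refine IsIntegral.of_pow two_pos ?_
    rw [hθ]
    exact_mod_cast isIntegral_algebraMap (R := ℤ) (A := K) (x := -6)
  obtain ⟨t, rfl⟩ : ∃ t : 𝓞 K, (t : K) = θ := ⟨⟨θ, hθint⟩, rfl⟩
  have ht : t ^ 2 = -6 := by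
    apply RingOfIntegers.coe_injective
    rw [map_pow, map_neg, map_ofNat]
    exact hθ
  have hrep (x : 𝓞 K) : ∃ a b : ℤ, x = a + b * t := by
    obtain ⟨a, b, h⟩ :=
      exists_ringOfIntegers_eq_add_mul_sqrt_neg_six hdeg hθ x x.isIntegral_coe
    exact ⟨a, b, by ext; simpa using h⟩
  have hzero (a b : ℤ) (h : (a : 𝓞 K) + b * t = 0) : a = 0 ∧ b = 0 := by
    have := eq_zero_of_add_mul_sqrt_neg_six hθ (r := a) (s := b)
      (by simpa using congrArg (algebraMap (𝓞 K) K) h)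
    exact_mod_cast this
  have hPP := span_two_sqrt_neg_six_sq ht
  have hP0 : Ideal.span {2, t} ∈ (Ideal (𝓞 K))⁰ := by
    rw [mem_nonZeroDivisors_iff_ne_zero]
    intro h
    have h2 : (2 : 𝓞 K) ∈ Ideal.span {2, t} := Ideal.subset_span (by simp)
    simp [h] at h2
  rw [classNumber, ← Nat.card_eq_fintype_card, Nat.card_eq_two_iff]
  refine ⟨1, ClassGroup.mk0 ⟨_, hP0⟩, ?_, Set.eq_univ_of_forall fun C ↦ ?_⟩
  · rw [ne_comm, Ne, ClassGroup.mk0_eq_one_iff]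
    exact not_isPrincipal_span_two_sqrt_neg_six ht hrep hzero
  obtain ⟨⟨I, hI⟩, rfl⟩ := ClassGroup.mk0_surjective C
  obtain ⟨α, hα, hα0, hdvd⟩ :=
    exists_dvd_two_mul_of_mem ht hrep I (nonZeroDivisors.ne_zero hI)
  obtain ⟨J, hJ⟩ : Ideal.span {α} ∣ Ideal.span {2} * I := by
    rw [Ideal.dvd_iff_le, Ideal.span_singleton_mul_le_iff]
    exact fun β hβ ↦ Ideal.mem_span_singleton.mpr (hdvd β hβ)
  have h2J : 2 ∈ J := by
    have : 2 * α ∈ Ideal.span {α} * J :=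
      hJ ▸ Ideal.mul_mem_mul (Ideal.mem_span_singleton_self 2) hα
    obtain ⟨z, hz, h⟩ := Ideal.mem_span_singleton_mul.mp this
    rw [mul_comm] at h
    exact mul_right_cancel₀ hα0 h ▸ hz
  have h20 : (2 : 𝓞 K) ≠ 0 := two_ne_zero
  rcases eq_top_or_eq_span_of_two_mem ht hrep J h2J with rfl | rfl | rfl
  · left
    rw [← map_one ClassGroup.mk0, ClassGroup.mk0_eq_mk0_iff]
    exact ⟨2, α, h20, hα0, by simpa using hJ⟩
  · left
    rw [← map_one ClassGroup.mk0, ClassGroup.mk0_eq_mk0_iff]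
    exact ⟨2, α * 2, h20, mul_ne_zero hα0 h20, by
      simpa [Ideal.span_singleton_mul_span_singleton] using hJ⟩
  · right
    rw [Set.mem_singleton_iff, ClassGroup.mk0_eq_mk0_iff]
    exact ⟨2, α, h20, hα0, hJ⟩
end

section
/- Let K be a number field of degree 2 over ℚ containing an element θ with θ² = −30. Then the class number of K (the cardinality of the ideal class group of its ring of integers) equals 4. -/
open Module NumberField
open scoped nonZeroDivisors Real

section Basis

variable {R S : Type*} [CommRing R] [CommRing S] [Algebra R S]

lemma leftMulMatrix_quadratic (B : Basis (Fin 2) R S) (h0 : B 0 = 1) (d : R)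
    (h1 : B 1 ^ 2 = algebraMap R S d) (a c : R) :
    Algebra.leftMulMatrix B (algebraMap R S a + algebraMap R S c * B 1) = !![a, d * c; c, a] := by
  have e0 : (algebraMap R S a + algebraMap R S c * B 1) * B 0 = a • B 0 + c • B 1 := by
    rw [h0, Algebra.smul_def, Algebra.smul_def]; ring
  have e1 : (algebraMap R S a + algebraMap R S c * B 1) * B 1 = (d * c) • B 0 + a • B 1 := by
    rw [h0, Algebra.smul_def, Algebra.smul_def, map_mul]; linear_combination algebraMap R S c * h1
  ext i j
  rw [Algebra.leftMulMatrix_eq_repr_mul]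
  fin_cases j
  · simp only [Fin.zero_eta, e0]
    fin_cases i <;> simp
  · simp only [Fin.mk_one, e1]
    fin_cases i <;> simp

lemma norm_quadratic (B : Basis (Fin 2) R S) (h0 : B 0 = 1) (d : R)
    (h1 : B 1 ^ 2 = algebraMap R S d) (a c : R) :
    Algebra.norm R (algebraMap R S a + algebraMap R S c * B 1) = a ^ 2 - d * c ^ 2 := by
  rw [Algebra.norm_eq_matrix_det B, leftMulMatrix_quadratic B h0 d h1, Matrix.det_fin_two_of]
  ring

lemma trace_quadratic (B : Basis (Fin 2) R S) (h0 : B 0 = 1) (d : R)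
    (h1 : B 1 ^ 2 = algebraMap R S d) (a c : R) :
    Algebra.trace R S (algebraMap R S a + algebraMap R S c * B 1) = 2 * a := by
  rw [Algebra.trace_eq_matrix_trace B, leftMulMatrix_quadratic B h0 d h1, Matrix.trace_fin_two_of]
  ring

lemma discr_quadratic (B : Basis (Fin 2) R S) (h0 : B 0 = 1) (d : R)
    (h1 : B 1 ^ 2 = algebraMap R S d) : Algebra.discr R B = 4 * d := by
  have t00 := trace_quadratic B h0 d h1 1 0
  have t01 := trace_quadratic B h0 d h1 0 1
  have t11 := trace_quadratic B h0 d h1 d 0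
  simp only [map_one, map_zero, zero_mul, add_zero, one_mul, zero_add] at t00 t01 t11
  rw [Algebra.discr_def, Matrix.det_fin_two]
  simp only [Algebra.traceMatrix_apply, Algebra.traceForm_apply, h0, one_mul, mul_one, ← pow_two,
    h1, t00, t01, t11, one_pow]
  ring

end Basis

lemma exists_int_eq_of_isIntegral {q : ℚ} (h : IsIntegral ℤ q) : ∃ n : ℤ, (n : ℚ) = q := by
  simpa using IsIntegrallyClosed.isIntegral_iff.mp h

/-- The integrality criterion for `p + q √-30`. -/
lemma exists_int_of_trace_norm {p q : ℚ} {m n : ℤ} (hm : (m : ℚ) = 2 * p)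
    (hn : (n : ℚ) = p ^ 2 + 30 * q ^ 2) : (∃ a : ℤ, (a : ℚ) = p) ∧ ∃ b : ℤ, (b : ℚ) = q := by
  obtain ⟨s, hs⟩ : ∃ s : ℤ, (s : ℚ) = 60 * q := by
    refine exists_int_eq_of_isIntegral (IsIntegral.of_pow (n := 2) two_pos ?_)
    have : (60 * q) ^ 2 = ((30 * (4 * n - m ^ 2) : ℤ) : ℚ) := by
      push_cast; rw [hm, hn]; ring
    rw [this]
    exact isIntegral_algebraMap (R := ℤ) (A := ℚ)
  have hsq : s ^ 2 = 30 * (4 * n - m ^ 2) := by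
    have : (s : ℚ) ^ 2 = 30 * (4 * n - m ^ 2) := by rw [hs, hm, hn]; ring
    exact_mod_cast this
  have h30 : (30 : ℤ) ∣ s := by
    have hsf : Squarefree (30 : ℤ) := by
      rw [← Int.squarefree_natAbs]; decide +kernel
    exact (hsf.dvd_pow_iff_dvd two_ne_zero).mp ⟨_, hsq⟩
  obtain ⟨r, rfl⟩ := h30
  have hr : 30 * r ^ 2 + m ^ 2 = 4 * n := by nlinarith
  have hme : Even m := by
    have : Even (m ^ 2) := ⟨2 * n - 15 * r ^ 2, by linarith⟩
    exact (Int.even_pow.mp this).1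
  obtain ⟨a, rfl⟩ := hme
  have hre : Even r := by
    have : Even (r ^ 2) := by
      refine ⟨(n - a ^ 2 - 7 * r ^ 2), by nlinarith⟩
    exact (Int.even_pow.mp this).1
  obtain ⟨b, rfl⟩ := hre
  refine ⟨⟨a, ?_⟩, ⟨b, ?_⟩⟩
  · push_cast at hm; linarith
  · push_cast at hs; linarith

section Field

variable {K : Type*} [Field K] [NumberField K]

lemma exists_basis_rat (hdeg : finrank ℚ K = 2) {θ : K} (hθ : θ ^ 2 = -30) :
    ∃ B : Basis (Fin 2) ℚ K, B 0 = 1 ∧ B 1 = θ := by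
  have hli : LinearIndependent ℚ ![(1 : K), θ] := by
    rw [LinearIndependent.pair_iff]
    intro s t h
    rw [Algebra.smul_def, Algebra.smul_def, mul_one] at h
    have h2 : s ^ 2 + 30 * t ^ 2 = 0 := by
      have : algebraMap ℚ K (s ^ 2 + 30 * t ^ 2) = 0 := by
        simp only [map_add, map_mul, map_pow, map_ofNat]
        linear_combination (algebraMap ℚ K s - algebraMap ℚ K t * θ) * h + algebraMap ℚ K t ^ 2 * hθ
      exact (map_eq_zero _).mp this
    constructor <;> nlinarith [sq_nonneg s, sq_nonneg t]
  refine ⟨basisOfLinearIndependentOfCardEqFinrank hli (by simp [hdeg]), by simp, by simp⟩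

lemma exists_int_repr (hdeg : finrank ℚ K = 2) {t : 𝓞 K} (ht : t ^ 2 = -30) (x : 𝓞 K) :
    ∃ a b : ℤ, x = a + b * t := by
  have hθ : algebraMap (𝓞 K) K t ^ 2 = -30 := by
    rw [← map_pow, ht, map_neg, map_ofNat]
  obtain ⟨B, h0, h1⟩ := exists_basis_rat hdeg hθ
  have hd : B 1 ^ 2 = algebraMap ℚ K (-30) := by rw [h1, hθ]; simp
  set p := B.repr (algebraMap (𝓞 K) K x) 0
  set q := B.repr (algebraMap (𝓞 K) K x) 1
  have hx : algebraMap (𝓞 K) K x = algebraMap ℚ K p + algebraMap ℚ K q * B 1 := by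
    conv_lhs => rw [← B.sum_repr (algebraMap (𝓞 K) K x)]
    rw [Fin.sum_univ_two, h0, Algebra.smul_def, Algebra.smul_def, mul_one]
  have hxi := RingOfIntegers.isIntegral_coe x
  obtain ⟨m, hm⟩ := exists_int_eq_of_isIntegral (Algebra.isIntegral_trace (L := ℚ) hxi)
  obtain ⟨n, hn⟩ := exists_int_eq_of_isIntegral (Algebra.isIntegral_norm ℚ hxi)
  rw [hx, trace_quadratic B h0 _ hd] at hm
  rw [hx, norm_quadratic B h0 _ hd] at hn
  obtain ⟨⟨a, ha⟩, ⟨b, hb⟩⟩ := exists_int_of_trace_norm (p := p) (q := q) hm (by rw [hn]; ring)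
  refine ⟨a, b, FaithfulSMul.algebraMap_injective (𝓞 K) K ?_⟩
  rw [hx, ← ha, ← hb, h1]
  simp

lemma exists_basis_int (hdeg : finrank ℚ K = 2) {t : 𝓞 K} (ht : t ^ 2 = -30) :
    ∃ B : Basis (Fin 2) ℤ (𝓞 K), B 0 = 1 ∧ B 1 = t := by
  have hli : LinearIndependent ℤ ![(1 : 𝓞 K), t] := by
    rw [LinearIndependent.pair_iff]
    intro r s h
    simp only [zsmul_eq_mul, mul_one] at h
    have h2 : r ^ 2 + 30 * s ^ 2 = 0 := by
      have : ((r ^ 2 + 30 * s ^ 2 : ℤ) : 𝓞 K) = 0 := by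
        push_cast
        linear_combination ((r : 𝓞 K) - s * t) * h + (s : 𝓞 K) ^ 2 * ht
      exact_mod_cast this
    constructor <;> nlinarith [sq_nonneg r, sq_nonneg s]
  suffices hsp : ⊤ ≤ Submodule.span ℤ (Set.range ![(1 : 𝓞 K), t]) from
    ⟨Basis.mk hli hsp, by simp, by simp⟩
  intro x _
  obtain ⟨a, b, rfl⟩ := exists_int_repr hdeg ht x
  simp only [Matrix.range_cons, Matrix.range_empty, Set.union_empty, Set.singleton_union]
  rw [Submodule.mem_span_pair]
  exact ⟨a, b, by simp⟩

lemma absNorm_span_int_repr (hdeg : finrank ℚ K = 2) {t : 𝓞 K} (ht : t ^ 2 = -30) (a b : ℤ) :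
    (Ideal.absNorm (Ideal.span {(a + b * t : 𝓞 K)}) : ℤ) = a ^ 2 + 30 * b ^ 2 := by
  obtain ⟨B, h0, h1⟩ := exists_basis_int hdeg ht
  have hd : B 1 ^ 2 = algebraMap ℤ (𝓞 K) (-30) := by rw [h1, ht]; simp
  have := norm_quadratic B h0 _ hd a b
  rw [h1] at this
  simp only [algebraMap_int_eq, eq_intCast] at this
  rw [Ideal.absNorm_span_singleton, this, Int.natCast_natAbs, abs_of_nonneg] <;> nlinarith

lemma exists_ideal_absNorm_le_six (hdeg : finrank ℚ K = 2) {t : 𝓞 K} (ht : t ^ 2 = -30)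
    (C : ClassGroup (𝓞 K)) :
    ∃ I : (Ideal (𝓞 K))⁰, ClassGroup.mk0 I = C ∧ Ideal.absNorm (I : Ideal (𝓞 K)) ≤ 6 := by
  obtain ⟨I, hI, hle⟩ := exists_ideal_in_class_of_norm_le C
  refine ⟨I, hI, ?_⟩
  obtain ⟨B, h0, h1⟩ := exists_basis_int hdeg ht
  have hd : B 1 ^ 2 = algebraMap ℤ (𝓞 K) (-30) := by rw [h1, ht]; simp
  have hdisc : discr K = -120 := by
    rw [← discr_eq_discr K B, discr_quadratic B h0 _ hd]; norm_num
  have hc : InfinitePlace.nrComplexPlaces K ≤ 1 := by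
    have := InfinitePlace.card_add_two_mul_card_eq_rank K
    omega
  have hpi := Real.pi_gt_d2
  have hpow : (4 / π) ^ InfinitePlace.nrComplexPlaces K ≤ (4 / π) ^ 1 := by
    refine pow_le_pow_right₀ ?_ hc
    rw [one_le_div Real.pi_pos]; exact Real.pi_le_four
  have hsqrt : √(120 : ℝ) ≤ 10.96 := Real.sqrt_le_iff.mpr ⟨by norm_num, by norm_num⟩
  have hbound : (4 / π) < 1.2739 := by
    rw [div_lt_iff₀ Real.pi_pos]; linarith
  rw [hdeg, hdisc] at hle
  norm_num [Nat.factorial] at hle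
  have : (Ideal.absNorm (I : Ideal (𝓞 K)) : ℝ) < 7 := by
    refine hle.trans_lt ?_
    nlinarith [Real.sqrt_nonneg (120 : ℝ)]
  have : Ideal.absNorm (I : Ideal (𝓞 K)) < 7 := by exact_mod_cast this
  omega

/-- The ideal `(n, t)`; when `t ^ 2 = -30` and `n ∣ 30` it is the ideal with square `(n)`. -/
def ramifiedIdeal (t : 𝓞 K) (n : ℕ) : Ideal (𝓞 K) := Ideal.span {(n : 𝓞 K), t}

lemma coprime_of_mul_eq_thirty {n m : ℕ} (h : n * m = 30) : n.Coprime m := by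
  refine Nat.coprime_of_squarefree_mul ?_
  rw [h]
  decide +kernel

lemma ramifiedIdeal_mul_self {t : 𝓞 K} (ht : t ^ 2 = -30) {n m : ℕ} (h : n * m = 30) :
    ramifiedIdeal t n * ramifiedIdeal t n = Ideal.span {(n : 𝓞 K)} := by
  have h' : (n : 𝓞 K) * m = 30 := by exact_mod_cast congrArg (Nat.cast (R := 𝓞 K)) h
  obtain ⟨u, v, huv⟩ : IsCoprime (n : 𝓞 K) m := by
    simpa using (Nat.isCoprime_iff_coprime.mpr (coprime_of_mul_eq_thirty h)).map
      (Int.castRingHom (𝓞 K))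
  rw [ramifiedIdeal, Ideal.span_pair_mul_span_pair]
  refine le_antisymm (Ideal.span_le.mpr ?_) ?_
  · simp only [Set.insert_subset_iff, Set.singleton_subset_iff, SetLike.mem_coe,
      Ideal.mem_span_singleton]
    exact ⟨⟨n, rfl⟩, ⟨t, rfl⟩, ⟨t, mul_comm _ _⟩, ⟨-m, by linear_combination ht + h'⟩⟩
  · rw [Ideal.span_singleton_le_iff_mem]
    have hn : u * (n * n) - v * (t * t) = n := by
      linear_combination (n : 𝓞 K) * huv - v * ht - v * h'
    have hmem : u * (n * n) - v * (t * t) ∈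
        Ideal.span {(n : 𝓞 K) * n, n * t, t * n, t * t} :=
      sub_mem (Ideal.mul_mem_left _ _ (Ideal.subset_span (by simp)))
        (Ideal.mul_mem_left _ _ (Ideal.subset_span (by simp)))
    rwa [hn] at hmem

lemma ramifiedIdeal_mul (t : 𝓞 K) {n m : ℕ} (hc : n.Coprime m) :
    ramifiedIdeal t n * ramifiedIdeal t m = ramifiedIdeal t (n * m) := by
  obtain ⟨u, v, huv⟩ : IsCoprime (n : 𝓞 K) m := by
    simpa using (Nat.isCoprime_iff_coprime.mpr hc).map (Int.castRingHom (𝓞 K))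
  simp only [ramifiedIdeal]
  rw [Ideal.span_pair_mul_span_pair, Nat.cast_mul]
  refine le_antisymm (Ideal.span_le.mpr ?_) (Ideal.span_le.mpr ?_)
  · simp only [Set.insert_subset_iff, Set.singleton_subset_iff, SetLike.mem_coe]
    have htm : t ∈ Ideal.span {(n : 𝓞 K) * m, t} := Ideal.subset_span (by simp)
    exact ⟨Ideal.subset_span (by simp), Ideal.mul_mem_left _ _ htm, Ideal.mul_mem_right _ _ htm,
      Ideal.mul_mem_left _ _ htm⟩
  · simp only [Set.insert_subset_iff, Set.singleton_subset_iff, SetLike.mem_coe]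
    refine ⟨Ideal.subset_span (by simp), ?_⟩
    have htu : u * (n * t) + v * (t * m) = t := by linear_combination t * huv
    have hmem : u * (n * t) + v * (t * m) ∈
        Ideal.span {(n : 𝓞 K) * m, n * t, t * m, t * t} :=
      add_mem (Ideal.mul_mem_left _ _ (Ideal.subset_span (by simp)))
        (Ideal.mul_mem_left _ _ (Ideal.subset_span (by simp)))
    rwa [htu] at hmem

lemma absNorm_ramifiedIdeal (hdeg : finrank ℚ K = 2) {t : 𝓞 K} (ht : t ^ 2 = -30) {n m : ℕ}
    (h : n * m = 30) : Ideal.absNorm (ramifiedIdeal t n) = n := by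
  have h1 := congrArg Ideal.absNorm (ramifiedIdeal_mul_self ht h)
  have h2 := absNorm_span_int_repr hdeg ht n 0
  simp only [Int.cast_natCast, Int.cast_zero, zero_mul, add_zero] at h2
  rw [map_mul] at h1
  have h3 : Ideal.absNorm (Ideal.span {(n : 𝓞 K)}) = n ^ 2 := by
    have : (Ideal.absNorm (Ideal.span {(n : 𝓞 K)}) : ℤ) = (n ^ 2 : ℕ) := by
      rw [h2]; push_cast; ring
    exact_mod_cast this
  rw [h3, ← pow_two] at h1
  exact Nat.pow_left_injective two_ne_zero h1

lemma eq_of_le_of_absNorm_eq {I J : Ideal (𝓞 K)} (hle : I ≤ J)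
    (h : Ideal.absNorm I = Ideal.absNorm J) (h0 : Ideal.absNorm J ≠ 0) : I = J := by
  obtain ⟨L, rfl⟩ := Ideal.dvd_iff_le.mpr hle
  rw [map_mul] at h
  have hL : Ideal.absNorm L = 1 := by
    exact Nat.eq_of_mul_eq_mul_left (Nat.pos_of_ne_zero h0) (by rw [h, mul_one])
  rw [Ideal.absNorm_eq_one_iff.mp hL, Ideal.mul_top]

lemma absNorm_dvd_of_mem (hdeg : finrank ℚ K = 2) {t : 𝓞 K} (ht : t ^ 2 = -30)
    {I : Ideal (𝓞 K)} {a b : ℤ} (hx : (a + b * t : 𝓞 K) ∈ I) :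
    (Ideal.absNorm I : ℤ) ∣ a ^ 2 + 30 * b ^ 2 := by
  rw [← absNorm_span_int_repr hdeg ht]
  exact_mod_cast Ideal.absNorm_dvd_absNorm_of_le ((Ideal.span_singleton_le_iff_mem I).mpr hx)

lemma eq_ramifiedIdeal (hdeg : finrank ℚ K = 2) {t : 𝓞 K} (ht : t ^ 2 = -30) {n m : ℕ}
    (h : n * m = 30) {I : Ideal (𝓞 K)} (hI : Ideal.absNorm I = n) : I = ramifiedIdeal t n := by
  have hn := absNorm_ramifiedIdeal hdeg ht h
  have hn0 : n ≠ 0 := by rintro rfl; simp at h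
  refine eq_of_le_of_absNorm_eq ?_ (hI.trans hn.symm) (hn.symm ▸ hn0)
  intro x hx
  obtain ⟨a, b, rfl⟩ := exists_int_repr hdeg ht x
  have hdvd := absNorm_dvd_of_mem hdeg ht hx
  rw [hI] at hdvd
  have h30 : (n : ℤ) ∣ 30 := ⟨m, by exact_mod_cast h.symm⟩
  have hsq : (n : ℤ) ∣ a ^ 2 := (dvd_add_left (h30.mul_right _)).mp hdvd
  have hsf : Squarefree (n : ℤ) := by
    refine Squarefree.squarefree_of_dvd h30 ?_
    rw [← Int.squarefree_natAbs]; decide +kernel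
  obtain ⟨k, rfl⟩ := (hsf.dvd_pow_iff_dvd two_ne_zero).mp hsq
  rw [ramifiedIdeal, Ideal.mem_span_pair]
  exact ⟨k, b, by push_cast; ring⟩

lemma eq_span_two (hdeg : finrank ℚ K = 2) {t : 𝓞 K} (ht : t ^ 2 = -30)
    {I : Ideal (𝓞 K)} (hI : Ideal.absNorm I = 4) : I = Ideal.span {2} := by
  have hn : Ideal.absNorm (Ideal.span {(2 : 𝓞 K)}) = 4 := by
    have := absNorm_span_int_repr hdeg ht 2 0
    simp only [Int.cast_ofNat, Int.cast_zero, zero_mul, add_zero] at this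
    have h4 : (Ideal.absNorm (Ideal.span {(2 : 𝓞 K)}) : ℤ) = (4 : ℕ) := by rw [this]; norm_num
    exact_mod_cast h4
  refine eq_of_le_of_absNorm_eq ?_ (hI.trans hn.symm) (by simp [hn])
  intro x hx
  obtain ⟨a, b, rfl⟩ := exists_int_repr hdeg ht x
  obtain ⟨c, hc⟩ := absNorm_dvd_of_mem hdeg ht hx
  rw [hI] at hc
  push_cast at hc
  have hae : Even (a ^ 2) := ⟨2 * c - 15 * b ^ 2, by linarith⟩
  obtain ⟨k, rfl⟩ := (Int.even_pow.mp hae).1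
  have hbe : Even (b ^ 2) := ⟨c - k ^ 2 - 7 * b ^ 2, by linarith⟩
  obtain ⟨l, rfl⟩ := (Int.even_pow.mp hbe).1
  rw [Ideal.mem_span_singleton]
  exact ⟨k + l * t, by push_cast; ring⟩

lemma not_isPrincipal_ramifiedIdeal (hdeg : finrank ℚ K = 2) {t : 𝓞 K} (ht : t ^ 2 = -30)
    {n m : ℕ} (h : n * m = 30) (hlt : n < 30) (hsq : ¬ IsSquare n) :
    ¬ (ramifiedIdeal t n).IsPrincipal := by
  rintro ⟨x, hx⟩
  obtain ⟨a, b, rfl⟩ := exists_int_repr hdeg ht x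
  have h1 := absNorm_span_int_repr hdeg ht a b
  rw [← Ideal.submodule_span_eq, ← hx, absNorm_ramifiedIdeal hdeg ht h] at h1
  have hb : b = 0 := by
    by_contra hb
    have : 0 < b ^ 2 := by positivity
    have : (n : ℤ) < 30 := by exact_mod_cast hlt
    nlinarith [sq_nonneg a]
  subst hb
  refine hsq ⟨a.natAbs, ?_⟩
  zify
  rw [h1, ← abs_mul, abs_mul_self]
  ring

end Field

/-- A number field of degree `2` over `ℚ` containing a square root of `−30`
has class number `4`. -/
theorem classNumber_sqrt_neg_thirty (K : Type) [Field K] [NumberField K]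
    (hdeg : Module.finrank ℚ K = 2) (θ : K) (hθ : θ ^ 2 = -30) :
    NumberField.classNumber K = 4 := by
  classical
  obtain ⟨t, ht⟩ : ∃ t : 𝓞 K, t ^ 2 = -30 := by
    have hint : IsIntegral ℤ θ := by
      refine IsIntegral.of_pow two_pos ?_
      rw [hθ]
      simpa using isIntegral_algebraMap (R := ℤ) (A := K) (x := -30)
    obtain ⟨t, rfl⟩ := (IsIntegralClosure.isIntegral_iff (A := 𝓞 K)).mp hint
    refine ⟨t, FaithfulSMul.algebraMap_injective (𝓞 K) K ?_⟩
    rw [map_pow, hθ, map_neg, map_ofNat]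
  have ht0 : t ≠ 0 := by
    rintro rfl
    norm_num at ht
  have hne (n : ℕ) : ramifiedIdeal t n ∈ (Ideal (𝓞 K))⁰ := by
    refine mem_nonZeroDivisors_of_ne_zero fun h => ht0 ?_
    have : t ∈ ramifiedIdeal t n := Ideal.subset_span (by simp)
    simpa [h] using this
  let c (n : ℕ) : ClassGroup (𝓞 K) := ClassGroup.mk0 ⟨ramifiedIdeal t n, hne n⟩
  have hc1 (n : ℕ) : c n = 1 ↔ (ramifiedIdeal t n).IsPrincipal := ClassGroup.mk0_eq_one_iff _
  have hmul {n m : ℕ} (hcop : n.Coprime m) : c n * c m = c (n * m) := by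
    rw [← map_mul]
    exact congrArg ClassGroup.mk0 (Subtype.ext (ramifiedIdeal_mul t hcop))
  have hself {n m : ℕ} (h : n * m = 30) : c n * c n = 1 := by
    rw [← map_mul, ClassGroup.mk0_eq_one_iff]
    exact ⟨n, ramifiedIdeal_mul_self ht h⟩
  have hI {n m : ℕ} (h : n * m = 30) {I : (Ideal (𝓞 K))⁰}
      (hIn : Ideal.absNorm (I : Ideal (𝓞 K)) = n) : ClassGroup.mk0 I = c n :=
    congrArg ClassGroup.mk0 (Subtype.ext (eq_ramifiedIdeal hdeg ht h hIn))
  have h1 : c 1 = 1 := by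
    have htop : ramifiedIdeal t 1 = ⊤ :=
      (Ideal.eq_top_iff_one _).mpr (Ideal.subset_span (by simp))
    rw [hc1, htop]
    exact top_isPrincipal
  have h30 : c 30 = 1 := by
    rw [hc1]
    refine ⟨t, le_antisymm (Ideal.span_le.mpr ?_) (Ideal.span_mono (by simp))⟩
    simp only [Set.insert_subset_iff, Set.singleton_subset_iff, SetLike.mem_coe,
      Ideal.submodule_span_eq, Ideal.mem_span_singleton]
    exact ⟨⟨-t, by push_cast; linear_combination ht⟩, dvd_rfl⟩
  have h22 := hself (n := 2) (m := 15) rfl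
  have h33 := hself (n := 3) (m := 10) rfl
  have h66 := hself (n := 6) (m := 5) rfl
  have h23 : c 2 * c 3 = c 6 := hmul (by norm_num)
  have h56 : c 5 * c 6 = 1 := (hmul (by norm_num)).trans h30
  have h5 : c 5 = c 6 := mul_right_cancel (h56.trans h66.symm)
  have n2 : c 2 ≠ 1 := (hc1 2).not.mpr
    (not_isPrincipal_ramifiedIdeal hdeg ht (m := 15) rfl (by norm_num) (by decide +kernel))
  have n3 : c 3 ≠ 1 := (hc1 3).not.mpr
    (not_isPrincipal_ramifiedIdeal hdeg ht (m := 10) rfl (by norm_num) (by decide +kernel))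
  have n6 : c 6 ≠ 1 := (hc1 6).not.mpr
    (not_isPrincipal_ramifiedIdeal hdeg ht (m := 5) rfl (by norm_num) (by decide +kernel))
  have n23 : c 2 ≠ c 3 := fun h => n6 (by rw [← h23, h, h33])
  have n26 : c 2 ≠ c 6 := fun h => n3 (by simpa [← h23] using h)
  have n36 : c 3 ≠ c 6 := fun h => n2 (by simpa [← h23] using h)
  have huniv : (Finset.univ : Finset (ClassGroup (𝓞 K))) = {1, c 2, c 3, c 6} := by
    refine (Finset.eq_univ_iff_forall.mpr fun C => ?_).symm
    obtain ⟨I, rfl, hle⟩ := exists_ideal_absNorm_le_six hdeg ht C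
    have hpos := Ideal.absNorm_pos_of_nonZeroDivisors I
    simp only [Finset.mem_insert, Finset.mem_singleton]
    generalize hN : Ideal.absNorm (I : Ideal (𝓞 K)) = N at hle hpos
    interval_cases N
    · exact Or.inl ((hI (m := 30) rfl hN).trans h1)
    · exact Or.inr (Or.inl (hI (m := 15) rfl hN))
    · exact Or.inr (Or.inr (Or.inl (hI (m := 10) rfl hN)))
    · refine Or.inl ((ClassGroup.mk0_eq_one_iff I.2).mpr ?_)
      exact ⟨2, eq_span_two hdeg ht hN⟩
    · exact Or.inr (Or.inr (Or.inr ((hI (m := 6) rfl hN).trans h5)))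
    · exact Or.inr (Or.inr (Or.inr (hI (m := 5) rfl hN)))
  rw [NumberField.classNumber, ← Finset.card_univ, huniv]
  simp [n2.symm, n3.symm, n6.symm, n23, n26, n36]
end

section
/- In the group GL(3, 𝔽₂) of invertible 3×3 matrices over the field with two elements (a simple group of order 168), the number of conjugacy classes of subgroups isomorphic to the Klein four-group is exactly 2. That is, the set of subgroups H of GL(3, 𝔽₂) such that H is isomorphic to ℤ/2ℤ × ℤ/2ℤ, modulo the equivalence relation 'H and K are conjugate in GL(3, 𝔽₂)', has exactly 2 equivalence classes. -/
/-- The Klein four-group `V₄ = ℤ/2ℤ × ℤ/2ℤ` (written multiplicatively). -/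
abbrev Klein : Type := Multiplicative (ZMod 2) × Multiplicative (ZMod 2)

/-- The conjugacy relation on subgroups of `G` isomorphic to the Klein four-group. -/
def kleinConj (G : Type*) [Group G]
    (H K : {H : Subgroup G // Nonempty (H ≃* Klein)}) : Prop :=
  ∃ g : G, Subgroup.map (MulAut.conj g).toMonoidHom H.1 = K.1

section Unitriangular

variable {R : Type*} [CommRing R]

/-- The upper unitriangular `3 × 3` matrix with superdiagonal `(a, b)` and corner entry `c`. -/
def unitriangular (a b c : R) : GL (Fin 3) R where
  val := !![1, a, c; 0, 1, b; 0, 0, 1]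
  inv := !![1, -a, a * b - c; 0, 1, -b; 0, 0, 1]
  val_inv := by
    ext i j
    fin_cases i <;> fin_cases j <;> simp [Matrix.mul_apply, Fin.sum_univ_three]
    ring
  inv_val := by
    ext i j
    fin_cases i <;> fin_cases j <;> simp [Matrix.mul_apply, Fin.sum_univ_three]
    ring

theorem coe_unitriangular (a b c : R) :
    (unitriangular a b c : Matrix (Fin 3) (Fin 3) R) = !![1, a, c; 0, 1, b; 0, 0, 1] :=
  rfl

theorem unitriangular_mul (a b c a' b' c' : R) :
    unitriangular a b c * unitriangular a' b' c' =
      unitriangular (a + a') (b + b') (c + c' + a * b') := by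
  apply Units.ext
  rw [Units.val_mul]
  simp only [coe_unitriangular]
  ext i j
  fin_cases i <;> fin_cases j <;> simp [Matrix.mul_apply, Fin.sum_univ_three] <;> ring

theorem unitriangular_zero : unitriangular (0 : R) 0 0 = 1 := by
  apply Units.ext
  rw [coe_unitriangular, Units.val_one]
  ext i j
  fin_cases i <;> fin_cases j <;> simp

theorem unitriangular_inj {a b c a' b' c' : R} :
    unitriangular a b c = unitriangular a' b' c' ↔ a = a' ∧ b = b' ∧ c = c' := by
  refine ⟨fun h => ?_, by rintro ⟨rfl, rfl, rfl⟩; rfl⟩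
  have entry (i j : Fin 3) := congrArg (fun g : GL (Fin 3) R => (g : Matrix _ _ R) i j) h
  exact ⟨by simpa [coe_unitriangular] using entry 0 1,
    by simpa [coe_unitriangular] using entry 1 2, by simpa [coe_unitriangular] using entry 0 2⟩

theorem unitriangular_inv (a b c : R) :
    (unitriangular a b c)⁻¹ = unitriangular (-a) (-b) (a * b - c) :=
  inv_eq_of_mul_eq_one_right <| by
    rw [unitriangular_mul, ← unitriangular_zero, unitriangular_inj]
    exact ⟨by ring, by ring, by ring⟩

theorem unitriangular_mulVec (a b c : R) (v : Fin 3 → R) :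
    (unitriangular a b c : Matrix (Fin 3) (Fin 3) R).mulVec v =
      ![v 0 + a * v 1 + c * v 2, v 1 + b * v 2, v 2] := by
  rw [coe_unitriangular]
  ext i
  fin_cases i <;> simp [Matrix.mulVec, dotProduct, Fin.sum_univ_three]

variable (R) in
/-- The group of upper unitriangular `3 × 3` matrices. -/
def unitriangularSubgroup : Subgroup (GL (Fin 3) R) where
  carrier := Set.range fun p : R × R × R => unitriangular p.1 p.2.1 p.2.2
  mul_mem' := by
    rintro _ _ ⟨p, rfl⟩ ⟨q, rfl⟩
    exact ⟨(_, _, _), (unitriangular_mul ..).symm⟩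
  one_mem' := ⟨(0, 0, 0), unitriangular_zero⟩
  inv_mem' := by
    rintro _ ⟨p, rfl⟩
    exact ⟨(_, _, _), (unitriangular_inv ..).symm⟩

variable (R) in
theorem card_unitriangularSubgroup : Nat.card (unitriangularSubgroup R) = Nat.card R ^ 3 := by
  have inj : Function.Injective fun p : R × R × R => unitriangular p.1 p.2.1 p.2.2 := by
    rintro ⟨a, b, c⟩ ⟨a', b', c'⟩ h
    simpa [unitriangular_inj] using h
  refine (Nat.card_range_of_injective inj).trans ?_
  rw [Nat.card_prod, Nat.card_prod]
  ring

end Unitriangular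

/-- The Klein four-group of transvections with the common fixed plane spanned by the first two
basis vectors. -/
def fixedPlaneHom : Klein →* GL (Fin 3) (ZMod 2) where
  toFun p := unitriangular 0 p.1.toAdd p.2.toAdd
  map_one' := unitriangular_zero
  map_mul' p q := by simp [unitriangular_mul]

/-- The Klein four-group of transvections with the first basis vector as common direction. -/
def fixedLineHom : Klein →* GL (Fin 3) (ZMod 2) where
  toFun p := unitriangular p.1.toAdd 0 p.2.toAdd
  map_one' := unitriangular_zero
  map_mul' p q := by simp [unitriangular_mul]

theorem fixedPlaneHom_injective : Function.Injective fixedPlaneHom := fun _ _ h =>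
  have ⟨_, h₁, h₂⟩ := unitriangular_inj.1 h
  Prod.ext h₁ h₂

theorem fixedLineHom_injective : Function.Injective fixedLineHom := fun _ _ h =>
  have ⟨h₁, _, h₂⟩ := unitriangular_inj.1 h
  Prod.ext h₁ h₂

theorem card_klein : Nat.card Klein = 4 := by
  simp [Klein]

theorem Klein.mul_self (p : Klein) : p * p = 1 := by
  revert p
  decide

theorem card_GL_three_zmod_two : Nat.card (GL (Fin 3) (ZMod 2)) = 168 := by
  rw [Matrix.card_GL_field, Fin.prod_univ_three]
  simp

/-- The upper unitriangular matrices form a Sylow `2`-subgroup of `GL(3, 𝔽₂)`. -/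
noncomputable def unitriangularSylow : Sylow 2 (GL (Fin 3) (ZMod 2)) :=
  Sylow.ofCard (unitriangularSubgroup (ZMod 2)) <| by
    rw [card_unitriangularSubgroup, card_GL_three_zmod_two, Nat.card_zmod,
      show 168 = 2 ^ 3 * 21 by norm_num, Nat.factorization_mul (by norm_num) (by norm_num)]
    rw [Finsupp.add_apply, Nat.prime_two.factorization_pow, Finsupp.single_eq_same,
      Nat.factorization_eq_zero_of_not_dvd (show ¬ 2 ∣ 21 by norm_num)]

theorem eq_range_of_le_of_mulEquiv_klein {G : Type*} [Group G] [Finite G] {H : Subgroup G}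
    (e : H ≃* Klein) {f : Klein →* G} (hf : Function.Injective f) (h : H ≤ f.range) :
    H = f.range := by
  refine Subgroup.eq_of_le_of_card_ge h ?_
  rw [Nat.card_congr e.toEquiv, Nat.card_congr (MonoidHom.ofInjective hf).symm.toEquiv]

/-- The two Klein four-subgroups of the group of upper unitriangular matrices over `𝔽₂`. -/
theorem eq_range_of_le_unitriangularSubgroup {H : Subgroup (GL (Fin 3) (ZMod 2))}
    (e : H ≃* Klein) (hH : H ≤ unitriangularSubgroup (ZMod 2)) :
    H = fixedPlaneHom.range ∨ H = fixedLineHom.range := by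
  have mul_eq_zero {a b c : ZMod 2} (h : unitriangular a b c ∈ H) : a = 0 ∨ b = 0 := by
    have sq : (⟨_, h⟩ : H) * ⟨_, h⟩ = 1 := e.injective <| by
      rw [map_mul, Klein.mul_self, map_one]
    have sq' := congrArg Subtype.val sq
    rw [Subgroup.coe_mul, Subgroup.coe_one, unitriangular_mul, ← unitriangular_zero,
      unitriangular_inj] at sq'
    simpa [CharTwo.add_self_eq_zero] using sq'.2.2
  by_cases plane : ∀ a b c : ZMod 2, unitriangular a b c ∈ H → a = 0
  · refine .inl (eq_range_of_le_of_mulEquiv_klein e fixedPlaneHom_injective fun h hh => ?_)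
    obtain ⟨⟨a, b, c⟩, rfl⟩ := hH hh
    obtain rfl := plane a b c hh
    exact ⟨(.ofAdd b, .ofAdd c), rfl⟩
  · push Not at plane
    obtain ⟨a, b, c, habc, ha⟩ := plane
    obtain rfl := (mul_eq_zero habc).resolve_left ha
    refine .inr (eq_range_of_le_of_mulEquiv_klein e fixedLineHom_injective fun h hh => ?_)
    obtain ⟨⟨a', b', c'⟩, rfl⟩ := hH hh
    suffices b' = 0 by
      subst this
      exact ⟨(.ofAdd a', .ofAdd c'), rfl⟩
    by_contra hb'
    obtain rfl : a' = 0 := (mul_eq_zero hh).resolve_right hb'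
    have prod := H.mul_mem habc hh
    rw [unitriangular_mul, add_zero, zero_add] at prod
    exact (mul_eq_zero prod).elim ha hb'

theorem exists_map_conj_eq_range {H : Subgroup (GL (Fin 3) (ZMod 2))} (e : H ≃* Klein) :
    ∃ g, H.map (MulAut.conj g).toMonoidHom = fixedPlaneHom.range ∨
      H.map (MulAut.conj g).toMonoidHom = fixedLineHom.range := by
  have hp : IsPGroup 2 H := IsPGroup.of_card (n := 2) <| by
    rw [Nat.card_congr e.toEquiv, card_klein]
    norm_num
  obtain ⟨P, hP⟩ := hp.exists_le_sylow
  obtain ⟨g, hg⟩ := MulAction.exists_smul_eq (GL (Fin 3) (ZMod 2)) P unitriangularSylow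
  refine ⟨g, eq_range_of_le_unitriangularSubgroup
    ((H.equivMapOfInjective _ (MulAut.conj g).injective).symm.trans e) ?_⟩
  have hg' : P.1.map (MulAut.conj g).toMonoidHom = unitriangularSubgroup (ZMod 2) :=
    congrArg Sylow.toSubgroup hg
  exact hg' ▸ Subgroup.map_mono hP

/-- A subgroup of `GL(n, R)` fixes two distinct nonzero vectors. -/
def FixesTwoVectors {n R : Type*} [Fintype n] [DecidableEq n] [CommRing R]
    (H : Subgroup (GL n R)) : Prop :=
  ∃ v w : n → R, v ≠ 0 ∧ w ≠ 0 ∧ v ≠ w ∧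
    ∀ h ∈ H, h.val.mulVec v = v ∧ h.val.mulVec w = w

theorem FixesTwoVectors.map_conj {n R : Type*} [Fintype n] [DecidableEq n] [CommRing R]
    {H : Subgroup (GL n R)} (hH : FixesTwoVectors H) (g : GL n R) :
    FixesTwoVectors (H.map (MulAut.conj g).toMonoidHom) := by
  obtain ⟨v, w, hv, hw, hvw, fixed⟩ := hH
  have inj : Function.Injective g.val.mulVec := Matrix.mulVec_injective_of_isUnit g.isUnit
  have conj_mulVec (h : GL n R) (x : n → R) (hx : h.val.mulVec x = x) :
      (g * h * g⁻¹).val.mulVec (g.val.mulVec x) = g.val.mulVec x := by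
    rw [Matrix.mulVec_mulVec, ← Units.val_mul, inv_mul_cancel_right, Units.val_mul,
      ← Matrix.mulVec_mulVec, hx]
  refine ⟨g.val.mulVec v, g.val.mulVec w, ?_, ?_, inj.ne hvw, ?_⟩
  · simpa using inj.ne hv
  · simpa using inj.ne hw
  · rintro _ ⟨h, hh, rfl⟩
    exact ⟨conj_mulVec h v (fixed h hh).1, conj_mulVec h w (fixed h hh).2⟩

theorem fixesTwoVectors_map_conj_iff {n R : Type*} [Fintype n] [DecidableEq n] [CommRing R]
    {H : Subgroup (GL n R)} (g : GL n R) :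
    FixesTwoVectors (H.map (MulAut.conj g).toMonoidHom) ↔ FixesTwoVectors H := by
  refine ⟨fun h => ?_, fun h => h.map_conj g⟩
  convert h.map_conj g⁻¹
  rw [Subgroup.map_map]
  convert (Subgroup.map_id H).symm
  ext1 x
  simp [mul_assoc]

theorem fixesTwoVectors_range_fixedPlaneHom : FixesTwoVectors fixedPlaneHom.range := by
  refine ⟨![1, 0, 0], ![0, 1, 0], by decide, by decide, by decide, ?_⟩
  rintro _ ⟨p, rfl⟩
  constructor <;> refine (unitriangular_mulVec ..).trans ?_ <;> simp

theorem not_fixesTwoVectors_range_fixedLineHom : ¬ FixesTwoVectors fixedLineHom.range := by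
  have eq_of_fixed (v : Fin 3 → ZMod 2) (hv : v ≠ 0)
      (fixed : ∀ h ∈ fixedLineHom.range, h.val.mulVec v = v) : v = ![1, 0, 0] := by
    have h₁ := congrFun ((unitriangular_mulVec 1 0 0 v).symm.trans
      (fixed _ ⟨(.ofAdd 1, .ofAdd 0), rfl⟩)) 0
    have h₂ := congrFun ((unitriangular_mulVec 0 0 1 v).symm.trans
      (fixed _ ⟨(.ofAdd 0, .ofAdd 1), rfl⟩)) 0
    simp at h₁ h₂
    have hv₀ : v 0 ≠ 0 := fun h₀ => hv (by ext i; fin_cases i <;> simp [h₀, h₁, h₂])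
    have h₀ : v 0 = 1 := Fin.eq_one_of_ne_zero (v 0) hv₀
    ext i
    fin_cases i <;> simp [h₀, h₁, h₂]
  rintro ⟨v, w, hv, hw, hvw, fixed⟩
  exact hvw ((eq_of_fixed v hv fun h hh => (fixed h hh).1).trans
    (eq_of_fixed w hw fun h hh => (fixed h hh).2).symm)

/-- In `GL(3, 𝔽₂)`, there are exactly 2 conjugacy classes of subgroups isomorphic to
the Klein four-group. -/
theorem GL3F2_klein_conj_classes :
    Nat.card (Quot (kleinConj (GL (Fin 3) (ZMod 2)))) = 2 := by
  let A : {H : Subgroup (GL (Fin 3) (ZMod 2)) // Nonempty (H ≃* Klein)} :=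
    ⟨fixedPlaneHom.range, ⟨(MonoidHom.ofInjective fixedPlaneHom_injective).symm⟩⟩
  let B : {H : Subgroup (GL (Fin 3) (ZMod 2)) // Nonempty (H ≃* Klein)} :=
    ⟨fixedLineHom.range, ⟨(MonoidHom.ofInjective fixedLineHom_injective).symm⟩⟩
  rw [Nat.card_eq_two_iff]
  refine ⟨Quot.mk _ A, Quot.mk _ B, fun hAB => ?_, Set.eq_univ_of_forall ?_⟩
  · let P : Quot (kleinConj (GL (Fin 3) (ZMod 2))) → Prop :=
      Quot.lift (fun H => FixesTwoVectors H.1) <| by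
        rintro H K ⟨g, hg⟩
        exact propext (hg ▸ (fixesTwoVectors_map_conj_iff g).symm)
    exact not_fixesTwoVectors_range_fixedLineHom
      ((congrArg P hAB).mp fixesTwoVectors_range_fixedPlaneHom)
  · rintro ⟨H, ⟨e⟩⟩
    obtain ⟨g, hg | hg⟩ := exists_map_conj_eq_range e
    · exact .inl (Quot.sound ⟨g, hg⟩)
    · exact .inr (Quot.sound ⟨g, hg⟩)
end

section
/- Let PGL₃(ℂ) denote the quotient of the group GL(3, ℂ) of invertible 3×3 complex matrices by its center (the scalar matrices), and let D denote the image in PGL₃(ℂ) of the subgroup of GL(3, ℂ) consisting of the diagonal matrices all of whose diagonal entries lie in {1, −1}. Then D is isomorphic to the Klein four-group, and every subgroup of PGL₃(ℂ) isomorphic to the Klein four-group is conjugate in PGL₃(ℂ) to D. In other words, up to conjugacy there is a unique embedding of the Klein four-group into PGL₃(ℂ). -/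
/-- `PGL₃(ℂ)`: the quotient of `GL(3, ℂ)` by its center. -/
abbrev PGL3 : Type := GL (Fin 3) ℂ ⧸ Subgroup.center (GL (Fin 3) ℂ)

/-- The subgroup `D` of `PGL₃(ℂ)`: the image in `PGL₃(ℂ)` of the subgroup of
`GL(3, ℂ)` consisting of the diagonal matrices with all diagonal entries in `{1, −1}`.
(Since that set of matrices is already a subgroup, taking the subgroup generated by its
image is the same as taking its image.) -/
def D : Subgroup PGL3 :=
  Subgroup.closure
    ((QuotientGroup.mk' (Subgroup.center (GL (Fin 3) ℂ))) ''
      {A : GL (Fin 3) ℂ | ∃ f : Fin 3 → ℂ,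
        (∀ i, f i = 1 ∨ f i = -1) ∧ (A : Matrix (Fin 3) (Fin 3) ℂ) = Matrix.diagonal f})

open Matrix

/-- The subgroup generated by two commuting involutions is `{1, a, b, a * b}`. -/
theorem coe_closure_pair_of_commuting_involutions {G : Type*} [Group G] {a b : G}
    (ha : a * a = 1) (hb : b * b = 1) (hab : a * b = b * a) :
    (Subgroup.closure {a, b} : Set G) = {1, a, b, a * b} := by
  have hai : a⁻¹ = a := inv_eq_of_mul_eq_one_left ha
  have hbi : b⁻¹ = b := inv_eq_of_mul_eq_one_left hb
  have haa (x : G) : a * (a * x) = x := by rw [← mul_assoc, ha, one_mul]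
  have hba (x : G) : b * (a * x) = a * (b * x) := by rw [← mul_assoc, ← hab, mul_assoc]
  let S : Subgroup G :=
    { carrier := {1, a, b, a * b}
      one_mem' := by simp
      mul_mem' := by
        rintro x y (rfl | rfl | rfl | rfl) (rfl | rfl | rfl | rfl) <;>
          simp [mul_assoc, ha, hb, haa, hba, ← hab]
      inv_mem' := by
        rintro x (rfl | rfl | rfl | rfl) <;> simp [hai, hbi, ← hab] }
  refine Set.Subset.antisymm (?_ : Subgroup.closure {a, b} ≤ S) ?_
  · rw [Subgroup.closure_le]
    rintro x (rfl | rfl) <;> simp [S]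
  · have h1 : a ∈ Subgroup.closure {a, b} := Subgroup.subset_closure (by simp)
    have h2 : b ∈ Subgroup.closure {a, b} := Subgroup.subset_closure (by simp)
    rintro x (rfl | rfl | rfl | rfl)
    exacts [one_mem _, h1, h2, mul_mem h1 h2]

theorem isKleinFour_klein : IsKleinFour Klein where
  card_four := by simp
  exponent_two := by simp [Monoid.exponent_prod]

/-- Two distinct commuting involutions generate a Klein four-group. -/
theorem nonempty_closure_pair_mulEquiv_klein {G : Type*} [Group G] {a b : G}
    (ha : a * a = 1) (hb : b * b = 1) (hab : a * b = b * a)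
    (ha1 : a ≠ 1) (hb1 : b ≠ 1) (hne : a ≠ b) :
    Nonempty (Subgroup.closure {a, b} ≃* Klein) := by
  have hS := coe_closure_pair_of_commuting_involutions ha hb hab
  have habne : a * b ≠ 1 := fun h => hne <| mul_right_cancel (h.trans hb.symm)
  have hcard : Nat.card (Subgroup.closure {a, b}) = 4 := by
    rw [← SetLike.coe_sort_coe, hS, Nat.card_coe_set_eq]
    rw [Set.ncard_insert_of_notMem, Set.ncard_insert_of_notMem, Set.ncard_pair]
    · simpa using ha1
    · simp [hne, hb1]
    · simp [ha1.symm, hb1.symm, habne.symm]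
  have : IsKleinFour (Subgroup.closure {a, b}) :=
    { card_four := hcard
      exponent_two := by
        have : Nontrivial (Subgroup.closure {a, b}) :=
          have := Nat.finite_of_card_ne_zero (hcard.trans_ne four_ne_zero)
          Finite.one_lt_card_iff_nontrivial.1 (by omega)
        refine (Nat.prime_two.eq_one_or_self_of_dvd _ ?_).resolve_left ?_
        · refine Monoid.exponent_dvd_of_forall_pow_eq_one fun ⟨x, hx⟩ => ?_
          rw [← SetLike.mem_coe, hS] at hx
          ext
          have habab : a * b * (a * b) = 1 := by
            rw [(show Commute b a from hab.symm).mul_mul_mul_comm, ha, hb, one_mul]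
          rcases hx with rfl | rfl | rfl | rfl <;> simp [pow_two, ha, hb, habab]
        · rw [Monoid.exp_eq_one_iff]
          exact not_subsingleton _ }
  have := isKleinFour_klein
  exact IsKleinFour.nonempty_mulEquiv

/-- A group isomorphic to the Klein four-group is generated by two commuting involutions. -/
theorem exists_generators_of_mulEquiv_klein {G : Type*} [Group G] (H : Subgroup G)
    (e : H ≃* Klein) :
    ∃ a b : G, a * a = 1 ∧ b * b = 1 ∧ a * b = b * a ∧ a ≠ 1 ∧ b ≠ 1 ∧ a ≠ b ∧
      H = Subgroup.closure {a, b} := by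
  let f : Klein →* G := H.subtype.comp e.symm.toMonoidHom
  have hf : Function.Injective f := H.subtype_injective.comp e.symm.injective
  have hrange : f.range = H := by
    ext x
    constructor
    · rintro ⟨k, rfl⟩
      exact (e.symm k).2
    · intro hx
      exact ⟨e ⟨x, hx⟩, by simp [f]⟩
  let s : Klein := (Multiplicative.ofAdd 1, 1)
  let t : Klein := (1, Multiplicative.ofAdd 1)
  have hst : Subgroup.closure {s, t} = ⊤ := by
    rw [← SetLike.coe_set_eq, coe_closure_pair_of_commuting_involutions (by decide) (by decide)
      (by decide), Subgroup.coe_top, Set.eq_univ_iff_forall]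
    simp only [Set.mem_insert_iff, Set.mem_singleton_iff]
    decide
  refine ⟨f s, f t, ?_, ?_, ?_, ?_, ?_, ?_, ?_⟩
  · rw [← map_mul, show s * s = 1 by decide, map_one]
  · rw [← map_mul, show t * t = 1 by decide, map_one]
  · rw [← map_mul, ← map_mul]; rfl
  · rw [← map_one f]; exact hf.ne (by decide)
  · rw [← map_one f]; exact hf.ne (by decide)
  · exact hf.ne (by decide)
  · rw [← Set.image_pair, ← MonoidHom.map_closure, hst, ← MonoidHom.range_eq_map, hrange]

/-- Every element of `PGL₃(ℂ)` squaring to `1` lifts to a matrix of determinant one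
squaring to `1`. -/
theorem exists_lift_involution (a : PGL3) (ha : a * a = 1) :
    ∃ A : GL (Fin 3) ℂ, (A : PGL3) = a ∧ A * A = 1 ∧ A.val.det = 1 := by
  obtain ⟨A, rfl⟩ := QuotientGroup.mk_surjective a
  rw [← QuotientGroup.mk_mul, QuotientGroup.eq_one_iff,
    GeneralLinearGroup.center_eq_range_scalar] at ha
  obtain ⟨c, hc⟩ := ha
  have hc' : A.val * A.val = (c : ℂ) • (1 : Matrix (Fin 3) (Fin 3) ℂ) := by
    have := congrArg Units.val hc
    simpa [smul_one_eq_diagonal] using this.symm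
  let d : ℂˣ := GeneralLinearGroup.det A
  have hd : (d : ℂ) = A.val.det := rfl
  have hdc : (d : ℂ) ^ 2 = (c : ℂ) ^ 3 := by
    have := congrArg Matrix.det hc'
    rw [det_mul, det_smul, det_one, ← hd] at this
    simpa [pow_two] using this
  have hd0 : (d : ℂ) ≠ 0 := d.ne_zero
  let s : ℂˣ := c / d
  have hs : (s : ℂ) = c / d := by simp [s]
  have hval : (GeneralLinearGroup.scalar (Fin 3) s * A).val = (s : ℂ) • A.val := by
    simp [smul_eq_diagonal_mul]
  refine ⟨GeneralLinearGroup.scalar (Fin 3) s * A, ?_, ?_, ?_⟩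
  · rw [QuotientGroup.mk_mul, (QuotientGroup.eq_one_iff _).2, one_mul]
    rw [GeneralLinearGroup.center_eq_range_scalar]
    exact ⟨s, rfl⟩
  · ext1
    rw [Units.val_mul, hval, smul_mul_smul_comm, hc', smul_smul, hs, Units.val_one]
    convert one_smul ℂ (1 : Matrix (Fin 3) (Fin 3) ℂ) using 2
    field_simp
    linear_combination -hdc
  · rw [hval, det_smul, hs, ← hd, Fintype.card_fin]
    field_simp
    linear_combination -hdc

theorem mk_eq_one_iff_of_involution {A : GL (Fin 3) ℂ} (hA : A * A = 1) (hd : A.val.det = 1) :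
    (A : PGL3) = 1 ↔ A = 1 := by
  refine ⟨fun h => ?_, fun h => by rw [h]; rfl⟩
  rw [QuotientGroup.eq_one_iff, GeneralLinearGroup.center_eq_range_scalar] at h
  obtain ⟨c, rfl⟩ := h
  have h2 : (c : ℂ) * c = 1 := by
    have := congrArg (fun M : GL (Fin 3) ℂ => M.val 0 0) hA
    simpa using this
  have h3 : (c : ℂ) ^ 3 = 1 := by simpa using hd
  have : c = 1 := by
    ext
    simp only [Units.val_one]
    linear_combination h3 - (c : ℂ) * h2
  rw [this, map_one]

/-- Commuting classes of determinant-one involutions lift to commuting matrices. -/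
theorem mul_comm_of_mk_mul_comm {A B : GL (Fin 3) ℂ} (hA : A * A = 1) (hB : B * B = 1)
    (hdA : A.val.det = 1) (hdB : B.val.det = 1)
    (h : (A : PGL3) * (B : PGL3) = (B : PGL3) * (A : PGL3)) : A * B = B * A := by
  obtain ⟨z, hz⟩ : ∃ z, A * B = B * A * z := ⟨_, (mul_inv_cancel_left _ _).symm⟩
  have hzmk : (z : PGL3) = 1 := by
    have := congrArg (QuotientGroup.mk (s := Subgroup.center (GL (Fin 3) ℂ))) hz
    simpa only [QuotientGroup.mk_mul, h, left_eq_mul] using this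
  have hcomm : B * z = z * B :=
    Subgroup.mem_center_iff.1 ((QuotientGroup.eq_one_iff z).1 hzmk) B
  have hAz : A * z = B * (A * B) := by
    rw [hz, ← mul_assoc, ← mul_assoc, hB, one_mul]
  have hzBA : z = A * (B * (A * B)) := by rw [← hAz, ← mul_assoc, hA, one_mul]
  have hzz : z * z = 1 := by
    calc z * z = A * (B * (A * B)) * z := by rw [← hzBA]
      _ = A * B * (A * z) * B := by simp only [mul_assoc, hcomm]
      _ = A * (B * B) * (A * (B * B)) := by rw [hAz]; simp only [mul_assoc]
      _ = 1 := by rw [hB, mul_one, hA]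
  have hdz : z.val.det = 1 := by
    rw [hzBA]
    simp [hdA, hdB]
  rw [hz, (mk_eq_one_iff_of_involution hzz hdz).1 hzmk, mul_one]

/-- A nontrivial involution of determinant one in dimension three has trace `-1`. -/
theorem trace_eq_neg_one_of_involution {A : Matrix (Fin 3) (Fin 3) ℂ} (hA : A * A = 1)
    (hd : A.det = 1) (h1 : A ≠ 1) : A.trace = -1 := by
  have hadj : A.adjugate = A := by
    have := adjugate_mul A
    rw [hd, one_smul] at this
    calc A.adjugate = A.adjugate * (A * A) := by rw [hA, mul_one]
      _ = A := by rw [← mul_assoc, this, one_mul]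
  by_contra ht
  apply h1
  have ht' : A.trace + 1 ≠ 0 := fun h => ht (by linear_combination h)
  have key : (A.trace + 1) • A = (A.trace + 1) • (1 : Matrix (Fin 3) (Fin 3) ℂ) := by
    rw [adjugate_fin_three] at hadj
    ext i j
    have e := fun i j => congrFun (congrFun hadj i) j
    have q := congrFun (congrFun hA i) j
    have e00 := e 0 0
    have e11 := e 1 1
    have e22 := e 2 2
    have eij := e i j
    fin_cases i <;> fin_cases j <;>
      simp [trace_fin_three, mul_apply, Fin.sum_univ_three] at * <;> grind
  simpa [smul_right_inj ht'] using key

/-- Commuting involutions of determinant one with nontrivial product satisfy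
`1 + A + B + A * B = 0`. -/
theorem one_add_involutions_eq_zero {A B : Matrix (Fin 3) (Fin 3) ℂ} (hA : A * A = 1)
    (hB : B * B = 1) (hAB : A * B = B * A) (hdA : A.det = 1) (hdB : B.det = 1)
    (hA1 : A ≠ 1) (hB1 : B ≠ 1) (hAB1 : A * B ≠ 1) : 1 + A + B + A * B = 0 := by
  have hC : A * B * (A * B) = 1 := by
    rw [(show Commute B A from hAB.symm).mul_mul_mul_comm, hA, hB, one_mul]
  let E : Matrix (Fin 3) (Fin 3) ℂ := (4⁻¹ : ℂ) • (1 + A + B + A * B)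
  have hmul : (1 + A + B + A * B) * (1 + A + B + A * B) = (4 : ℂ) • (1 + A + B + A * B) := by
    have : (1 + A + B + A * B) = (1 + A) * (1 + B) := by noncomm_ring
    have hc : Commute (1 + A) (1 + B) :=
      ((Commute.one_left _).add_left ((Commute.one_right A).add_right hAB))
    have sqA : (1 + A) * (1 + A) = (2 : ℂ) • (1 + A) := by
      rw [two_smul, add_mul, mul_add, mul_add, hA]; simp; abel
    have sqB : (1 + B) * (1 + B) = (2 : ℂ) • (1 + B) := by
      rw [two_smul, add_mul, mul_add, mul_add, hB]; simp; abel
    rw [this, hc.symm.mul_mul_mul_comm, sqA, sqB, smul_mul_smul_comm]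
    norm_num
  have hE : IsIdempotentElem E := by
    simp only [IsIdempotentElem, E, smul_mul_smul_comm, hmul, smul_smul]
    norm_num
  have htr : E.trace = 0 := by
    simp only [E, trace_smul, trace_add, trace_eq_neg_one_of_involution hA hdA hA1,
      trace_eq_neg_one_of_involution hB hdB hB1,
      trace_eq_neg_one_of_involution hC (by rw [det_mul, hdA, hdB, one_mul]) hAB1]
    norm_num
  have hlin : IsIdempotentElem (toLin' E) := by
    rw [IsIdempotentElem, Module.End.mul_eq_comp, ← toLin'_mul, hE.eq]
  have h0 : toLin' E = 0 :=
    LinearMap.IsIdempotentElem.eq_zero_of_trace_eq_zero hlin (by rw [trace_toLin'_eq, htr])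
  have : E = 0 := by simpa using h0
  exact (smul_eq_zero.1 this).resolve_left (by norm_num)

theorem exists_eigenvector_one {A : Matrix (Fin 3) (Fin 3) ℂ} (hA : A * A = 1)
    (hd : A.det = 1) : ∃ v : Fin 3 → ℂ, v ≠ 0 ∧ A *ᵥ v = v := by
  have hne : 1 + A ≠ 0 := by
    intro h
    rw [eq_neg_of_add_eq_zero_right h, det_neg] at hd
    norm_num at hd
  obtain ⟨w, hw⟩ : ∃ w, (1 + A) *ᵥ w ≠ 0 := by
    by_contra! h
    exact hne (ext_of_mulVec_single fun i => by rw [h, zero_mulVec])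
  refine ⟨(1 + A) *ᵥ w, hw, ?_⟩
  rw [mulVec_mulVec, mul_add, hA, mul_one, add_comm]

/-- The diagonal matrices `diag(1, -1, -1)` and `diag(-1, 1, -1)` are simultaneous normal forms
of two commuting determinant-one involutions generating a Klein four-group. -/
theorem exists_simultaneous_diagonalization {A B : Matrix (Fin 3) (Fin 3) ℂ} (hA : A * A = 1)
    (hB : B * B = 1) (hAB : A * B = B * A) (hdA : A.det = 1) (hdB : B.det = 1)
    (hA1 : A ≠ 1) (hB1 : B ≠ 1) (hAB1 : A * B ≠ 1) :
    ∃ P : GL (Fin 3) ℂ, A * P.val = P.val * diagonal ![1, -1, -1] ∧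
      B * P.val = P.val * diagonal ![-1, 1, -1] := by
  have hsum := one_add_involutions_eq_zero hA hB hAB hdA hdB hA1 hB1 hAB1
  have hC : A * B * (A * B) = 1 := by
    rw [(show Commute B A from hAB.symm).mul_mul_mul_comm, hA, hB, one_mul]
  obtain ⟨u, hu0, hAu⟩ := exists_eigenvector_one hA hdA
  obtain ⟨v, hv0, hBv⟩ := exists_eigenvector_one hB hdB
  obtain ⟨w, hw0, hCw⟩ := exists_eigenvector_one hC (by rw [det_mul, hdA, hdB, one_mul])
  have hz (x : Fin 3 → ℂ) : x + A *ᵥ x + B *ᵥ x + A *ᵥ B *ᵥ x = 0 := by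
    have := congrArg (· *ᵥ x) hsum
    simpa [add_mulVec] using this
  have hcomm (x : Fin 3 → ℂ) : A *ᵥ B *ᵥ x = B *ᵥ A *ᵥ x := by
    rw [mulVec_mulVec, hAB, mulVec_mulVec]
  have hAA (x : Fin 3 → ℂ) : A *ᵥ A *ᵥ x = x := by rw [mulVec_mulVec, hA, one_mulVec]
  rw [← mulVec_mulVec] at hCw
  have hBu : B *ᵥ u = -u := by
    have := hz u
    rw [hcomm, hAu] at this
    ext i
    have := congrFun this i
    simp at this ⊢
    linear_combination this / 2
  have hAv : A *ᵥ v = -v := by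
    have := hz v
    rw [hBv] at this
    ext i
    have := congrFun this i
    simp at this ⊢
    linear_combination this / 2
  have hABw : A *ᵥ w = B *ᵥ w := by
    conv_lhs => rw [← hCw]
    exact hAA _
  have hAw : A *ᵥ w = -w := by
    have := hz w
    rw [hCw, ← hABw] at this
    ext i
    have := congrFun this i
    simp at this ⊢
    linear_combination this / 2
  have hBw : B *ᵥ w = -w := hABw ▸ hAw
  have hli : LinearIndependent ℂ ![u, v, w] := by
    rw [Fintype.linearIndependent_iff]
    intro g hg
    simp only [Fin.sum_univ_three, cons_val_zero, cons_val_one, cons_val] at hg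
    have hgA := congrArg (A *ᵥ ·) hg
    have hgB := congrArg (B *ᵥ ·) hg
    simp only [mulVec_add, mulVec_smul, hAu, hAv, hAw, hBu, hBv, hBw, mulVec_zero] at hgA hgB
    have h0 : g 0 • u = 0 := by
      ext i
      have e₁ := congrFun hg i
      have e₂ := congrFun hgA i
      simp only [Pi.add_apply, Pi.smul_apply, Pi.neg_apply, Pi.zero_apply, smul_eq_mul] at e₁ e₂ ⊢
      linear_combination (e₁ + e₂) / 2
    have h1 : g 1 • v = 0 := by
      ext i
      have e₁ := congrFun hg i
      have e₂ := congrFun hgB i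
      simp only [Pi.add_apply, Pi.smul_apply, Pi.neg_apply, Pi.zero_apply, smul_eq_mul] at e₁ e₂ ⊢
      linear_combination (e₁ + e₂) / 2
    have h2 : g 2 • w = 0 := by simpa [h0, h1] using hg
    intro i
    fin_cases i
    exacts [(smul_eq_zero.1 h0).resolve_right hu0, (smul_eq_zero.1 h1).resolve_right hv0,
      (smul_eq_zero.1 h2).resolve_right hw0]
  obtain ⟨P, hP⟩ := linearIndependent_cols_iff_isUnit.1
    (show LinearIndependent ℂ (Matrix.of ![u, v, w])ᵀ.col from hli)
  have hcol (M : Matrix (Fin 3) (Fin 3) ℂ) (d : Fin 3 → ℂ)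
      (h : ∀ j, M *ᵥ ![u, v, w] j = d j • ![u, v, w] j) : M * P.val = P.val * diagonal d := by
    ext i j
    rw [mul_diagonal, hP]
    have := congrFun (h j) i
    simpa [mul_apply, mulVec, dotProduct, mul_comm] using this
  refine ⟨P, hcol _ _ fun j => ?_, hcol _ _ fun j => ?_⟩ <;> fin_cases j <;>
    simp [hAu, hAv, hAw, hBu, hBv, hBw]

/-- The invertible diagonal matrix with prescribed units on the diagonal. -/
def diagGL : (Fin 3 → ℂˣ) →* GL (Fin 3) ℂ :=
  (Units.map (diagonalRingHom (Fin 3) ℂ).toMonoidHom).comp MulEquiv.piUnits.symm.toMonoidHom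

theorem val_diagGL (f : Fin 3 → ℂˣ) : (diagGL f).val = diagonal fun i => (f i : ℂ) := rfl

theorem diagGL_injective : Function.Injective diagGL := by
  intro f g h
  have := diagonal_injective (congrArg Units.val h)
  ext i
  exact congrFun this i

theorem mk_diagGL_neg (f : Fin 3 → ℂˣ) : (diagGL (-f) : PGL3) = diagGL f := by
  rw [QuotientGroup.eq, ← map_inv, ← map_mul, GeneralLinearGroup.center_eq_range_scalar]
  refine ⟨-1, ?_⟩
  ext1
  rw [val_diagGL]
  simp [← diagonal_neg]

theorem D_eq_closure : D = Subgroup.closure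
    {(diagGL ![1, -1, -1] : PGL3), (diagGL ![-1, 1, -1] : PGL3)} := by
  apply le_antisymm
  · rw [D, Subgroup.closure_le]
    rintro _ ⟨A, ⟨f, hf, hAf⟩, rfl⟩
    let C : Subgroup PGL3 := Subgroup.closure
      {(diagGL ![1, -1, -1] : PGL3), (diagGL ![-1, 1, -1] : PGL3)}
    have hx : (diagGL ![1, -1, -1] : PGL3) ∈ C := Subgroup.subset_closure (by simp)
    have hy : (diagGL ![-1, 1, -1] : PGL3) ∈ C := Subgroup.subset_closure (by simp)
    have hone : (diagGL ![1, 1, 1] : PGL3) ∈ C := by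
      convert one_mem C
      rw [← QuotientGroup.mk_one, ← map_one diagGL]
      congr 2
      ext i
      fin_cases i <;> simp
    have hxy : (diagGL ![-1, -1, 1] : PGL3) ∈ C := by
      convert mul_mem hx hy
      rw [← QuotientGroup.mk_mul, ← map_mul]
      congr 2
      ext i
      fin_cases i <;> simp
    have hneg {p q r : ℂˣ} (h : (diagGL ![p, q, r] : PGL3) ∈ C) :
        (diagGL ![-p, -q, -r] : PGL3) ∈ C := by
      rw [← mk_diagGL_neg] at h
      simpa using h
    have hunit (i : Fin 3) : ∃ u : ℂˣ, (u = 1 ∨ u = -1) ∧ (u : ℂ) = f i := by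
      rcases hf i with h | h
      exacts [⟨1, .inl rfl, by simp [h]⟩, ⟨-1, .inr rfl, by simp [h]⟩]
    choose g hg hgf using hunit
    have hA : A = diagGL ![g 0, g 1, g 2] := by
      ext1
      rw [hAf, val_diagGL]
      congr 1
      ext i
      fin_cases i <;> simp [hgf]
    change (A : PGL3) ∈ C
    rw [hA]
    rcases hg 0 with h₀ | h₀ <;> rcases hg 1 with h₁ | h₁ <;> rcases hg 2 with h₂ | h₂ <;>
      rw [h₀, h₁, h₂]
    exacts [hone, by simpa using hneg hxy, by simpa using hneg hy, hx,
      by simpa using hneg hx, hy, hxy, by simpa using hneg hone]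
  · rw [Subgroup.closure_le]
    rintro _ (rfl | rfl) <;> refine Subgroup.subset_closure ⟨_, ⟨_, ?_, val_diagGL _⟩, rfl⟩ <;>
      intro i <;> fin_cases i <;> simp

theorem nonempty_D_mulEquiv_klein : Nonempty (D ≃* Klein) := by
  let x : GL (Fin 3) ℂ := diagGL ![1, -1, -1]
  let y : GL (Fin 3) ℂ := diagGL ![-1, 1, -1]
  have hx : x * x = 1 := by
    simp only [x, ← map_mul]
    rw [← map_one diagGL]
    congr 1
    ext i
    fin_cases i <;> simp
  have hy : y * y = 1 := by
    simp only [y, ← map_mul]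
    rw [← map_one diagGL]
    congr 1
    ext i
    fin_cases i <;> simp
  have hxy : x * y = y * x := by simp only [x, y, ← map_mul, mul_comm]
  have hdx : x.val.det = 1 := by simp [x, val_diagGL, Fin.prod_univ_three]
  have hdy : y.val.det = 1 := by simp [y, val_diagGL, Fin.prod_univ_three]
  have hxy2 : x * y * (x * y) = 1 := by
    rw [(show Commute y x from hxy.symm).mul_mul_mul_comm, hx, hy, one_mul]
  have hne : (-1 : ℂˣ) ≠ 1 := by
    intro h
    have := congrArg Units.val h
    norm_num at this
  have hy' : (y : PGL3) * y = 1 := by rw [← QuotientGroup.mk_mul, hy]; rfl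
  rw [D_eq_closure]
  refine nonempty_closure_pair_mulEquiv_klein (a := (x : PGL3)) (b := (y : PGL3))
    (by rw [← QuotientGroup.mk_mul, hx]; rfl) hy'
    (by rw [← QuotientGroup.mk_mul, hxy]; rfl) ?_ ?_ ?_
  · rw [Ne, mk_eq_one_iff_of_involution hx hdx, ← map_one diagGL]
    exact fun h => hne (congrFun (diagGL_injective h) 1)
  · rw [Ne, mk_eq_one_iff_of_involution hy hdy, ← map_one diagGL]
    exact fun h => hne (congrFun (diagGL_injective h) 0)
  · intro h
    have h1 : ((x * y : GL (Fin 3) ℂ) : PGL3) = 1 := by rw [QuotientGroup.mk_mul, h, hy']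
    rw [mk_eq_one_iff_of_involution hxy2 (by simp [hdx, hdy]), ← map_mul, ← map_one diagGL] at h1
    exact hne (by simpa using congrFun (diagGL_injective h1) 0)

/-- `D` is isomorphic to the Klein four-group, and every subgroup of `PGL₃(ℂ)`
isomorphic to the Klein four-group is conjugate in `PGL₃(ℂ)` to `D`: up to conjugacy
there is a unique embedding of the Klein four-group into `PGL₃(ℂ)`. -/
theorem klein_in_PGL3_unique_up_to_conjugacy :
    Nonempty (D ≃* Klein) ∧
      ∀ H : Subgroup PGL3, Nonempty (H ≃* Klein) →
        ∃ g : PGL3, Subgroup.map (MulAut.conj g).toMonoidHom H = D := by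
  refine ⟨nonempty_D_mulEquiv_klein, fun H ⟨e⟩ => ?_⟩
  obtain ⟨a, b, ha, hb, hab, ha1, hb1, hne, rfl⟩ := exists_generators_of_mulEquiv_klein H e
  obtain ⟨A, rfl, hA, hdA⟩ := exists_lift_involution a ha
  obtain ⟨B, rfl, hB, hdB⟩ := exists_lift_involution b hb
  have hAB := mul_comm_of_mk_mul_comm hA hB hdA hdB hab
  have hval {X Y : GL (Fin 3) ℂ} (h : X = Y) : X.val = Y.val := congrArg Units.val h
  have hA1 : A ≠ 1 := fun h => ha1 (by rw [h]; rfl)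
  have hB1 : B ≠ 1 := fun h => hb1 (by rw [h]; rfl)
  have hAB1 : A * B ≠ 1 := fun h => hne (by rw [mul_right_cancel (h.trans hB.symm)])
  obtain ⟨P, hPA, hPB⟩ := exists_simultaneous_diagonalization (hval hA) (hval hB) (hval hAB)
    hdA hdB (fun h => hA1 (Units.ext h)) (fun h => hB1 (Units.ext h))
    (fun h => hAB1 (Units.ext h))
  have hconj {M N : GL (Fin 3) ℂ} (h : M.val * P.val = P.val * N.val) :
      (MulAut.conj ((P⁻¹ : GL (Fin 3) ℂ) : PGL3)).toMonoidHom (M : PGL3) = (N : PGL3) := by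
    have hMP : M * P = P * N := Units.ext h
    have hN : N = P⁻¹ * M * P⁻¹⁻¹ := by rw [inv_inv, mul_assoc, hMP, inv_mul_cancel_left]
    rw [hN]
    rfl
  have hdiag (p q r : ℂˣ) : (diagGL ![p, q, r]).val = diagonal ![(p : ℂ), q, r] := by
    rw [val_diagGL]
    congr 1
    ext i
    fin_cases i <;> rfl
  refine ⟨((P⁻¹ : GL (Fin 3) ℂ) : PGL3), ?_⟩
  rw [MonoidHom.map_closure, Set.image_pair, D_eq_closure,
    hconj (N := diagGL ![1, -1, -1]) (by rw [hPA, hdiag]; simp),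
    hconj (N := diagGL ![-1, 1, -1]) (by rw [hPB, hdiag]; simp)]
end

section
/- Let Q₈ be the quaternion group of order 8 and let z be its central element of order 2. Let N be the subgroup of Q₈ × ℤ/4ℤ generated by the element (z, 2); N is central, hence normal, and the quotient group G₁₆ = (Q₈ × ℤ/4ℤ)/N (the central product of Q₈ with the cyclic group of order 4) has order 16. The number of conjugacy classes of subgroups of G₁₆ isomorphic to the Klein four-group is exactly 3. -/
/-- The Pauli group `⟨i, X, Z⟩`: the triple `(k, x, z)` stands for the matrix `iᵏ Xˣ Zᶻ`. -/
@[ext]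
structure Pauli where
  phase : ZMod 4
  x : ZMod 2
  z : ZMod 2
  deriving DecidableEq, Fintype

namespace Pauli

/-- The cocycle of the Pauli group: the phase produced by moving `Zᶻ` past `Xˣ`. -/
def twist (z x : ZMod 2) : ZMod 4 := if z = 1 ∧ x = 1 then 2 else 0

lemma twist_add_left (z w x : ZMod 2) : twist (z + w) x = twist z x + twist w x := by
  revert z w x; decide

lemma twist_add_right (z x y : ZMod 2) : twist z (x + y) = twist z x + twist z y := by
  revert z x y; decide

instance : Mul Pauli :=
  ⟨fun p q => ⟨p.phase + q.phase + twist p.z q.x, p.x + q.x, p.z + q.z⟩⟩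

instance : One Pauli := ⟨⟨0, 0, 0⟩⟩

instance : Inv Pauli := ⟨fun p => ⟨-p.phase + twist p.z p.x, p.x, p.z⟩⟩

lemma mul_def (p q : Pauli) :
    p * q = ⟨p.phase + q.phase + twist p.z q.x, p.x + q.x, p.z + q.z⟩ := rfl

instance : Group Pauli :=
  Group.ofLeftAxioms
    (fun p q r => by
      ext <;> simp only [mul_def, twist_add_left, twist_add_right] <;> ring)
    (by decide)
    (by decide)

/-- The embedding of `Q₈` into the Pauli group, sending the generators to `iZ` and `iX`. -/
def ofQuaternion : QuaternionGroup 2 →* Pauli where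
  toFun
    | .a k => ⟨k, 0, ZMod.castHom (by decide : 2 ∣ 4) (ZMod 2) k⟩
    | .xa k => ⟨k + 1, 1, ZMod.castHom (by decide : 2 ∣ 4) (ZMod 2) k⟩
  map_one' := by decide
  map_mul' := by decide

/-- The embedding of the cyclic group of order four as the scalar matrices. -/
def ofPhase : Multiplicative (ZMod 4) →* Pauli where
  toFun k := ⟨k.toAdd, 0, 0⟩
  map_one' := by decide
  map_mul' := by decide

/-- The product of the two embeddings. -/
def ofProd : QuaternionGroup 2 × Multiplicative (ZMod 4) →* Pauli :=
  ofQuaternion.noncommCoprod ofPhase (by unfold Commute SemiconjBy; decide)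

lemma ofProd_surjective : Function.Surjective ofProd := by
  unfold Function.Surjective; decide

lemma ofProd_eq_one_iff (p : QuaternionGroup 2 × Multiplicative (ZMod 4)) :
    ofProd p = 1 ↔ p = 1 ∨ p = (.a 2, Multiplicative.ofAdd 2) := by
  revert p; decide

lemma ker_ofProd :
    ofProd.ker = Subgroup.normalClosure
      {((.a 2 : QuaternionGroup 2), Multiplicative.ofAdd (2 : ZMod 4))} := by
  apply le_antisymm
  · intro p hp
    rcases (ofProd_eq_one_iff p).1 hp with rfl | rfl
    · exact one_mem _
    · exact Subgroup.subset_normalClosure rfl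
  · exact Subgroup.normalClosure_le_normal
      (Set.singleton_subset_iff.2 ((ofProd_eq_one_iff _).2 (Or.inr rfl)))

/-- The Pauli group is the central product of `Q₈` and the cyclic group of order four. -/
noncomputable def centralProductEquiv :
    (QuaternionGroup 2 × Multiplicative (ZMod 4)) ⧸ Subgroup.normalClosure
      {((.a 2 : QuaternionGroup 2), Multiplicative.ofAdd (2 : ZMod 4))} ≃* Pauli :=
  (QuotientGroup.quotientMulEquivOfEq ker_ofProd.symm).trans
    (QuotientGroup.quotientKerEquivOfSurjective ofProd ofProd_surjective)

/-- The Hermitian representatives of the three noncentral classes `X`, `Z` and `iXZ`. -/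
def involution : Fin 3 → Pauli := ![⟨0, 1, 0⟩, ⟨0, 0, 1⟩, ⟨1, 1, 1⟩]

/-- The elements of the subgroup generated by `-1` and an involution. -/
def kleinFinset (i : Fin 3) : Finset Pauli :=
  {1, ⟨2, 0, 0⟩, involution i, ⟨2, 0, 0⟩ * involution i}

/-- The subgroup generated by `-1` and an involution. -/
def kleinSubgroup (i : Fin 3) : Subgroup Pauli where
  carrier := kleinFinset i
  one_mem' := by revert i; decide
  mul_mem' {p q} := by
    simp only [Finset.mem_coe]
    revert p q i; decide
  inv_mem' {p} := by
    simp only [Finset.mem_coe]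
    revert p i; decide

lemma mem_kleinSubgroup {i : Fin 3} {p : Pauli} : p ∈ kleinSubgroup i ↔ p ∈ kleinFinset i :=
  Iff.rfl

lemma kleinSubgroup_injective : Function.Injective kleinSubgroup := by
  intro i j h
  have hij : involution i ∈ kleinFinset j := by
    rw [← mem_kleinSubgroup, ← h, mem_kleinSubgroup]
    simp [kleinFinset]
  clear h
  revert i j; decide

instance kleinSubgroup_normal (i : Fin 3) : (kleinSubgroup i).Normal where
  conj_mem p hp g := by
    rw [mem_kleinSubgroup] at hp ⊢
    revert i p g; decide

lemma card_kleinSubgroup (i : Fin 3) : Nat.card (kleinSubgroup i) = 4 := by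
  change Nat.card (kleinFinset i : Set Pauli) = 4
  rw [Nat.card_coe_set_eq, Set.ncard_coe_finset]
  revert i; decide

lemma mul_self_of_mem_kleinSubgroup {i : Fin 3} {p : Pauli} (hp : p ∈ kleinSubgroup i) :
    p * p = 1 := by
  rw [mem_kleinSubgroup] at hp
  revert i p; decide

lemma eq_kleinFinset (p q : Pauli) (hp : p ≠ 1) (hq : q ≠ 1) (hpq : p ≠ q)
    (hp2 : p * p = 1) (hq2 : q * q = 1) (hcomm : p * q = q * p) :
    ∃ i, kleinFinset i ⊆ {1, p, q, p * q} := by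
  revert p q; decide

end Pauli

instance isKleinFour_klein_s13 : IsKleinFour Klein where
  card_four := by simp [Klein]
  exponent_two := by
    simp [Klein, Monoid.exponent_prod, Monoid.exponent_multiplicative, ZMod.exponent]

lemma nonempty_mulEquiv_klein_iff {G : Type*} [Group G] :
    Nonempty (G ≃* Klein) ↔ Nat.card G = 4 ∧ ∀ g : G, g * g = 1 := by
  constructor
  · rintro ⟨e⟩
    refine ⟨(Nat.card_congr e.toEquiv).trans IsKleinFour.card_four, fun g => e.injective ?_⟩
    rw [map_mul, map_one, IsKleinFour.mul_self]
  · rintro ⟨hcard, hsq⟩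
    have : Nontrivial G :=
      have := Nat.finite_of_card_ne_zero (hcard ▸ four_ne_zero)
      Finite.one_lt_card_iff_nontrivial.1 (by omega)
    have : IsKleinFour G :=
      ⟨hcard, (Monoid.exponent_eq_prime_iff Nat.prime_two).2 fun g hg =>
        orderOf_eq_prime (by rw [pow_two, hsq]) hg⟩
    exact IsKleinFour.nonempty_mulEquiv

namespace Pauli

lemma nonempty_kleinSubgroup_mulEquiv (i : Fin 3) : Nonempty (kleinSubgroup i ≃* Klein) :=
  nonempty_mulEquiv_klein_iff.2
    ⟨card_kleinSubgroup i, fun p => Subtype.ext (mul_self_of_mem_kleinSubgroup p.2)⟩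

lemma exists_eq_kleinSubgroup (H : Subgroup Pauli) (hH : Nonempty (H ≃* Klein)) :
    ∃ i, kleinSubgroup i = H := by
  obtain ⟨e⟩ := hH
  let p : Klein := (Multiplicative.ofAdd 1, 1)
  let q : Klein := (1, Multiplicative.ofAdd 1)
  have hne (k l : Klein) (h : k ≠ l) : (e.symm k : Pauli) ≠ e.symm l := fun h' =>
    h (e.symm.injective (Subtype.ext h'))
  have hone : (e.symm 1 : Pauli) = 1 := by simp
  have hsq (k : Klein) : (e.symm k : Pauli) * e.symm k = 1 := by
    rw [← Subgroup.coe_mul, ← map_mul, IsKleinFour.mul_self, hone]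
  obtain ⟨i, hi⟩ := eq_kleinFinset (e.symm p) (e.symm q)
    (hone ▸ hne p 1 (by decide)) (hone ▸ hne q 1 (by decide)) (hne p q (by decide))
    (hsq p) (hsq q) (by rw [← Subgroup.coe_mul, ← Subgroup.coe_mul, ← map_mul, ← map_mul, mul_comm])
  have hle : kleinSubgroup i ≤ H := by
    intro r hr
    have := hi hr
    simp only [Finset.mem_insert, Finset.mem_singleton] at this
    rcases this with rfl | rfl | rfl | rfl
    exacts [one_mem _, (e.symm p).2, (e.symm q).2, mul_mem (e.symm p).2 (e.symm q).2]
  refine ⟨i, Subgroup.eq_of_le_of_card_ge hle ?_⟩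
  rw [card_kleinSubgroup, (nonempty_mulEquiv_klein_iff.1 ⟨e⟩).1]

/-- The Klein four-subgroups of the Pauli group. -/
noncomputable def kleinSubgroupEquiv : Fin 3 ≃ {H : Subgroup Pauli // Nonempty (H ≃* Klein)} :=
  Equiv.ofBijective (fun i => ⟨kleinSubgroup i, nonempty_kleinSubgroup_mulEquiv i⟩)
    ⟨fun _ _ h => kleinSubgroup_injective (congrArg Subtype.val h), fun H =>
      (exists_eq_kleinSubgroup H.1 H.2).imp fun _ h => Subtype.ext h⟩

lemma eq_of_kleinConj {H K : {H : Subgroup Pauli // Nonempty (H ≃* Klein)}}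
    (h : kleinConj Pauli H K) : H = K := by
  obtain ⟨g, hg⟩ := h
  obtain ⟨i, hi⟩ := exists_eq_kleinSubgroup H.1 H.2
  have : H.1.Normal := hi ▸ kleinSubgroup_normal i
  exact Subtype.ext ((Subgroup.Normal.map_conj_eq H.1 g).symm.trans hg)

lemma card_quot_kleinConj : Nat.card (Quot (kleinConj Pauli)) = 3 := by
  have hbij : Function.Bijective (Quot.mk (kleinConj Pauli)) :=
    ⟨fun _ _ h => congrArg (Quot.lift id fun _ _ => eq_of_kleinConj) h, Quot.mk_surjective⟩
  rw [← Nat.card_congr (Equiv.ofBijective _ hbij), ← Nat.card_congr kleinSubgroupEquiv,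
    Nat.card_fin]

lemma card_eq : Nat.card Pauli = 16 := by
  rw [Nat.card_eq_fintype_card]; decide

end Pauli

/-- An isomorphism of groups induces a bijection of their Klein four-subgroups. -/
def kleinSubgroupsCongr {G G' : Type*} [Group G] [Group G'] (e : G ≃* G') :
    {H : Subgroup G // Nonempty (H ≃* Klein)} ≃ {H : Subgroup G' // Nonempty (H ≃* Klein)} :=
  e.mapSubgroup.toEquiv.subtypeEquiv fun H =>
    ⟨fun ⟨f⟩ => ⟨(e.subgroupMap H).symm.trans f⟩, fun ⟨f⟩ => ⟨(e.subgroupMap H).trans f⟩⟩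

lemma kleinConj_congr {G G' : Type*} [Group G] [Group G'] (e : G ≃* G')
    (H K : {H : Subgroup G // Nonempty (H ≃* Klein)}) :
    kleinConj G H K ↔ kleinConj G' (kleinSubgroupsCongr e H) (kleinSubgroupsCongr e K) := by
  refine e.toEquiv.exists_congr fun g => ?_
  have h : (H.1.map e.toMonoidHom).map (MulAut.conj (e g)).toMonoidHom =
      (H.1.map (MulAut.conj g).toMonoidHom).map e.toMonoidHom := by
    rw [Subgroup.map_map, Subgroup.map_map]
    congr 1
    ext x
    simp
  change _ ↔ (H.1.map e.toMonoidHom).map (MulAut.conj (e g)).toMonoidHom = K.1.map e.toMonoidHom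
  rw [h, (Subgroup.map_injective e.injective).eq_iff]

lemma card_quot_kleinConj_congr {G G' : Type*} [Group G] [Group G'] (e : G ≃* G') :
    Nat.card (Quot (kleinConj G)) = Nat.card (Quot (kleinConj G')) :=
  Nat.card_congr (Quot.congr (kleinSubgroupsCongr e) (kleinConj_congr e))

lemma QuaternionGroup.eq_a_two_of_orderOf_eq_two (z : QuaternionGroup 2) (hz : orderOf z = 2) :
    z = .a 2 := by
  have hsq : z * z = 1 := (pow_two z).symm.trans (orderOf_dvd_iff_pow_eq_one.1 hz.dvd)
  have hne : z ≠ 1 := by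
    rintro rfl
    simp at hz
  clear hz
  revert z; decide

/-- Let `z` be the central element of order `2` of the quaternion group `Q₈`, and let
`N` be the (normal, indeed central) subgroup of `Q₈ × ℤ/4ℤ` generated by `(z, 2)`.
Then the central product `G₁₆ = (Q₈ × ℤ/4ℤ)/N` has order `16`, and it has exactly `3`
conjugacy classes of subgroups isomorphic to the Klein four-group. -/
theorem central_product_klein_conj_classes
    (z : QuaternionGroup 2) (hz : z ∈ Subgroup.center (QuaternionGroup 2))
    (hord : orderOf z = 2) :
    Nat.card ((QuaternionGroup 2 × Multiplicative (ZMod 4)) ⧸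
        Subgroup.normalClosure
          {(z, Multiplicative.ofAdd (2 : ZMod 4))}) = 16 ∧
    Nat.card (Quot (kleinConj ((QuaternionGroup 2 × Multiplicative (ZMod 4)) ⧸
        Subgroup.normalClosure
          {(z, Multiplicative.ofAdd (2 : ZMod 4))}))) = 3 := by
  obtain rfl := QuaternionGroup.eq_a_two_of_orderOf_eq_two z hord
  exact ⟨(Nat.card_congr Pauli.centralProductEquiv.toEquiv).trans Pauli.card_eq,
    (card_quot_kleinConj_congr Pauli.centralProductEquiv).trans Pauli.card_quot_kleinConj⟩
end

section
/- Let r = −69 − 48√2 + 40√3 + 28√6 and r' = −69 + 48√2 + 40√3 − 28√6, as real numbers. Then r and r' are both roots of the polynomial x⁴ + 276x³ + 342x² − 396x − 207, and moreover 0 < r < 1 and −1 < r' < 0. -/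
/-- Each number `-69 - 48a + 40b + 28ab` with `a² = 2` and `b² = 3` is a root of
`x⁴ + 276x³ + 342x² − 396x − 207`. -/
theorem quartic_eq_zero_of_sq {R : Type*} [CommRing R] {a b x : R} (ha : a ^ 2 = 2)
    (hb : b ^ 2 = 3) (hx : x = -69 - 48 * a + 40 * b + 28 * (a * b)) :
    x ^ 4 + 276 * x ^ 3 + 342 * x ^ 2 - 396 * x - 207 = 0 := by
  have hq : x ^ 2 + 138 * x + 249 - b * (80 * x + 144) = 0 := by
    subst hx
    linear_combination (28 * b - 48) ^ 2 * ha - 32 * hb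
  linear_combination (x ^ 2 + 138 * x + 249 + b * (80 * x + 144)) * hq
    + (80 * x + 144) ^ 2 * hb

/-- Let `r = −69 − 48√2 + 40√3 + 28√6` and `r' = −69 + 48√2 + 40√3 − 28√6`.  Then `r`
and `r'` are roots of `x⁴ + 276x³ + 342x² − 396x − 207`, with `0 < r < 1` and
`−1 < r' < 0`. -/
theorem roots_of_quartic :
    let r : ℝ := -69 - 48 * Real.sqrt 2 + 40 * Real.sqrt 3 + 28 * Real.sqrt 6
    let r' : ℝ := -69 + 48 * Real.sqrt 2 + 40 * Real.sqrt 3 - 28 * Real.sqrt 6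
    r ^ 4 + 276 * r ^ 3 + 342 * r ^ 2 - 396 * r - 207 = 0 ∧
    r' ^ 4 + 276 * r' ^ 3 + 342 * r' ^ 2 - 396 * r' - 207 = 0 ∧
    0 < r ∧ r < 1 ∧ -1 < r' ∧ r' < 0 := by
  intro r r'
  have ha : √(2 : ℝ) ^ 2 = 2 := Real.sq_sqrt (by norm_num)
  have hb : √(3 : ℝ) ^ 2 = 3 := Real.sq_sqrt (by norm_num)
  have hab : √(6 : ℝ) = √2 * √3 := by
    rw [← Real.sqrt_mul (by norm_num)]
    norm_num
  have a_lower : 1.41421 < √(2 : ℝ) := Real.lt_sqrt_of_sq_lt (by norm_num)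
  have a_upper : √(2 : ℝ) < 1.41422 := (Real.sqrt_lt' (by norm_num)).2 (by norm_num)
  have b_lower : 1.73205 < √(3 : ℝ) := Real.lt_sqrt_of_sq_lt (by norm_num)
  have b_upper : √(3 : ℝ) < 1.73206 := (Real.sqrt_lt' (by norm_num)).2 (by norm_num)
  have c_lower : 2.44948 < √(6 : ℝ) := Real.lt_sqrt_of_sq_lt (by norm_num)
  have c_upper : √(6 : ℝ) < 2.44949 := (Real.sqrt_lt' (by norm_num)).2 (by norm_num)
  refine ⟨quartic_eq_zero_of_sq ha hb ?_,
    quartic_eq_zero_of_sq (a := -√2) (by rw [neg_sq, ha]) hb ?_, ?_, ?_, ?_, ?_⟩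
  · simp only [r, hab]
  · simp only [r', hab]
    ring
  all_goals
    simp only [r, r']
    linarith
end

section
/- Let F ∈ ℂ[X,Y,Z] be a homogeneous polynomial of degree 4 such that there is no nonzero point (x,y,z) ∈ ℂ³ at which all three partial derivatives ∂F/∂X, ∂F/∂Y, ∂F/∂Z vanish (i.e., the plane quartic defined by F is nonsingular). Suppose that the zero set of F in ℂ³ is invariant under the two maps (x,y,z) ↦ (−x,y,z) and (x,y,z) ↦ (x,−y,z). Then every monomial X^p Y^q Z^s appearing in F with nonzero coefficient has p, q, and s all even, and the coefficients of X⁴, Y⁴, and Z⁴ in F are all nonzero. -/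
open MvPolynomial

section

variable {σ : Type*}

/-- Over an algebraically closed field, a polynomial vanishing on the zero set of `f` has a power
divisible by `f`. -/
theorem MvPolynomial.exists_dvd_pow_of_forall_eval_eq_zero {k : Type*} [Field k] [IsAlgClosed k]
    [Finite σ] {f g : MvPolynomial σ k} (h : ∀ p, eval p f = 0 → eval p g = 0) :
    ∃ n : ℕ, f ∣ g ^ n := by
  have hg : g ∈ vanishingIdeal k (zeroLocus k (Ideal.span {f})) := by
    intro p hp
    rw [zeroLocus_span] at hp
    simpa using h p (by simpa using hp)
  rw [vanishingIdeal_zeroLocus_eq_radical] at hg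
  obtain ⟨n, hn⟩ := hg
  exact ⟨n, Ideal.mem_span_singleton.mp hn⟩

/-- An irreducible polynomial in at least two variables over an algebraically closed field has a
nonzero zero. -/
theorem Irreducible.exists_ne_zero_eval_eq_zero {k : Type*} [Field k] [IsAlgClosed k]
    [Finite σ] [Nontrivial σ] {f : MvPolynomial σ k} (hf : Irreducible f) :
    ∃ p : σ → k, p ≠ 0 ∧ eval p f = 0 := by
  classical
  by_contra! h
  have hX (i : σ) : f ∣ X i := by
    obtain ⟨n, hn⟩ := exists_dvd_pow_of_forall_eval_eq_zero (f := f) (g := X i) fun p hp => by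
      have : p = 0 := by
        by_contra hp0
        exact h p hp0 hp
      simp [this]
    exact hf.prime.dvd_of_dvd_pow hn
  obtain ⟨i, j, hij⟩ := exists_pair_ne σ
  obtain ⟨g, hg⟩ := ((hf.associated_of_dvd X_prime.irreducible (hX i)).dvd_iff_dvd_left).mp (hX j)
  have := congrArg (eval (Pi.single j 1)) hg
  simp [hij] at this

/-- A polynomial without nonzero singular points is squarefree. -/
theorem MvPolynomial.squarefree_of_nonsingular {k : Type*} [Field k] [IsAlgClosed k]
    [Finite σ] [Nontrivial σ] {f : MvPolynomial σ k}
    (hf : ¬ ∃ p : σ → k, p ≠ 0 ∧ ∀ i, eval p (pderiv i f) = 0) : Squarefree f := by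
  have hf0 : f ≠ 0 := by
    rintro rfl
    exact hf ⟨1, one_ne_zero, by simp⟩
  rw [squarefree_iff_no_irreducibles hf0]
  rintro g hg ⟨q, rfl⟩
  obtain ⟨p, hp0, hp⟩ := hg.exists_ne_zero_eval_eq_zero
  exact hf ⟨p, hp0, fun i => by simp [hp]⟩

/-- The algebra endomorphism negating the variable `X i`. -/
noncomputable def MvPolynomial.negVar {R : Type*} [CommRing R] [DecidableEq σ] (i : σ) :
    MvPolynomial σ R →ₐ[R] MvPolynomial σ R :=
  aeval (Function.update X i (-X i))

theorem MvPolynomial.eval_negVar {R : Type*} [CommRing R] [DecidableEq σ] (i : σ) (p : σ → R)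
    (f : MvPolynomial σ R) :
    eval p (negVar i f) = eval (Function.update p i (-p i)) f := by
  induction f using MvPolynomial.induction_on with
  | C a => simp [negVar]
  | add f g hf hg => simp [hf, hg]
  | mul_X f j hf =>
    rw [map_mul, map_mul, map_mul, hf]
    by_cases hj : j = i <;> simp [negVar, hj]

theorem MvPolynomial.negVar_negVar {R : Type*} [CommRing R] [DecidableEq σ] (i : σ)
    (f : MvPolynomial σ R) : negVar i (negVar i f) = f := by
  induction f using MvPolynomial.induction_on with
  | C a => simp [negVar]
  | add f g hf hg => simp [hf, hg]
  | mul_X f j hf =>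
    rw [map_mul, map_mul, hf]
    by_cases hj : j = i <;> simp [negVar, hj]

theorem MvPolynomial.negVar_monomial {R : Type*} [CommRing R] [DecidableEq σ] (i : σ)
    (n : σ →₀ ℕ) (a : R) : negVar i (monomial n a) = monomial n ((-1) ^ n i * a) := by
  induction n using Finsupp.induction_linear generalizing a with
  | zero => simp [negVar]
  | add m n hm hn =>
    rw [← one_mul a, ← monomial_mul, map_mul, hm, hn, monomial_mul, Finsupp.add_apply, pow_add]
    ring_nf
  | single j m =>
    by_cases hj : j = i
    · subst hj
      simp [negVar, neg_pow (X j : MvPolynomial σ R), monomial_eq, mul_comm, mul_assoc]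
    · simp [negVar, monomial_eq, hj]

theorem MvPolynomial.coeff_negVar {R : Type*} [CommRing R] [DecidableEq σ] (i : σ)
    (n : σ →₀ ℕ) (f : MvPolynomial σ R) : coeff n (negVar i f) = (-1) ^ n i * coeff n f := by
  induction f using MvPolynomial.induction_on' with
  | monomial m a =>
    rw [negVar_monomial, coeff_monomial, coeff_monomial]
    split_ifs with h <;> simp [h]
  | add f g hf hg => rw [map_add, coeff_add, coeff_add, hf, hg, mul_add]

/-- If the zero set of a squarefree polynomial is invariant under negating the `i`-th coordinate,
then negating `X i` preserves the polynomial up to sign. -/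
theorem Squarefree.negVar_eq_or_eq_neg {k : Type*} [Field k] [IsAlgClosed k] [Finite σ]
    [DecidableEq σ] {f : MvPolynomial σ k} (hf : Squarefree f) (i : σ)
    (h : ∀ p, eval p f = 0 → eval (Function.update p i (-p i)) f = 0) :
    negVar i f = f ∨ negVar i f = -f := by
  obtain ⟨n, hn⟩ := exists_dvd_pow_of_forall_eval_eq_zero (f := f) (g := negVar i f)
    fun p hp => by rw [eval_negVar, h p hp]
  obtain ⟨g, hg⟩ := hf.isRadical n _ hn
  have hgg : g * negVar i g = 1 := by
    have := negVar_negVar i f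
    rw [hg, map_mul, hg, mul_assoc] at this
    exact mul_left_cancel₀ hf.ne_zero (this.trans (mul_one f).symm)
  obtain ⟨c, -, rfl⟩ := isUnit_iff_eq_C_of_isReduced.mp (IsUnit.of_mul_eq_one _ hgg)
  have hc : c * c = 1 := by
    apply C_injective σ k
    simpa [negVar] using hgg
  rcases mul_self_eq_one_iff.mp hc with rfl | rfl
  · left; simp [hg]
  · right; simp [hg]

theorem MvPolynomial.IsHomogeneous.eval_smul {R : Type*} [CommSemiring R] {f : MvPolynomial σ R}
    {d : ℕ} (hf : f.IsHomogeneous d) (c : R) (p : σ → R) :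
    eval (c • p) f = c ^ d * eval p f := by
  rw [eval_eq, eval_eq, Finset.mul_sum]
  refine Finset.sum_congr rfl fun n hn => ?_
  rw [hf.degree_eq_sum_deg_support hn]
  simp only [Pi.smul_apply, smul_eq_mul, mul_pow, Finset.prod_mul_distrib,
    Finset.prod_pow_eq_pow_sum]
  ring

theorem MvPolynomial.IsHomogeneous.eval_single {R : Type*} [CommSemiring R] [DecidableEq σ]
    {f : MvPolynomial σ R} {d : ℕ} (hf : f.IsHomogeneous d) (i : σ) :
    eval (Pi.single i 1) f = coeff (Finsupp.single i d) f := by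
  rw [eval_eq, Finset.sum_eq_single (Finsupp.single i d)]
  · rw [Finset.prod_eq_one, mul_one]
    intro j hj
    by_cases hij : j = i
    · simp [hij]
    · simp [Ne.symm hij] at hj
  · intro n hn hne
    obtain ⟨j, hj, hji⟩ : ∃ j ∈ n.support, j ≠ i := by
      by_contra! h
      have hsub : n.support ⊆ {i} := fun j hj => by simpa using h j hj
      have hn' := Finsupp.support_subset_singleton.mp hsub
      have hd := hf.degree_eq_sum_deg_support hn
      apply hne
      rw [hn'] at hd ⊢
      rw [← Finsupp.degree_apply, Finsupp.degree_single] at hd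
      rw [hd]
    rw [Finset.prod_eq_zero hj, mul_zero]
    simp [hji, Finsupp.mem_support_iff.mp hj]
  · intro h
    simp [notMem_support_iff.mp h]

/-- A polynomial function without zeros on an affine line over an algebraically closed field is
constant on it. -/
theorem MvPolynomial.eval_add_smul_eq_of_ne_zero {k : Type*} [Field k] [IsAlgClosed k]
    (f : MvPolynomial σ k) (p q : σ → k) (h : ∀ t : k, eval (p + t • q) f ≠ 0) (s t : k) :
    eval (p + s • q) f = eval (p + t • q) f := by
  let g : Polynomial k := aeval (fun i => Polynomial.C (p i) + Polynomial.X * Polynomial.C (q i)) f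
  have hg (t : k) : g.eval t = eval (p + t • q) f := by
    have : g.eval t = Polynomial.aeval t g := by simp
    rw [this, comp_aeval_apply, ← coe_aeval_eq_eval]
    simp [Pi.add_def, fun i => mul_comm (q i) t]
  have hdeg : g.degree = 0 := by
    by_contra hne
    obtain ⟨t, ht⟩ := IsAlgClosed.exists_root g hne
    exact h t (by rw [← hg, ht])
  rw [← hg, ← hg, Polynomial.eq_C_of_degree_eq_zero hdeg]
  simp

/-- A form of positive degree has a zero on one of the affine lines `p + t q`, `q + t p`. -/
theorem MvPolynomial.IsHomogeneous.exists_eval_line_eq_zero {k : Type*} [Field k] [IsAlgClosed k]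
    [CharZero k] {f : MvPolynomial σ k} {d : ℕ} (hf : f.IsHomogeneous d) (hd : d ≠ 0)
    (p q : σ → k) : ∃ t : k, eval (p + t • q) f = 0 ∨ eval (q + t • p) f = 0 := by
  by_contra! h
  have hp := eval_add_smul_eq_of_ne_zero f p q (fun t => (h t).1) 1 2
  have hq := eval_add_smul_eq_of_ne_zero f q p (fun t => (h t).2) 1 2⁻¹
  have hpq : p + (2 : k) • q = (2 : k) • (q + (2⁻¹ : k) • p) := by
    ext i
    simp
    ring
  rw [hpq, hf.eval_smul, ← hq, one_smul, one_smul, add_comm q p, eq_comm] at hp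
  have h1 := (h 1).1
  rw [one_smul] at h1
  have h2 : (2 : k) ^ d = 1 := (mul_eq_right₀ h1).mp hp
  have h3 : (2 : ℕ) ^ d = 1 := by exact_mod_cast h2
  simp [hd] at h3

/-- A form of degree at least two in three or more variables which is odd in one variable has a
nonzero singular point. -/
theorem MvPolynomial.IsHomogeneous.exists_singular_of_negVar_eq_neg {k : Type*} [Field k]
    [IsAlgClosed k] [CharZero k] [DecidableEq σ] {f : MvPolynomial σ k} {d : ℕ}
    (hf : f.IsHomogeneous d) (hd : 2 ≤ d) {i j l : σ} (hij : i ≠ j) (hil : i ≠ l) (hjl : j ≠ l)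
    (hodd : negVar i f = -f) : ∃ p : σ → k, p ≠ 0 ∧ ∀ m, eval p (pderiv m f) = 0 := by
  have hcoeff (n : σ →₀ ℕ) (hn : n i = 0) : coeff n f = 0 := by
    have := congrArg (coeff n) hodd
    rw [coeff_negVar, hn, coeff_neg, pow_zero, one_mul] at this
    exact self_eq_neg.mp this
  obtain ⟨p, hp0, hpi, hp⟩ : ∃ p : σ → k, p ≠ 0 ∧ p i = 0 ∧ eval p (pderiv i f) = 0 := by
    obtain ⟨t, ht | ht⟩ := (hf.pderiv (i := i)).exists_eval_line_eq_zero (by omega)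
      (Pi.single j 1) (Pi.single l 1)
    · exact ⟨_, fun h => by simpa [hjl] using congrFun h j, by simp [hij, hil], ht⟩
    · exact ⟨_, fun h => by simpa [hjl.symm] using congrFun h l, by simp [hij, hil], ht⟩
  refine ⟨p, hp0, fun m => ?_⟩
  by_cases hm : m = i
  · rwa [hm]
  rw [eval_eq]
  refine Finset.sum_eq_zero fun n hn => ?_
  have hni : n i ≠ 0 := by
    intro hni
    rw [mem_support_iff, coeff_pderiv, hcoeff _ (by simp [hni, hm])] at hn
    simp at hn
  rw [Finset.prod_eq_zero (Finsupp.mem_support_iff.mpr hni), mul_zero]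
  rw [hpi, zero_pow hni]

end

/-- Let `F ∈ ℂ[X,Y,Z]` be homogeneous of degree `4`, defining a nonsingular plane
quartic (no nonzero point of `ℂ³` where all partial derivatives vanish).  If the zero
set of `F` in `ℂ³` is invariant under `(x,y,z) ↦ (−x,y,z)` and `(x,y,z) ↦ (x,−y,z)`,
then every monomial of `F` with nonzero coefficient has all three exponents even, and
the coefficients of `X⁴`, `Y⁴`, and `Z⁴` in `F` are all nonzero. -/
theorem invariant_nonsingular_quartic_even_exponents (F : MvPolynomial (Fin 3) ℂ)
    (hhom : F.IsHomogeneous 4)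
    (hns : ¬ ∃ p : Fin 3 → ℂ, p ≠ 0 ∧ ∀ i : Fin 3, eval p (pderiv i F) = 0)
    (hinv1 : ∀ x y z : ℂ, eval ![x, y, z] F = 0 → eval ![-x, y, z] F = 0)
    (hinv2 : ∀ x y z : ℂ, eval ![x, y, z] F = 0 → eval ![x, -y, z] F = 0) :
    (∀ n : Fin 3 →₀ ℕ, coeff n F ≠ 0 → Even (n 0) ∧ Even (n 1) ∧ Even (n 2)) ∧
    coeff (Finsupp.single (0 : Fin 3) 4) F ≠ 0 ∧
    coeff (Finsupp.single (1 : Fin 3) 4) F ≠ 0 ∧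
    coeff (Finsupp.single (2 : Fin 3) 4) F ≠ 0 := by
  have hsq := squarefree_of_nonsingular hns
  have heven (i j l : Fin 3) (hij : i ≠ j) (hil : i ≠ l) (hjl : j ≠ l)
      (h : ∀ p, eval p F = 0 → eval (Function.update p i (-p i)) F = 0)
      (n : Fin 3 →₀ ℕ) (hn : coeff n F ≠ 0) : Even (n i) := by
    rcases hsq.negVar_eq_or_eq_neg i h with hF | hF
    · by_contra ho
      have := congrArg (coeff n) hF
      rw [coeff_negVar, (Nat.not_even_iff_odd.mp ho).neg_one_pow, neg_one_mul] at this
      exact hn (neg_eq_self.mp this)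
    · exact absurd
        (hhom.exists_singular_of_negVar_eq_neg (by norm_num) hij hil hjl hF) hns
  have h0 := heven 0 1 2 (by decide) (by decide) (by decide) fun p hp => by
    have hp' : p = ![p 0, p 1, p 2] := by ext i; fin_cases i <;> rfl
    rw [hp'] at hp
    have := hinv1 _ _ _ hp
    rwa [show ![-p 0, p 1, p 2] = Function.update p 0 (-p 0) by
      ext i; fin_cases i <;> simp] at this
  have h1 := heven 1 0 2 (by decide) (by decide) (by decide) fun p hp => by
    have hp' : p = ![p 0, p 1, p 2] := by ext i; fin_cases i <;> rfl
    rw [hp'] at hp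
    have := hinv2 _ _ _ hp
    rwa [show ![p 0, -p 1, p 2] = Function.update p 1 (-p 1) by
      ext i; fin_cases i <;> simp] at this
  have hall (n : Fin 3 →₀ ℕ) (hn : coeff n F ≠ 0) : ∀ i, Even (n i) := by
    have hdeg : n 0 + n 1 + n 2 = 4 := by
      have : n.degree = 4 := by
        by_contra hne
        exact hn (hhom.coeff_eq_zero hne)
      rwa [Finsupp.degree_eq_sum, Fin.sum_univ_three] at this
    have e0 := h0 n hn
    have e1 := h1 n hn
    have e2 : Even (n 2) := by grind
    intro i
    fin_cases i
    exacts [e0, e1, e2]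
  have hpure (i : Fin 3) : coeff (Finsupp.single i 4) F ≠ 0 := by
    intro hi
    refine hns ⟨Pi.single i 1, by simp, fun j => ?_⟩
    rw [(hhom.pderiv (i := j)).eval_single, coeff_pderiv]
    by_cases hij : j = i
    · subst hij
      rw [← Finsupp.single_add, hi, zero_mul]
    · have : coeff (Finsupp.single i (4 - 1) + Finsupp.single j 1) F = 0 := by
        by_contra hne
        have := hall _ hne j
        simp [Ne.symm hij] at this
      rw [this, zero_mul]
  exact ⟨fun n hn => ⟨hall n hn 0, hall n hn 1, hall n hn 2⟩, hpure 0, hpure 1, hpure 2⟩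
end
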